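/- arXiv:1211.2762 — 5 statements merged into one kernel-verified Lean document; each statement's English description precedes it below -/
import Mathlib

section
/- For every real α ≠ 0, the Cauchy problem u''(r) + (n−1)(ψ'(r)/ψ(r)) u'(r) + |u(r)|^{p−1} u(r) = 0 for r > 0, u(0) = α, u'(0) = 0, admits a global C² solution u on [0, ∞); moreover lim_{r→∞} u'(r) = 0 and lim_{r→∞} u(r) exists and is finite. -/
open Real MeasureTheory Filter Set Asymptotics

noncomputable section

/-- (H1): ψ is C² on [0,∞), ψ(0) = ψ''(0) = 0, ψ'(0) = 1, ψ > 0 on (0,∞). -/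
def H1 (ψ : ℝ → ℝ) : Prop :=
  ContDiffOn ℝ 2 ψ (Ici 0) ∧ ψ 0 = 0 ∧ deriv ψ 0 = 1 ∧
    deriv (deriv ψ) 0 = 0 ∧ ∀ r > (0 : ℝ), 0 < ψ r

/-- (H2): ψ' ≥ 0 on (0,∞). -/
def H2 (ψ : ℝ → ℝ) : Prop := ∀ r > (0 : ℝ), 0 ≤ deriv ψ r

/-- (H3): liminf_{r→∞} ψ'(r)/ψ(r) > 0, i.e. ψ'/ψ is eventually bounded below
by a positive constant. -/
def H3 (ψ : ℝ → ℝ) : Prop := ∃ c > (0 : ℝ), ∀ᶠ r in atTop, c ≤ deriv ψ r / ψ r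

/-- A radial solution of the Lane–Emden–Fowler equation with initial value α. -/
def IsRadialSolution (n : ℕ) (p : ℝ) (ψ u : ℝ → ℝ) (α : ℝ) : Prop :=
  ContDiffOn ℝ 2 u (Ici 0) ∧ u 0 = α ∧ deriv u 0 = 0 ∧
    ∀ r > (0 : ℝ), deriv (deriv u) r + ((n : ℝ) - 1) * (deriv ψ r / ψ r) * deriv u r
      + |u r| ^ (p - 1) * u r = 0


/-- The weighted primitive `w(s)⁻¹ ∫₀ˢ w(t) h(t) dt`. -/
def weightedPrimitive (w h : ℝ → ℝ) (s : ℝ) : ℝ := (∫ t in (0 : ℝ)..s, w t * h t) / w s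

/-- A continuous nondecreasing weight that vanishes exactly on `(-∞, 0]`. -/
structure IsRadialWeight (w : ℝ → ℝ) : Prop where
  continuous : Continuous w
  monotone : Monotone w
  eq_zero : ∀ t ≤ 0, w t = 0
  pos : ∀ t > 0, 0 < w t

namespace IsRadialWeight

variable {w : ℝ → ℝ} (hw : IsRadialWeight w)
include hw

theorem nonneg (t : ℝ) : 0 ≤ w t := by
  rcases le_or_gt t 0 with h | h
  · exact (hw.eq_zero t h).ge
  · exact (hw.pos t h).le

theorem weightedPrimitive_of_nonpos (h : ℝ → ℝ) {s : ℝ} (hs : s ≤ 0) :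
    weightedPrimitive w h s = 0 := by
  simp [weightedPrimitive, hw.eq_zero s hs]

theorem abs_weightedPrimitive_le {h : ℝ → ℝ} (hh : Continuous h) {s : ℝ} (hs : 0 ≤ s) :
    |weightedPrimitive w h s| ≤ ∫ t in (0 : ℝ)..s, |h t| := by
  rcases hs.eq_or_lt with rfl | hs'
  · simp [weightedPrimitive]
  have hws := hw.pos s hs'
  rw [weightedPrimitive, abs_div, abs_of_pos hws, div_le_iff₀ hws, 
    ← intervalIntegral.integral_mul_const]
  refine (intervalIntegral.abs_integral_le_integral_abs hs).trans ?_
  refine intervalIntegral.integral_mono_on hs ?_ ?_ fun t ht => ?_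
  · exact (hw.continuous.mul hh).abs.intervalIntegrable _ _
  · exact (hh.abs.mul continuous_const).intervalIntegrable _ _
  · rw [abs_mul, abs_of_nonneg (hw.nonneg t), mul_comm]
    exact mul_le_mul_of_nonneg_left (hw.monotone ht.2) (abs_nonneg _)

theorem continuous_weightedPrimitive {h : ℝ → ℝ} (hh : Continuous h) :
    Continuous (weightedPrimitive w h) := by
  have hint : Continuous fun s => ∫ t in (0 : ℝ)..s, w t * h t :=
    intervalIntegral.continuous_primitive
      (fun a b => (hw.continuous.mul hh).intervalIntegrable a b) 0
  have habs : Continuous fun s => ∫ t in (0 : ℝ)..s, |h t| :=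
    intervalIntegral.continuous_primitive (fun a b => hh.abs.intervalIntegrable a b) 0
  rw [continuous_iff_continuousAt]
  intro s
  rcases lt_trichotomy s 0 with hs | rfl | hs
  · refine (continuousAt_const (y := (0 : ℝ))).congr ?_
    filter_upwards [Iio_mem_nhds hs] with t ht
    exact (hw.weightedPrimitive_of_nonpos h (le_of_lt ht)).symm
  · rw [ContinuousAt, hw.weightedPrimitive_of_nonpos h le_rfl]
    refine squeeze_zero_norm (a := fun s => |(∫ t in (0 : ℝ)..s, |h t|)|) (fun t => ?_) ?_
    · rcases le_total t 0 with ht | ht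
      · simp [hw.weightedPrimitive_of_nonpos h ht]
      · exact (hw.abs_weightedPrimitive_le hh ht).trans (le_abs_self _)
    · simpa using habs.abs.tendsto 0
  · exact hint.continuousAt.div hw.continuous.continuousAt (hw.pos s hs).ne'

theorem weightedPrimitive_sub {h k : ℝ → ℝ} (hh : Continuous h) (hk : Continuous k) (s : ℝ) :
    weightedPrimitive w (fun t => h t - k t) s
      = weightedPrimitive w h s - weightedPrimitive w k s := by
  simp only [weightedPrimitive, mul_sub]
  have := intervalIntegral.integral_sub (μ := volume)
    ((hw.continuous.mul hh).intervalIntegrable 0 s) ((hw.continuous.mul hk).intervalIntegrable 0 s)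
  simp only [Pi.mul_apply] at this
  rw [this, sub_div]

omit hw in
theorem integral_mul_exp_le {B l : ℝ} (hB : 0 ≤ B) (hl : 0 < l) (s : ℝ) :
    ∫ t in (0 : ℝ)..s, B * exp (l * t) ≤ B / l * exp (l * s) := by
  have hd : ∀ t ∈ uIcc 0 s, HasDerivAt (fun t => B / l * exp (l * t)) (B * exp (l * t)) t := by
    intro t _
    have h := ((hasDerivAt_id t).const_mul l).exp.const_mul (B / l)
    simp only [id, mul_one] at h
    refine h.congr_deriv ?_
    field_simp
  rw [intervalIntegral.integral_eq_sub_of_hasDerivAt hd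
    ((by fun_prop : Continuous fun t => B * exp (l * t)).intervalIntegrable _ _)]
  have : 0 ≤ B / l * exp (l * 0) := by positivity
  linarith

theorem abs_integral_weightedPrimitive_le {h : ℝ → ℝ} (hh : Continuous h) {B l : ℝ} (hB : 0 ≤ B)
    (hl : 0 < l) (hle : ∀ t ≥ 0, |h t| ≤ B * exp (l * t)) (r : ℝ) :
    |∫ s in (0 : ℝ)..r, weightedPrimitive w h s| ≤ B / l / l * exp (l * max r 0) := by
  have hexp : ∀ C : ℝ, Continuous fun t => C * exp (l * t) := fun C => by fun_prop
  rcases le_total r 0 with hr | hr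
  · have : ∫ s in (0 : ℝ)..r, weightedPrimitive w h s = ∫ s in (0 : ℝ)..r, (0 : ℝ) := by
      refine intervalIntegral.integral_congr fun s hs => ?_
      rw [uIcc_of_ge hr] at hs
      exact hw.weightedPrimitive_of_nonpos h hs.2
    rw [this]
    simp only [intervalIntegral.integral_zero, abs_zero]
    positivity
  · rw [max_eq_left hr]
    refine (intervalIntegral.abs_integral_le_integral_abs hr).trans ?_
    refine le_trans ?_ (integral_mul_exp_le (div_nonneg hB hl.le) hl r)
    refine intervalIntegral.integral_mono_on hr
      ((hw.continuous_weightedPrimitive hh).abs.intervalIntegrable _ _)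
      ((hexp _).intervalIntegrable _ _) fun s hs => ?_
    refine (hw.abs_weightedPrimitive_le hh hs.1).trans ?_
    refine le_trans ?_ (integral_mul_exp_le hB hl s)
    exact intervalIntegral.integral_mono_on hs.1 (hh.abs.intervalIntegrable _ _)
      ((hexp _).intervalIntegrable _ _) fun t ht => hle t ht.1

/-- Global solvability of the Volterra equation for a Lipschitz nonlinearity: the right-hand side
is a contraction for an exponentially weighted supremum norm. -/
theorem exists_volterra_solution {g : ℝ → ℝ} {K : NNReal} (hg : LipschitzWith K g) (α : ℝ) :
    ∃ u : ℝ → ℝ, Continuous u ∧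
      ∀ r, u r = α - ∫ s in (0 : ℝ)..r, weightedPrimitive w (fun t => g (u t)) s := by
  obtain ⟨l, hl, hKl⟩ : ∃ l : ℝ, 0 < l ∧ (K : ℝ) / l / l ≤ 1 / 2 := by
    refine ⟨1 + 2 * K, by positivity, ?_⟩
    have hK : (0 : ℝ) ≤ K := K.2
    rw [div_div, div_le_iff₀ (by positivity)]
    nlinarith
  set e : ℝ → ℝ := fun t => exp (l * max t 0) with he
  have hec : Continuous e := by fun_prop
  have hepos : ∀ t, 0 < e t := fun t => exp_pos _
  have heone : ∀ t, 1 ≤ e t := fun t => one_le_exp (by positivity)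
  have hgc := hg.continuous
  have hcont : ∀ x : BoundedContinuousFunction ℝ ℝ, Continuous fun t => g (e t * x t) :=
    fun x => hgc.comp (hec.mul x.continuous)
  have hprim : ∀ x : BoundedContinuousFunction ℝ ℝ, Continuous fun r =>
      ∫ s in (0 : ℝ)..r, weightedPrimitive w (fun t => g (e t * x t)) s := fun x =>
    intervalIntegral.continuous_primitive
      (fun a b => (hw.continuous_weightedPrimitive (hcont x)).intervalIntegrable a b) 0
  have hbound : ∀ (x : BoundedContinuousFunction ℝ ℝ) (r : ℝ),
      ‖(α - ∫ s in (0 : ℝ)..r, weightedPrimitive w (fun t => g (e t * x t)) s) / e r‖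
        ≤ |α| + (|g 0| + K * ‖x‖) / l / l := by
    intro x r
    have hle := hw.abs_integral_weightedPrimitive_le (hcont x) (B := |g 0| + K * ‖x‖)
      (by positivity) hl (fun t ht => by
        have hd := hg.dist_le_mul (e t * x t) 0
        rw [Real.dist_eq, Real.dist_eq, sub_zero, abs_mul, abs_of_pos (hepos t)] at hd
        have hx : |x t| ≤ ‖x‖ := x.norm_coe_le_norm t
        have het : e t = exp (l * t) := by simp [he, max_eq_left ht]
        rw [← het]
        have h1 : |g (e t * x t)| ≤ |g 0| + K * (e t * |x t|) := by
          have := abs_sub_abs_le_abs_sub (g (e t * x t)) (g 0)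
          linarith
        have h2 : (K : ℝ) * (e t * |x t|) ≤ K * (e t * ‖x‖) := by
          have := hepos t
          gcongr
        nlinarith [abs_nonneg (g 0), heone t]) r
    rw [Real.norm_eq_abs, abs_div, abs_of_pos (hepos r), div_le_iff₀ (hepos r)]
    have h3 := abs_sub α (∫ s in (0 : ℝ)..r, weightedPrimitive w (fun t => g (e t * x t)) s)
    nlinarith [abs_nonneg α, heone r]
  let Φ : BoundedContinuousFunction ℝ ℝ → BoundedContinuousFunction ℝ ℝ := fun x =>
    BoundedContinuousFunction.ofNormedAddCommGroup
      (fun r => (α - ∫ s in (0 : ℝ)..r, weightedPrimitive w (fun t => g (e t * x t)) s) / e r)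
      ((continuous_const.sub (hprim x)).div hec fun r => (hepos r).ne') _ (hbound x)
  have hΦ : ContractingWith (1 / 2 : NNReal) Φ := by
    refine ⟨by norm_num, LipschitzWith.of_dist_le_mul fun x y => ?_⟩
    refine (BoundedContinuousFunction.dist_le (by positivity)).2 fun r => ?_
    have hle := hw.abs_integral_weightedPrimitive_le
      (h := fun t => g (e t * x t) - g (e t * y t)) ((hcont x).sub (hcont y))
      (B := K * dist x y) (by positivity) hl (fun t ht => by
        have hd := hg.dist_le_mul (e t * x t) (e t * y t)
        rw [Real.dist_eq, Real.dist_eq, ← mul_sub, abs_mul, abs_of_pos (hepos t)] at hd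
        have hx : |x t - y t| ≤ dist x y :=
          BoundedContinuousFunction.dist_coe_le_dist (f := x) (g := y) t
        have het : e t = exp (l * t) := by simp [he, max_eq_left ht]
        rw [← het]
        refine hd.trans ?_
        have := hepos t
        calc (K : ℝ) * (e t * |x t - y t|) ≤ K * (e t * dist x y) := by gcongr
          _ = _ := by ring) r
    have hsub : ∫ s in (0 : ℝ)..r,
        weightedPrimitive w (fun t => g (e t * x t) - g (e t * y t)) s
        = (∫ s in (0 : ℝ)..r, weightedPrimitive w (fun t => g (e t * x t)) s)
          - ∫ s in (0 : ℝ)..r, weightedPrimitive w (fun t => g (e t * y t)) s := by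
      rw [← intervalIntegral.integral_sub
        ((hw.continuous_weightedPrimitive (hcont x)).intervalIntegrable _ _)
        ((hw.continuous_weightedPrimitive (hcont y)).intervalIntegrable _ _)]
      exact intervalIntegral.integral_congr fun s _ =>
        hw.weightedPrimitive_sub (hcont x) (hcont y) s
    rw [hsub] at hle
    simp only [Φ, BoundedContinuousFunction.coe_ofNormedAddCommGroup]
    rw [Real.dist_eq, ← sub_div, abs_div, abs_of_pos (hepos r), div_le_iff₀ (hepos r),
      sub_sub_sub_cancel_left, abs_sub_comm]
    refine hle.trans (mul_le_mul_of_nonneg_right ?_ (hepos r).le)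
    have : (K : ℝ) * dist x y / l / l = K / l / l * dist x y := by ring
    rw [this]
    push_cast
    exact mul_le_mul_of_nonneg_right hKl dist_nonneg
  obtain ⟨x, hx⟩ : ∃ x, Φ x = x := ⟨_, hΦ.fixedPoint_isFixedPt⟩
  refine ⟨fun t => e t * x t, hec.mul x.continuous, fun r => ?_⟩
  have hxr : (Φ x) r = x r := by rw [hx]
  simp only [Φ, BoundedContinuousFunction.coe_ofNormedAddCommGroup] at hxr
  change e r * x r = _
  rw [← hxr, mul_div_cancel₀ _ (hepos r).ne']

end IsRadialWeight

theorem hasDerivAt_abs_rpow_mul_self {p : ℝ} (hp : 1 < p) (x : ℝ) :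
    HasDerivAt (fun y : ℝ => |y| ^ (p - 1) * y) (p * |x| ^ (p - 1)) x := by
  have hpos : ∀ x : ℝ, 0 < x →
      HasDerivAt (fun y : ℝ => |y| ^ (p - 1) * y) (p * |x| ^ (p - 1)) x := by
    intro x hx
    rw [abs_of_pos hx]
    refine (Real.hasDerivAt_rpow_const (Or.inl hx.ne')).congr_of_eventuallyEq ?_
    filter_upwards [Ioi_mem_nhds hx] with y hy
    rw [abs_of_pos hy, ← Real.rpow_add_one (ne_of_gt hy), sub_add_cancel]
  rcases lt_trichotomy x 0 with hx | rfl | hx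
  · have := ((hpos (-x) (neg_pos.2 hx)).comp x (hasDerivAt_neg x)).neg
    simpa [Function.comp_def, Pi.neg_def] using this
  · have h0 : p - 1 ≠ 0 := by linarith
    rw [hasDerivAt_iff_tendsto_slope_zero]
    have hlim : Tendsto (fun t : ℝ => |t| ^ (p - 1)) (nhdsWithin 0 {0}ᶜ)
        (nhds (p * |(0 : ℝ)| ^ (p - 1))) := by
      have hc : Continuous fun t : ℝ => |t| ^ (p - 1) :=
        continuous_abs.rpow_const fun _ => Or.inr (by linarith)
      have := (hc.tendsto 0).mono_left (nhdsWithin_le_nhds (s := {0}ᶜ))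
      simpa [Real.zero_rpow h0] using this
    refine hlim.congr' ?_
    filter_upwards [self_mem_nhdsWithin] with t ht
    have ht' : t ≠ 0 := ht
    simp only [zero_add, mul_zero, sub_zero, smul_eq_mul]
    field_simp
  · exact hpos x hx

/-- The nonlinearity `|x|^(p-1) x`, extended by constants outside `[-A, A]`. -/
def truncatedPower (p A x : ℝ) : ℝ := |max (-A) (min A x)| ^ (p - 1) * max (-A) (min A x)

theorem truncatedPower_eq (p : ℝ) {A x : ℝ} (hx : |x| ≤ A) :
    truncatedPower p A x = |x| ^ (p - 1) * x := by
  rw [truncatedPower, min_eq_right (abs_le.1 hx).2, max_eq_right (abs_le.1 hx).1]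

theorem truncatedPower_neg (p : ℝ) {A : ℝ} (hA : 0 ≤ A) (x : ℝ) :
    truncatedPower p A (-x) = -truncatedPower p A x := by
  have : max (-A) (min A (-x)) = -max (-A) (min A x) := by
    rw [← min_neg_neg, ← max_neg_neg, neg_neg, max_min_distrib_left, max_eq_right (by linarith)]
  rw [truncatedPower, this, abs_neg, mul_neg, truncatedPower]

theorem truncatedPower_pos (p : ℝ) {A x : ℝ} (hA : 0 < A) (hx : 0 < x) :
    0 < truncatedPower p A x := by
  have : 0 < max (-A) (min A x) := lt_max_of_lt_right (lt_min hA hx)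
  unfold truncatedPower
  positivity

theorem exists_lipschitzWith_truncatedPower {p : ℝ} (hp : 1 < p) {A : ℝ} (hA : 0 < A) :
    ∃ K : NNReal, LipschitzWith K (truncatedPower p A) := by
  have hB : 0 ≤ p * A ^ (p - 1) := by positivity
  have h1 : LipschitzOnWith (p * A ^ (p - 1)).toNNReal
      (fun y : ℝ => |y| ^ (p - 1) * y) (Icc (-A) A) := by
    refine (convex_Icc (-A) A).lipschitzOnWith_of_nnnorm_hasDerivWithin_le
      (fun x _ => (hasDerivAt_abs_rpow_mul_self hp x).hasDerivWithinAt) fun x hx => ?_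
    rw [← NNReal.coe_le_coe, coe_nnnorm, Real.norm_eq_abs, abs_of_nonneg (by positivity),
      Real.coe_toNNReal _ hB]
    have := abs_le.2 hx
    gcongr
  have h2 : LipschitzWith 1 fun x : ℝ => max (-A) (min A x) :=
    (LipschitzWith.id.const_min A).const_max (-A)
  have h3 := h1.comp (h2.lipschitzOnWith (s := univ)) fun x _ =>
    ⟨le_max_left _ _, max_le (by linarith) (min_le_left _ _)⟩
  exact ⟨_, lipschitzOnWith_univ.1 h3⟩

section Potential

variable {g : ℝ → ℝ} (hgc : Continuous g) (hodd : ∀ x, g (-x) = -g x) (hpos : ∀ x > 0, 0 < g x)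

include hodd in
theorem integral_odd_eq_abs (x : ℝ) : ∫ t in (0 : ℝ)..x, g t = ∫ t in (0 : ℝ)..|x|, g t := by
  rcases abs_cases x with ⟨h, _⟩ | ⟨h, _⟩
  · rw [h]
  · have := intervalIntegral.integral_comp_neg (a := 0) (b := -x) g
    simp only [hodd, intervalIntegral.integral_neg, neg_neg, neg_zero] at this
    rw [h, intervalIntegral.integral_symm, ← this, neg_neg]

include hgc hodd hpos in
theorem integral_odd_lt {x y : ℝ} (h : |x| < |y|) :
    ∫ t in (0 : ℝ)..x, g t < ∫ t in (0 : ℝ)..y, g t := by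
  rw [integral_odd_eq_abs hodd x, integral_odd_eq_abs hodd y, ← sub_pos,
    intervalIntegral.integral_interval_sub_left (hgc.intervalIntegrable _ _)
      (hgc.intervalIntegrable _ _)]
  exact intervalIntegral.intervalIntegral_pos_of_pos_on (hgc.intervalIntegrable _ _)
    (fun t ht => hpos t ((abs_nonneg x).trans_lt ht.1)) h

include hgc hodd hpos in
theorem abs_le_of_integral_odd_le {x y : ℝ}
    (h : ∫ t in (0 : ℝ)..x, g t ≤ ∫ t in (0 : ℝ)..y, g t) : |x| ≤ |y| := by
  contrapose! h
  exact integral_odd_lt hgc hodd hpos h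

include hgc hodd hpos in
theorem integral_odd_nonneg (x : ℝ) : 0 ≤ ∫ t in (0 : ℝ)..x, g t := by
  by_contra! h
  have := abs_le_of_integral_odd_le hgc hodd hpos (x := x) (y := 0) (by simpa using h.le)
  rw [abs_zero, abs_nonpos_iff] at this
  simp [this] at h

theorem exists_tendsto_of_tendsto_abs {u : ℝ → ℝ} (hu : Continuous u) {l : ℝ}
    (h : Tendsto (fun r => |u r|) atTop (nhds l)) : ∃ L, Tendsto u atTop (nhds L) := by
  have hl : 0 ≤ l := ge_of_tendsto' h fun r => abs_nonneg _
  rcases hl.eq_or_lt with rfl | hl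
  · exact ⟨0, (tendsto_zero_iff_abs_tendsto_zero u).2 h⟩
  obtain ⟨R, hR⟩ := eventually_atTop.1 (h.eventually (lt_mem_nhds hl))
  have hne : ∀ r ≥ R, u r ≠ 0 := fun r hr => abs_pos.1 (hR r hr)
  rcases (hne R le_rfl).lt_or_gt with hneg | hpos
  · refine ⟨-l, h.neg.congr' ?_⟩
    filter_upwards [eventually_ge_atTop R] with r hr
    rw [abs_of_nonpos, neg_neg]
    by_contra! hr'
    obtain ⟨s, hs, hs0⟩ := intermediate_value_Icc hr hu.continuousOn ⟨hneg.le, hr'.le⟩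
    exact hne s hs.1 hs0
  · refine ⟨l, h.congr' ?_⟩
    filter_upwards [eventually_ge_atTop R] with r hr
    rw [abs_of_nonneg]
    by_contra! hr'
    obtain ⟨s, hs, hs0⟩ := intermediate_value_Icc' hr hu.continuousOn ⟨hr'.le, hpos.le⟩
    exact hne s hs.1 hs0

include hgc hodd hpos in
theorem exists_tendsto_of_tendsto_integral_odd {u : ℝ → ℝ} (hu : Continuous u) {A e : ℝ}
    (hA : ∀ r ≥ 0, |u r| ≤ |A|)
    (h : Tendsto (fun r => ∫ t in (0 : ℝ)..u r, g t) atTop (nhds e)) :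
    ∃ L, Tendsto u atTop (nhds L) := by
  have he0 : 0 ≤ e := ge_of_tendsto' h fun r => integral_odd_nonneg hgc hodd hpos _
  have heA : e ≤ ∫ t in (0 : ℝ)..|A|, g t := by
    refine le_of_tendsto h ?_
    filter_upwards [eventually_ge_atTop 0] with r hr
    rcases (hA r hr).lt_or_eq with h | h
    · exact (integral_odd_lt hgc hodd hpos (by rwa [abs_abs])).le
    · rw [integral_odd_eq_abs hodd, h]
  have hGc : Continuous fun x => ∫ t in (0 : ℝ)..x, g t :=
    intervalIntegral.continuous_primitive (fun a b => hgc.intervalIntegrable a b) 0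
  obtain ⟨l, hl, hle⟩ := intermediate_value_Icc (abs_nonneg A) hGc.continuousOn
    ⟨by simpa using he0, heA⟩
  refine exists_tendsto_of_tendsto_abs hu (l := l) (tendsto_order.2 ⟨fun a ha => ?_, fun a ha => ?_⟩)
  · rcases lt_or_ge a 0 with ha0 | ha0
    · exact Eventually.of_forall fun r => ha0.trans_le (abs_nonneg _)
    · have hlt : ∫ t in (0 : ℝ)..a, g t < e := by
        rw [← hle]
        exact integral_odd_lt hgc hodd hpos (by rwa [abs_of_nonneg ha0, abs_of_nonneg hl.1])
      filter_upwards [h.eventually (lt_mem_nhds hlt)] with r hr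
      by_contra! hr'
      refine hr.not_ge ?_
      rw [integral_odd_eq_abs hodd (u r)]
      rcases hr'.eq_or_lt with h | h
      · rw [h]
      · exact (integral_odd_lt hgc hodd hpos (by rwa [abs_abs, abs_of_nonneg ha0])).le
  · have hlt : e < ∫ t in (0 : ℝ)..a, g t := by
      rw [← hle]
      exact integral_odd_lt hgc hodd hpos
        (by rwa [abs_of_nonneg hl.1, abs_of_pos (hl.1.trans_lt ha)])
    filter_upwards [h.eventually (gt_mem_nhds hlt)] with r hr
    by_contra! hr'
    refine hr.not_ge ?_
    rw [integral_odd_eq_abs hodd (u r)]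
    rcases hr'.eq_or_lt with h | h
    · rw [h]
    · exact (integral_odd_lt hgc hodd hpos
        (by rwa [abs_abs, abs_of_pos (hl.1.trans_lt ha)])).le

end Potential

/-- If the energy `E` converges and dissipates at rate at least `c k`, where `k` grows at most
linearly on each interval, then `k` tends to zero. -/
theorem tendsto_zero_of_dissipation {E E' k : ℝ → ℝ} {e R c C : ℝ} (hc : 0 < c) (hC : 0 < C)
    (hE : Tendsto E atTop (nhds e)) (hE' : ∀ r ≥ R, HasDerivAt E (E' r) r)
    (hdiss : ∀ r ≥ R, E' r ≤ -c * k r) (hk : ∀ r, 0 ≤ k r)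
    (hgrow : ∀ s ≥ R, ∀ r ≥ s, k r - k s ≤ C * (r - s)) : Tendsto k atTop (nhds 0) := by
  refine tendsto_order.2 ⟨fun a ha => Eventually.of_forall fun r => ha.trans_le (hk r),
    fun ε hε => ?_⟩
  set δ := ε / (2 * C) with hδ
  have hδpos : 0 < δ := by positivity
  have hCδ : C * δ = ε / 2 := by rw [hδ]; field_simp
  have hdiff : Tendsto (fun r => E (r - δ) - E r) atTop (nhds 0) := by
    have h1 : Tendsto (fun r : ℝ => r - δ) atTop atTop :=
      tendsto_atTop_add_const_right _ (-δ) tendsto_id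
    simpa using (hE.comp h1).sub hE
  filter_upwards [hdiff.eventually (gt_mem_nhds (by positivity : 0 < c * (ε / 2) * δ)),
    eventually_ge_atTop (R + δ)] with r hr hrR
  by_contra! hkr
  have hanti : AntitoneOn (fun s => E s + c * (ε / 2) * s) (Icc (r - δ) r) := by
    have hd : ∀ s ∈ Icc (r - δ) r, HasDerivAt (fun s => E s + c * (ε / 2) * s)
        (E' s + c * (ε / 2) * 1) s := fun s hs =>
      (hE' s (by linarith [hs.1])).add ((hasDerivAt_id s).const_mul _)
    refine antitoneOn_of_deriv_nonpos (convex_Icc _ _)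
      (fun s hs => (hd s hs).continuousAt.continuousWithinAt)
      (fun s hs => (hd s (interior_subset hs)).differentiableAt.differentiableWithinAt)
      fun s hs => ?_
    have hs := interior_subset hs
    rw [(hd s hs).deriv]
    have h1 := hgrow s (by linarith [hs.1]) r hs.2
    have h2 : C * (r - s) ≤ C * δ := by
      have := hs.1
      gcongr
      linarith
    have h3 := hdiss s (by linarith [hs.1])
    have h4 : c * (ε / 2) ≤ c * k s := by
      gcongr
      linarith
    linarith
  have h5 := hanti (left_mem_Icc.2 (by linarith)) (right_mem_Icc.2 (by linarith)) (by linarith)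
  simp only at h5
  nlinarith

theorem contDiffOn_one_Ici_of_tendsto {v v' : ℝ → ℝ} {l : ℝ} (hv : Continuous v)
    (hd : ∀ r > 0, HasDerivAt v (v' r) r) (hc : ContinuousOn v' (Ioi 0))
    (hl : Tendsto v' (nhdsWithin 0 (Ioi 0)) (nhds l)) : ContDiffOn ℝ 1 v (Ici 0) := by
  have hd0 : HasDerivWithinAt v l (Ici 0) 0 := by
    refine hasDerivWithinAt_Ici_of_tendsto_deriv (s := Ioi 0)
      (fun r hr => (hd r hr).differentiableAt.differentiableWithinAt)
      hv.continuousWithinAt self_mem_nhdsWithin (hl.congr' ?_)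
    filter_upwards [self_mem_nhdsWithin] with r hr
    exact (hd r hr).deriv.symm
  have hw0 : derivWithin v (Ici 0) 0 = l := hd0.derivWithin (uniqueDiffOn_Ici 0 0 self_mem_Ici)
  have hwpos : ∀ r > 0, derivWithin v (Ici 0) r = v' r := fun r hr => by
    rw [derivWithin_of_mem_nhds (Ici_mem_nhds hr), (hd r hr).deriv]
  rw [show (1 : WithTop ℕ∞) = 0 + 1 from (zero_add 1).symm,
    contDiffOn_succ_iff_derivWithin (uniqueDiffOn_Ici 0)]
  refine ⟨fun r hr => ?_, by simp, contDiffOn_zero.2 fun r hr => ?_⟩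
  · rcases (show (0 : ℝ) ≤ r from hr).eq_or_lt with rfl | hr
    · exact hd0.differentiableWithinAt
    · exact (hd r hr).differentiableAt.differentiableWithinAt
  · rcases (show (0 : ℝ) ≤ r from hr).eq_or_lt with rfl | hr
    · rw [← Ioi_insert, continuousWithinAt_insert_self, ContinuousWithinAt, Ioi_insert, hw0]
      refine hl.congr' ?_
      filter_upwards [self_mem_nhdsWithin] with r hr
      exact (hwpos r hr).symm
    · have h1 : ContinuousAt v' r := (hc r hr).continuousAt (Ioi_mem_nhds hr)
      refine (h1.congr ?_).continuousWithinAt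
      filter_upwards [Ioi_mem_nhds hr] with s hs
      exact (hwpos s hs).symm

section Damped

variable {g q u v : ℝ → ℝ} (hgc : Continuous g) (hu : ∀ r, HasDerivAt u (v r) r)
  (hv : ∀ r > 0, HasDerivAt v (-g (u r) - q r * v r) r)

include hgc hu hv in
theorem hasDerivAt_energy {r : ℝ} (hr : 0 < r) :
    HasDerivAt (fun r => v r ^ 2 / 2 + ∫ t in (0 : ℝ)..u r, g t) (-q r * v r ^ 2) r := by
  have h1 := ((hv r hr).pow 2).div_const 2
  have h2 := (hgc.integral_hasStrictDerivAt 0 (u r)).hasDerivAt.comp r (hu r)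
  refine (h1.add h2).congr_deriv ?_
  push_cast
  ring

include hgc hu hv in
theorem antitoneOn_energy (hvc : Continuous v) (hq : ∀ r > 0, 0 ≤ q r) :
    AntitoneOn (fun r => v r ^ 2 / 2 + ∫ t in (0 : ℝ)..u r, g t) (Ici 0) := by
  have huc : Continuous u := continuous_iff_continuousAt.2 fun r => (hu r).continuousAt
  have hGc : Continuous fun x => ∫ t in (0 : ℝ)..x, g t :=
    intervalIntegral.continuous_primitive (fun a b => hgc.intervalIntegrable a b) 0
  refine antitoneOn_of_deriv_nonpos (convex_Ici 0)
    (((hvc.pow 2).div_const 2).add (hGc.comp huc)).continuousOn ?_ ?_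
  all_goals
    intro r hr
    rw [interior_Ici] at hr
  · exact (hasDerivAt_energy hgc hu hv hr).differentiableAt.differentiableWithinAt
  · rw [(hasDerivAt_energy hgc hu hv hr).deriv]
    have := mul_nonneg (hq r hr) (sq_nonneg (v r))
    linarith

include hgc hu hv in
/-- Damped oscillations with eventually uniformly positive damping come to rest. -/
theorem tendsto_of_damped (hodd : ∀ x, g (-x) = -g x) (hpos : ∀ x > 0, 0 < g x)
    (hvc : Continuous v) (hq : ∀ r > 0, 0 ≤ q r) {c : ℝ} (hc : 0 < c)
    (hqc : ∀ᶠ r in atTop, c ≤ q r) {A : ℝ} (hA : ∀ r ≥ 0, |u r| ≤ |A|) :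
    Tendsto v atTop (nhds 0) ∧ ∃ L, Tendsto u atTop (nhds L) := by
  set E : ℝ → ℝ := fun r => v r ^ 2 / 2 + ∫ t in (0 : ℝ)..u r, g t with hEdef
  have huc : Continuous u := continuous_iff_continuousAt.2 fun r => (hu r).continuousAt
  have hanti : AntitoneOn E (Ici 0) := antitoneOn_energy hgc hu hv hvc hq
  have hGnonneg := integral_odd_nonneg hgc hodd hpos
  have hE0 : ∀ r, v r ^ 2 / 2 ≤ E r := fun r => by
    have := hGnonneg (u r)
    simp only [hEdef]
    linarith
  obtain ⟨e, he⟩ : ∃ e, Tendsto E atTop (nhds e) := by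
    have hm : Antitone fun r => E (max r 0) := fun a b hab =>
      hanti (mem_Ici.2 (le_max_right _ _)) (mem_Ici.2 (le_max_right _ _)) (max_le_max_right 0 hab)
    have hbdd : BddBelow (range fun r => E (max r 0)) :=
      ⟨0, by rintro _ ⟨r, rfl⟩; exact le_trans (by positivity) (hE0 _)⟩
    refine ⟨_, (tendsto_atTop_ciInf hm hbdd).congr' ?_⟩
    filter_upwards [eventually_ge_atTop 0] with r hr
    rw [max_eq_left hr]
  obtain ⟨M, hM⟩ : ∃ M, ∀ x ∈ Icc (-|A|) |A|, g x ^ 2 ≤ M := by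
    obtain ⟨M, hM⟩ := isCompact_Icc.bddAbove_image (hgc.pow 2).continuousOn
    exact ⟨M, fun x hx => hM (mem_image_of_mem _ hx)⟩
  have hM0 : 0 ≤ M := (sq_nonneg _).trans (hM 0 ⟨by simp, by simp⟩)
  have hEn : 0 ≤ E 0 := le_trans (by positivity) (hE0 0)
  obtain ⟨R₀, hR₀⟩ := eventually_atTop.1 hqc
  set R := max R₀ 1 with hR
  have hRpos : 0 < R := lt_of_lt_of_le one_pos (le_max_right _ _)
  have hv2 : Tendsto (fun r => v r ^ 2) atTop (nhds 0) := by
    refine tendsto_zero_of_dissipation (R := R) (C := M + 2 * E 0 + 1) hc (by positivity) he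
      (fun r hr => hasDerivAt_energy hgc hu hv (hRpos.trans_le hr)) (fun r hr => ?_)
      (fun r => sq_nonneg _) fun s hs r hr => ?_
    · have := mul_le_mul_of_nonneg_right (hR₀ r ((le_max_left _ _).trans hr)) (sq_nonneg (v r))
      linarith
    · refine (convex_Ici R).image_sub_le_mul_sub_of_deriv_le (hvc.pow 2).continuousOn ?_ ?_
        s hs r (hs.le.trans hr) hr
      all_goals
        intro t ht
        have htR : R ≤ t := interior_subset ht
        have ht0 : 0 < t := hRpos.trans_le htR
        have hd := (hv t ht0).pow 2
      · exact hd.differentiableAt.differentiableWithinAt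
      · rw [hd.deriv]
        have h1 := hM (u t) (abs_le.1 (hA t ht0.le))
        have h2 := (hE0 t).trans (hanti self_mem_Ici (mem_Ici.2 ht0.le) ht0.le)
        have h3 := mul_nonneg (hq t ht0) (sq_nonneg (v t))
        push_cast
        nlinarith [sq_nonneg (g (u t) + v t)]
  have hv0 : Tendsto v atTop (nhds 0) := by
    rw [tendsto_zero_iff_abs_tendsto_zero]
    have := hv2.sqrt
    simpa [Real.sqrt_sq_eq_abs, Function.comp_def] using this
  refine ⟨hv0, exists_tendsto_of_tendsto_integral_odd hgc hodd hpos huc hA (e := e) ?_⟩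
  simpa [hEdef] using he.sub (hv2.div_const 2)

end Damped

section Radial

variable {ψ : ℝ → ℝ} (h1 : H1 ψ)

include h1 in
theorem H1.hasDerivAt {r : ℝ} (hr : 0 < r) : HasDerivAt ψ (deriv ψ r) r :=
  ((h1.1.differentiableOn (by norm_num)).differentiableAt (Ici_mem_nhds hr)).hasDerivAt

include h1 in
theorem H1.continuousOn_deriv : ContinuousOn (deriv ψ) (Ioi 0) :=
  (h1.1.mono Ioi_subset_Ici_self).continuousOn_deriv_of_isOpen isOpen_Ioi (by norm_num)

include h1 in
theorem H1.tendsto_deriv : Tendsto (deriv ψ) (nhdsWithin 0 (Ioi 0)) (nhds 1) := by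
  have hd : DifferentiableAt ℝ ψ 0 := by
    by_contra h
    have := deriv_zero_of_not_differentiableAt h
    rw [h1.2.2.1] at this
    exact one_ne_zero this
  have hc := h1.1.continuousOn_derivWithin (uniqueDiffOn_Ici 0) (by norm_num) 0 self_mem_Ici
  rw [ContinuousWithinAt, hd.derivWithin (uniqueDiffOn_Ici 0 0 self_mem_Ici), h1.2.2.1] at hc
  refine (hc.mono_left (nhdsWithin_mono _ Ioi_subset_Ici_self)).congr' ?_
  filter_upwards [self_mem_nhdsWithin] with r hr
  exact derivWithin_of_mem_nhds (Ici_mem_nhds hr)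

include h1 in
theorem H1.isRadialWeight (h2 : H2 ψ) {m : ℕ} (hm : m ≠ 0) :
    IsRadialWeight fun t => ψ (max t 0) ^ m := by
  have hmono : MonotoneOn ψ (Ici 0) :=
    monotoneOn_of_deriv_nonneg (convex_Ici 0) h1.1.continuousOn
      (by
        rw [interior_Ici]
        exact fun r hr => (h1.hasDerivAt hr).differentiableAt.differentiableWithinAt)
      (by rw [interior_Ici]; exact h2)
  have hnonneg : ∀ t ≥ 0, 0 ≤ ψ t := fun t ht =>
    h1.2.1.ge.trans (hmono self_mem_Ici (mem_Ici.2 ht) ht)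
  refine ⟨?_, fun a b hab => ?_, fun t ht => ?_, fun t ht => ?_⟩
  · exact (h1.1.continuousOn.comp_continuous (by fun_prop) fun t =>
      mem_Ici.2 (le_max_right t 0)).pow m
  · exact pow_le_pow_left₀ (hnonneg _ (le_max_right _ _)) (hmono (mem_Ici.2 (le_max_right _ _))
      (mem_Ici.2 (le_max_right _ _)) (max_le_max_right 0 hab)) m
  · simp only [max_eq_right ht, h1.2.1, zero_pow hm]
  · simp only [max_eq_left ht.le]
    exact pow_pos (h1.2.2.2.2 t ht) m

variable {m : ℕ} {h : ℝ → ℝ} (hh : Continuous h)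

include h1 hh in
theorem hasDerivAt_weightedPrimitive
    (hw : IsRadialWeight fun t => ψ (max t 0) ^ (m + 1)) {r : ℝ} (hr : 0 < r) :
    HasDerivAt (weightedPrimitive (fun t => ψ (max t 0) ^ (m + 1)) h)
      (h r - (m + 1 : ℕ) * (deriv ψ r / ψ r)
        * weightedPrimitive (fun t => ψ (max t 0) ^ (m + 1)) h r) r := by
  have hψ : ψ r ≠ 0 := (h1.2.2.2.2 r hr).ne'
  have hI := ((hw.continuous.mul hh).integral_hasStrictDerivAt 0 r).hasDerivAt
  have hwd : HasDerivAt (fun t => ψ (max t 0) ^ (m + 1)) ((m + 1 : ℕ) * ψ r ^ m * deriv ψ r) r := by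
    refine ((h1.hasDerivAt hr).pow (m + 1)).congr_of_eventuallyEq ?_
    filter_upwards [Ioi_mem_nhds hr] with t ht
    simp only [max_eq_left (le_of_lt (mem_Ioi.1 ht)), Pi.pow_apply]
  refine (hI.div hwd (hw.pos r hr).ne').congr_deriv ?_
  simp only [weightedPrimitive, Pi.mul_apply, max_eq_left hr.le]
  field_simp
  ring

include h1 hh in
theorem tendsto_weightedPrimitive_div
    (hw : IsRadialWeight fun t => ψ (max t 0) ^ (m + 1)) :
    Tendsto (fun r => weightedPrimitive (fun t => ψ (max t 0) ^ (m + 1)) h r / ψ r)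
      (nhdsWithin 0 (Ioi 0)) (nhds (h 0 / (m + 2))) := by
  have hψ0 : Tendsto ψ (nhdsWithin 0 (Ioi 0)) (nhds 0) := by
    have := h1.1.continuousOn 0 self_mem_Ici
    rw [ContinuousWithinAt, h1.2.1] at this
    exact this.mono_left (nhdsWithin_mono _ Ioi_subset_Ici_self)
  have hI0 : Tendsto (fun r => ∫ t in (0 : ℝ)..r, ψ (max t 0) ^ (m + 1) * h t)
      (nhdsWithin 0 (Ioi 0)) (nhds 0) := by
    have hc : Continuous fun r => ∫ t in (0 : ℝ)..r, ψ (max t 0) ^ (m + 1) * h t :=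
      intervalIntegral.continuous_primitive
        (fun a b => (hw.continuous.mul hh).intervalIntegrable a b) 0
    simpa using (hc.tendsto 0).mono_left (nhdsWithin_le_nhds (s := Ioi 0))
  have hlim : Tendsto (fun r => (∫ t in (0 : ℝ)..r, ψ (max t 0) ^ (m + 1) * h t) / ψ r ^ (m + 2))
      (nhdsWithin 0 (Ioi 0)) (nhds (h 0 / (m + 2))) := by
    refine HasDerivAt.lhopital_zero_nhdsGT
      (f' := fun r => ψ r ^ (m + 1) * h r)
      (g' := fun r => (m + 2 : ℕ) * ψ r ^ (m + 1) * deriv ψ r) ?_ ?_ ?_ hI0 ?_ ?_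
    · filter_upwards [self_mem_nhdsWithin] with r hr
      have hI := ((hw.continuous.mul hh).integral_hasStrictDerivAt 0 r).hasDerivAt
      refine hI.congr_deriv ?_
      simp only [Pi.mul_apply, max_eq_left (le_of_lt (mem_Ioi.1 hr))]
    · filter_upwards [self_mem_nhdsWithin] with r hr
      exact (h1.hasDerivAt hr).pow (m + 2)
    · filter_upwards [self_mem_nhdsWithin, h1.tendsto_deriv.eventually (lt_mem_nhds one_pos)]
        with r hr hd
      have := h1.2.2.2.2 r hr
      positivity
    · simpa using hψ0.pow (m + 2)
    · have hl : Tendsto (fun r => h r / ((m + 2) * deriv ψ r)) (nhdsWithin 0 (Ioi 0))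
          (nhds (h 0 / ((m + 2) * 1))) :=
        ((hh.tendsto 0).mono_left nhdsWithin_le_nhds).div
          (tendsto_const_nhds.mul h1.tendsto_deriv) (by positivity)
      rw [mul_one] at hl
      refine hl.congr' ?_
      filter_upwards [self_mem_nhdsWithin] with r hr
      have := (h1.2.2.2.2 r hr).ne'
      push_cast
      field_simp
  refine hlim.congr' ?_
  filter_upwards [self_mem_nhdsWithin] with r hr
  simp only [weightedPrimitive, max_eq_left (le_of_lt (mem_Ioi.1 hr))]
  rw [div_div, ← pow_succ]

include h1 hh in
theorem contDiffOn_weightedPrimitive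
    (hw : IsRadialWeight fun t => ψ (max t 0) ^ (m + 1)) :
    ContDiffOn ℝ 1 (weightedPrimitive (fun t => ψ (max t 0) ^ (m + 1)) h) (Ici 0) := by
  have hc := hw.continuous_weightedPrimitive hh
  refine contDiffOn_one_Ici_of_tendsto hc
    (fun r hr => hasDerivAt_weightedPrimitive h1 hh hw hr)
    (l := h 0 - (m + 1 : ℕ) * 1 * (h 0 / (m + 2))) ?_ ?_
  · refine hh.continuousOn.sub ((continuousOn_const.mul (h1.continuousOn_deriv.div
      (h1.1.continuousOn.mono Ioi_subset_Ici_self) fun r hr => ?_)).mul hc.continuousOn)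
    exact (h1.2.2.2.2 r hr).ne'
  · have := ((hh.tendsto 0).mono_left nhdsWithin_le_nhds).sub
      ((h1.tendsto_deriv.const_mul ((m + 1 : ℕ) : ℝ)).mul (tendsto_weightedPrimitive_div h1 hh hw))
    refine this.congr fun r => ?_
    ring

end Radial

/-- Global existence for the Cauchy problem: for every α ≠ 0 there is a global
radial solution `u`, with `u'(r) → 0` and `u(r)` converging to a finite limit
as `r → ∞`. -/
theorem statement0 (n : ℕ) (hn : 3 ≤ n) (p : ℝ) (hp : 1 < p) (ψ : ℝ → ℝ)
    (h1 : H1 ψ) (h2 : H2 ψ) (h3 : H3 ψ) (α : ℝ) (hα : α ≠ 0) :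
    ∃ u : ℝ → ℝ, IsRadialSolution n p ψ u α ∧
      Tendsto (deriv u) atTop (nhds 0) ∧ ∃ L : ℝ, Tendsto u atTop (nhds L) := by
  obtain ⟨m, rfl⟩ : ∃ m, n = m + 2 := ⟨n - 2, by omega⟩
  have hA : 0 < |α| := abs_pos.2 hα
  set g := truncatedPower p |α| with hg
  obtain ⟨K, hK⟩ := exists_lipschitzWith_truncatedPower hp hA
  have hodd := truncatedPower_neg p hA.le
  have hpos : ∀ x > 0, 0 < g x := fun x hx => truncatedPower_pos p hA hx
  have hw := h1.isRadialWeight h2 (Nat.succ_ne_zero m)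
  obtain ⟨u, huc, hu⟩ := hw.exists_volterra_solution hK α
  have hh : Continuous fun t => g (u t) := hK.continuous.comp huc
  set V := weightedPrimitive (fun t => ψ (max t 0) ^ (m + 1)) fun t => g (u t) with hV
  have hVc : Continuous V := hw.continuous_weightedPrimitive hh
  have hud : ∀ r, HasDerivAt u (-V r) r := fun r => by
    have h := ((hVc.integral_hasStrictDerivAt 0 r).hasDerivAt).const_sub α
    exact h.congr_of_eventuallyEq (Eventually.of_forall hu)
  have hderiv : deriv u = fun r => -V r := funext fun r => (hud r).deriv
  have hV0 : V 0 = 0 := hw.weightedPrimitive_of_nonpos _ le_rfl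
  have hu0 : u 0 = α := by simpa using hu 0
  have hVd : ∀ r > 0, HasDerivAt (fun r => -V r)
      (-g (u r) - ((m + 1 : ℕ) * (deriv ψ r / ψ r)) * -V r) r := fun r hr =>
    (hasDerivAt_weightedPrimitive h1 hh hw hr).neg.congr_deriv (by ring)
  have hq : ∀ r > 0, 0 ≤ ((m + 1 : ℕ) : ℝ) * (deriv ψ r / ψ r) := fun r hr =>
    mul_nonneg (Nat.cast_nonneg _) (div_nonneg (h2 r hr) (h1.2.2.2.2 r hr).le)
  have hbound : ∀ r ≥ 0, |u r| ≤ |α| := fun r hr => by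
    have h := antitoneOn_energy hK.continuous hud hVd hVc.neg hq self_mem_Ici (mem_Ici.2 hr) hr
    simp only [hV0, hu0] at h
    refine abs_le_of_integral_odd_le hK.continuous hodd hpos ?_
    have := sq_nonneg (-V r)
    linarith
  obtain ⟨c, hc, hψc⟩ := h3
  have hqc : ∀ᶠ r in atTop, c ≤ ((m + 1 : ℕ) : ℝ) * (deriv ψ r / ψ r) := by
    filter_upwards [hψc] with r hr
    have hm : (1 : ℝ) ≤ (m + 1 : ℕ) := by exact_mod_cast Nat.le_add_left 1 m
    nlinarith
  obtain ⟨hlim, hL⟩ := tendsto_of_damped hK.continuous hud hVd hodd hpos hVc.neg hq hc hqc hbound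
  refine ⟨u, ⟨?_, hu0, by simp [hderiv, hV0], fun r hr => ?_⟩, by rwa [hderiv], hL⟩
  · rw [show (2 : WithTop ℕ∞) = 1 + 1 from one_add_one_eq_two.symm,
      contDiffOn_succ_iff_derivWithin (uniqueDiffOn_Ici 0)]
    refine ⟨fun r _ => (hud r).differentiableAt.differentiableWithinAt, by simp, ?_⟩
    refine (contDiffOn_weightedPrimitive h1 hh hw).neg.congr fun r hr => ?_
    exact (hud r).hasDerivWithinAt.derivWithin (uniqueDiffOn_Ici 0 r hr)
  · rw [hderiv, (hVd r hr).deriv, hg, truncatedPower_eq p (hbound r hr.le)]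
    push_cast
    ring
end
end

section
/- There exists a constant λ > 0 such that λ ∫₀^∞ φ(r)² ψ(r)^{n−1} dr ≤ ∫₀^∞ φ'(r)² ψ(r)^{n−1} dr for every C¹ function φ : [0, ∞) → ℝ with compact support (radial Poincaré inequality). -/
open Real MeasureTheory Filter Set Asymptotics

noncomputable section

/-- If the primitive of a weight `w` is bounded by `C * w` on `(0, ∞)`, then `w` satisfies a
Poincaré inequality on the half-line with constant `(4 * C ^ 2)⁻¹`. -/
theorem weighted_poincare_of_primitive_le {w : ℝ → ℝ} {C : ℝ} (hC : 0 < C) (hw : Continuous w)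
    (hw0 : ∀ r ≥ 0, 0 ≤ w r) (hF : ∀ r > 0, ∫ t in (0:ℝ)..r, w t ≤ C * w r)
    {φ : ℝ → ℝ} (hφ : ContDiff ℝ 1 φ) (hsupp : HasCompactSupport φ) :
    (4 * C ^ 2)⁻¹ * ∫ r in Ioi (0:ℝ), (φ r) ^ 2 * w r ≤
      ∫ r in Ioi (0:ℝ), (deriv φ r) ^ 2 * w r := by
  have hφ' : Continuous (deriv φ) := hφ.continuous_deriv le_rfl
  have hi : Integrable (fun r => (φ r) ^ 2 * w r) :=
    ((hφ.continuous.pow 2).mul hw).integrable_of_hasCompactSupport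
      (hsupp.mono fun x hx => by
        simp only [Function.mem_support] at hx ⊢
        exact fun h => hx (by simp [h]))
  have hi' : Integrable (fun r => (deriv φ r) ^ 2 * w r) :=
    ((hφ'.pow 2).mul hw).integrable_of_hasCompactSupport
      (hsupp.deriv.mono fun x hx => by
        simp only [Function.mem_support] at hx ⊢
        exact fun h => hx (by simp [h]))
  set F : ℝ → ℝ := fun r => ∫ t in (0:ℝ)..r, w t with hFdef
  have hFd : ∀ r, HasDerivAt F (w r) r := fun r =>
    intervalIntegral.integral_hasDerivAt_right (hw.intervalIntegrable _ _)
      hw.aestronglyMeasurable.stronglyMeasurableAtFilter hw.continuousAt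
  have hFc : Continuous F := continuous_iff_continuousAt.2 fun r => (hFd r).continuousAt
  have hd : ∀ r, HasDerivAt (fun r => (φ r) ^ 2 * F r)
      (2 * φ r * deriv φ r * F r + (φ r) ^ 2 * w r) r := fun r => by
    refine ((((hφ.differentiable one_ne_zero) r).hasDerivAt.pow 2).mul (hFd r)).congr_deriv ?_
    simp
  have hs : HasCompactSupport (fun r => (φ r) ^ 2 * F r) :=
    hsupp.mono fun x hx => by
      simp only [Function.mem_support] at hx ⊢
      exact fun h => hx (by simp [h])
  have hcs : Continuous fun r => 2 * φ r * deriv φ r * F r + (φ r) ^ 2 * w r := by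
    have := hφ.continuous
    fun_prop
  have hid : Integrable fun r => 2 * φ r * deriv φ r * F r + (φ r) ^ 2 * w r :=
    hcs.integrable_of_hasCompactSupport
      (hsupp.mono fun x hx => by
        simp only [Function.mem_support] at hx ⊢
        exact fun h => hx (by simp [h]))
  have hzero : ∫ r in Ioi (0:ℝ), (2 * φ r * deriv φ r * F r + (φ r) ^ 2 * w r) = 0 := by
    have h := integral_Ioi_of_hasDerivAt_of_tendsto' (a := 0) (fun r _ => hd r)
      hid.integrableOn (hs.is_zero_at_infty.mono_left atTop_le_cocompact)
    simpa [hFdef] using h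
  have hle : ∫ r in Ioi (0:ℝ), ((1 / 2) * ((φ r) ^ 2 * w r) -
      2 * C ^ 2 * ((deriv φ r) ^ 2 * w r)) ≤ 0 := by
    refine (setIntegral_mono_on ((hi.const_mul _).sub (hi'.const_mul _)).integrableOn
      hid.integrableOn measurableSet_Ioi fun r hr => ?_).trans_eq hzero
    have hr : 0 < r := hr
    have hF0 : 0 ≤ F r :=
      intervalIntegral.integral_nonneg hr.le fun t ht => hw0 t ht.1
    have h1 : |2 * φ r * deriv φ r| * F r ≤ |2 * φ r * deriv φ r| * (C * w r) :=
      mul_le_mul_of_nonneg_left (hF r hr) (abs_nonneg _)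
    have h2 : C * |2 * φ r * deriv φ r| ≤ (1 / 2) * (φ r) ^ 2 + 2 * C ^ 2 * (deriv φ r) ^ 2 := by
      rcases abs_cases (2 * φ r * deriv φ r) with h | h <;> rw [h.1]
      · nlinarith [sq_nonneg (φ r - 2 * C * deriv φ r)]
      · nlinarith [sq_nonneg (φ r + 2 * C * deriv φ r)]
    have h3 := mul_le_mul_of_nonneg_right h2 (hw0 r hr.le)
    have h4 := mul_le_mul_of_nonneg_right (neg_abs_le (2 * φ r * deriv φ r)) hF0
    simp only [Pi.sub_apply]
    linarith
  rw [integral_sub (hi.const_mul _).integrableOn (hi'.const_mul _).integrableOn,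
    integral_const_mul, integral_const_mul] at hle
  rw [inv_mul_le_iff₀ (by positivity)]
  linarith

/-- A nonnegative monotone weight whose logarithmic derivative is bounded below near infinity
dominates its primitive. -/
theorem primitive_le_of_le_deriv {w : ℝ → ℝ} {R k : ℝ} (hR : 0 < R) (hk : 0 < k)
    (hw : Continuous w) (hw0 : ∀ r ≥ 0, 0 ≤ w r) (hmono : MonotoneOn w (Ici 0))
    (hd : ∀ r > 0, DifferentiableAt ℝ w r) (hgrowth : ∀ r > R, k * w r ≤ deriv w r)
    {r : ℝ} (hr : 0 < r) :
    ∫ t in (0:ℝ)..r, w t ≤ (R + k⁻¹) * w r := by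
  have hFd : ∀ r, HasDerivAt (fun r => ∫ t in (0:ℝ)..r, w t) (w r) r := fun r =>
    intervalIntegral.integral_hasDerivAt_right (hw.intervalIntegrable _ _)
      hw.aestronglyMeasurable.stronglyMeasurableAtFilter hw.continuousAt
  have hsmall : ∀ s > 0, ∫ t in (0:ℝ)..s, w t ≤ s * w s := fun s hs => by
    have h := intervalIntegral.integral_mono_on hs.le (hw.intervalIntegrable (μ := volume) 0 s)
      (intervalIntegrable_const (c := w s)) fun t ht => hmono ht.1 hs.le ht.2
    simpa using h
  have hk' : 0 < k⁻¹ := inv_pos.2 hk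
  rcases le_or_gt r R with h | h
  · refine (hsmall r hr).trans (mul_le_mul_of_nonneg_right ?_ (hw0 r hr.le))
    linarith
  · have hG : ∀ s > 0, HasDerivAt (fun s => (R + k⁻¹) * w s - ∫ t in (0:ℝ)..s, w t)
        ((R + k⁻¹) * deriv w s - w s) s := fun s hs =>
      ((hd s hs).hasDerivAt.const_mul _).sub (hFd s)
    have hGm : MonotoneOn (fun s => (R + k⁻¹) * w s - ∫ t in (0:ℝ)..s, w t) (Ici R) := by
      refine monotoneOn_of_deriv_nonneg (convex_Ici R)
        (fun s hs => (hG s (hR.trans_le hs)).continuousAt.continuousWithinAt)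
        (fun s hs => ?_) fun s hs => ?_
      all_goals
        rw [interior_Ici] at hs
        have hs : R < s := hs
      · exact (hG s (hR.trans hs)).differentiableAt.differentiableWithinAt
      · rw [(hG s (hR.trans hs)).deriv]
        have h1 := hgrowth s hs
        have h2 : 0 ≤ k * w s := mul_nonneg hk.le (hw0 s (hR.trans hs).le)
        have h3 : k⁻¹ * (k * w s) ≤ k⁻¹ * deriv w s := mul_le_mul_of_nonneg_left h1 hk'.le
        rw [inv_mul_cancel_left₀ hk.ne'] at h3
        have h4 : 0 ≤ R * deriv w s := mul_nonneg hR.le (h2.trans h1)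
        linarith
    have h1 : (R + k⁻¹) * w R - ∫ t in (0:ℝ)..R, w t ≤
        (R + k⁻¹) * w r - ∫ t in (0:ℝ)..r, w t := hGm self_mem_Ici h.le h.le
    have h2 := hsmall R hR
    have h3 := mul_nonneg hk'.le (hw0 R hR.le)
    linarith

/-- Radial Poincaré inequality: there is λ > 0 with
λ ∫₀^∞ φ² ψ^{n-1} ≤ ∫₀^∞ (φ')² ψ^{n-1} for all compactly supported C¹ functions φ. -/
theorem statement1 (n : ℕ) (hn : 3 ≤ n) (ψ : ℝ → ℝ)
    (h1 : H1 ψ) (h2 : H2 ψ) (h3 : H3 ψ) :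
    ∃ lam : ℝ, 0 < lam ∧ ∀ φ : ℝ → ℝ, ContDiff ℝ 1 φ → HasCompactSupport φ →
      lam * ∫ r in Ioi (0:ℝ), (φ r) ^ 2 * ψ r ^ (n - 1) ≤
        ∫ r in Ioi (0:ℝ), (deriv φ r) ^ 2 * ψ r ^ (n - 1) := by
  obtain ⟨hψ, hψ0, -, -, hpos⟩ := h1
  obtain ⟨c, hc, hev⟩ := h3
  obtain ⟨R₀, hR₀⟩ := eventually_atTop.1 hev
  have hR : 0 < max R₀ 1 := lt_max_of_lt_right one_pos
  have hm : 0 < n - 1 := by omega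
  have hψd : ∀ r > 0, DifferentiableAt ℝ ψ r := fun r hr =>
    (hψ.differentiableOn two_ne_zero r hr.le).differentiableAt (Ici_mem_nhds hr)
  have hψmono : MonotoneOn ψ (Ici 0) := by
    refine monotoneOn_of_deriv_nonneg (convex_Ici 0) hψ.continuousOn ?_ ?_ <;> rw [interior_Ici]
    · exact fun r hr => (hψd r hr).differentiableWithinAt
    · exact h2
  have hψnn : ∀ r ≥ 0, 0 ≤ ψ r := fun r hr => by
    simpa [hψ0] using hψmono self_mem_Ici hr hr
  -- Extending the weight by a constant to the left makes it continuous on the whole line.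
  set w : ℝ → ℝ := fun r => ψ (max r 0) ^ (n - 1) with hwdef
  have hwψ : ∀ r ≥ 0, w r = ψ r ^ (n - 1) := fun r hr => by simp [hwdef, max_eq_left hr]
  have hw : Continuous w :=
    (hψ.continuousOn.comp_continuous (continuous_id.max continuous_const)
      fun r => le_max_right r 0).pow _
  have hw0 : ∀ r ≥ 0, 0 ≤ w r := fun r hr => hwψ r hr ▸ pow_nonneg (hψnn r hr) _
  have hwmono : MonotoneOn w (Ici 0) := fun a ha b hb hab => by
    rw [hwψ a ha, hwψ b hb]
    exact pow_le_pow_left₀ (hψnn a ha) (hψmono ha hb hab) _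
  have hwd : ∀ r > 0, HasDerivAt w (↑(n - 1) * ψ r ^ (n - 1 - 1) * deriv ψ r) r := fun r hr =>
    ((hψd r hr).hasDerivAt.pow (n - 1)).congr_of_eventuallyEq <| by
      filter_upwards [Ioi_mem_nhds hr] with s hs
      exact hwψ s (le_of_lt hs)
  have hgrowth : ∀ r > max R₀ 1, (↑(n - 1) * c) * w r ≤ deriv w r := fun r hr => by
    have hr0 : 0 < r := hR.trans hr
    have h := (le_div_iff₀ (hpos r hr0)).1 (hR₀ r ((le_max_left _ _).trans hr.le))
    rw [(hwd r hr0).deriv, hwψ r hr0.le, ← pow_sub_one_mul hm.ne' (ψ r)]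
    have h' := mul_le_mul_of_nonneg_left h
      (mul_nonneg (Nat.cast_nonneg (α := ℝ) (n - 1)) (pow_nonneg (hpos r hr0).le (n - 1 - 1)))
    linarith
  have hk : 0 < (↑(n - 1) * c : ℝ) := mul_pos (Nat.cast_pos.2 hm) hc
  have hC : 0 < max R₀ 1 + (↑(n - 1) * c : ℝ)⁻¹ := add_pos hR (inv_pos.2 hk)
  refine ⟨(4 * (max R₀ 1 + (↑(n - 1) * c : ℝ)⁻¹) ^ 2)⁻¹, by positivity, fun φ hφ hsupp => ?_⟩
  have key := weighted_poincare_of_primitive_le hC hw hw0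
    (fun r hr => primitive_le_of_le_deriv hR hk hw hw0 hwmono
      (fun s hs => (hwd s hs).differentiableAt) hgrowth hr) hφ hsupp
  have hcongr : ∀ f : ℝ → ℝ, ∫ r in Ioi (0:ℝ), f r * w r =
      ∫ r in Ioi (0:ℝ), f r * ψ r ^ (n - 1) := fun f =>
    setIntegral_congr_fun measurableSet_Ioi fun r hr => by
      simp only [hwψ r (le_of_lt hr)]
  rwa [hcongr fun r => (φ r) ^ 2, hcongr fun r => (deriv φ r) ^ 2] at key
end
end

section
/- If 1 < p ≤ (n+2)/(n−2), then there exists a constant C > 0 such that (∫₀^∞ |φ(r)|^{p+1} ψ(r)^{n−1} dr)^{2/(p+1)} ≤ C ∫₀^∞ φ'(r)² ψ(r)^{n−1} dr for every C¹ function φ : [0, ∞) → ℝ with compact support (radial Poincaré–Sobolev inequality). -/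
open Real MeasureTheory Filter Set Asymptotics

noncomputable section

/-- The weight `ψ` multiplied by a bounded increasing factor, so that it grows at a definite rate
even where `ψ'` vanishes. -/
def tilt (ψ : ℝ → ℝ) (r : ℝ) : ℝ := ψ r * (2 - (1 + r)⁻¹)

theorem H1.continuousOn {ψ : ℝ → ℝ} (h : H1 ψ) : ContinuousOn ψ (Ici 0) :=
  h.1.continuousOn

theorem H1.differentiableAt {ψ : ℝ → ℝ} (h : H1 ψ) {r : ℝ} (hr : 0 < r) :
    DifferentiableAt ℝ ψ r :=
  (h.1.differentiableOn (by norm_num)).differentiableAt (Ici_mem_nhds hr)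

theorem H1.nonneg {ψ : ℝ → ℝ} (h : H1 ψ) {r : ℝ} (hr : 0 ≤ r) : 0 ≤ ψ r := by
  rcases hr.eq_or_lt with rfl | hr
  · exact h.2.1.ge
  · exact (h.2.2.2.2 r hr).le

theorem H1.exists_half_le_deriv {ψ : ℝ → ℝ} (h : H1 ψ) :
    ∃ δ > 0, ∀ r, 0 < r → r < δ → 1 / 2 ≤ deriv ψ r := by
  have hd : DifferentiableAt ℝ ψ 0 := by
    by_contra hd
    have := h.2.2.1
    rw [deriv_zero_of_not_differentiableAt hd] at this
    norm_num at this
  have h0 : derivWithin ψ (Ici 0) 0 = 1 := by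
    rw [hd.derivWithin (uniqueDiffOn_Ici 0 0 self_mem_Ici), h.2.2.1]
  have hc := h.1.continuousOn_derivWithin (uniqueDiffOn_Ici 0) (by norm_num) 0 self_mem_Ici
  rw [Metric.continuousWithinAt_iff] at hc
  obtain ⟨δ, hδ, hh⟩ := hc (1 / 2) (by norm_num)
  refine ⟨δ, hδ, fun r hr hrδ => ?_⟩
  have := hh (x := r) hr.le (by simpa [Real.dist_eq, abs_of_pos hr] using hrδ)
  rw [h0, Real.dist_eq, derivWithin_of_mem_nhds (Ici_mem_nhds hr)] at this
  linarith [(abs_lt.1 this).1]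

theorem monotoneOn_of_H1_H2 {ψ : ℝ → ℝ} (h1 : H1 ψ) (h2 : H2 ψ) : MonotoneOn ψ (Ici 0) := by
  refine monotoneOn_of_deriv_nonneg (convex_Ici 0) h1.continuousOn ?_ ?_
  · rw [interior_Ici]
    exact fun r hr => (h1.differentiableAt hr).differentiableWithinAt
  · rw [interior_Ici]
    exact h2

theorem exists_mul_one_add_le {ψ : ℝ → ℝ} (h1 : H1 ψ) (h2 : H2 ψ) (h3 : H3 ψ) :
    ∃ a > 0, ∀ r > 0, a * (1 + ψ r) ≤ deriv ψ r + ψ r / (1 + r) ^ 2 := by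
  obtain ⟨δ, hδ, hδ'⟩ := h1.exists_half_le_deriv
  obtain ⟨c, hc, hc'⟩ := h3
  obtain ⟨R, hR⟩ := eventually_atTop.1 hc'
  have hmono := monotoneOn_of_H1_H2 h1 h2
  set S := max R δ
  have hS0 : 0 < S := hδ.trans_le (le_max_right _ _)
  have hm : 0 < ψ δ := h1.2.2.2.2 δ hδ
  have hM : 0 < ψ S := h1.2.2.2.2 S hS0
  set m := ψ δ
  set M := ψ S
  set a := min (1 / (2 * (1 + M))) (min (m / ((1 + S) ^ 2 * (1 + M))) (c * m / (1 + m)))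
  have ha1 : a ≤ 1 / (2 * (1 + M)) := min_le_left _ _
  have ha2 : a ≤ m / ((1 + S) ^ 2 * (1 + M)) := (min_le_right _ _).trans (min_le_left _ _)
  have ha3 : a ≤ c * m / (1 + m) := (min_le_right _ _).trans (min_le_right _ _)
  have ha : 0 < a := by
    refine lt_min (by positivity) (lt_min (by positivity) (by positivity))
  clear_value a
  rw [le_div_iff₀ (by positivity)] at ha1 ha2 ha3
  refine ⟨a, ha, fun r hr => ?_⟩
  have hψ : 0 < ψ r := h1.2.2.2.2 r hr
  have hdr : 0 ≤ deriv ψ r := h2 r hr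
  have hq : 0 ≤ ψ r / (1 + r) ^ 2 := by positivity
  rcases lt_or_ge r δ with hrδ | hrδ
  · have hle : ψ r ≤ M := hmono hr.le hS0.le (hrδ.le.trans (le_max_right _ _))
    have := hδ' r hr hrδ
    nlinarith
  have hmr : m ≤ ψ r := hmono hδ.le hr.le hrδ
  rcases le_or_gt r S with hrS | hrS
  · have hle : ψ r ≤ M := hmono hr.le hS0.le hrS
    have h5 : m / (1 + S) ^ 2 ≤ ψ r / (1 + r) ^ 2 := by gcongr
    have h6 : a * (1 + M) ≤ m / (1 + S) ^ 2 := by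
      rw [le_div_iff₀ (by positivity)]
      linarith
    nlinarith
  · have h5 := hR r ((le_max_left _ _).trans hrS.le)
    rw [le_div_iff₀ hψ] at h5
    have h6 : a * (1 + ψ r) * m ≤ c * ψ r * m := by nlinarith [mul_pos ha hψ]
    have h7 := le_of_mul_le_mul_right h6 hm
    linarith

theorem le_tilt {ψ : ℝ → ℝ} (h : H1 ψ) {r : ℝ} (hr : 0 ≤ r) : ψ r ≤ tilt ψ r := by
  have h1 : (1 + r)⁻¹ ≤ 1 := inv_le_one_of_one_le₀ (by linarith)
  unfold tilt
  nlinarith [h.nonneg hr]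

theorem tilt_le {ψ : ℝ → ℝ} (h : H1 ψ) {r : ℝ} (hr : 0 ≤ r) : tilt ψ r ≤ 2 * ψ r := by
  have h1 : 0 ≤ (1 + r)⁻¹ := by positivity
  unfold tilt
  nlinarith [h.nonneg hr]

theorem continuousOn_tilt {ψ : ℝ → ℝ} (h : H1 ψ) : ContinuousOn (tilt ψ) (Ici 0) := by
  refine h.continuousOn.mul (continuousOn_const.sub (ContinuousOn.inv₀ (by fun_prop) ?_))
  intro r hr
  have : (0 : ℝ) ≤ r := hr
  positivity

theorem exists_hasDerivAt_tilt {ψ : ℝ → ℝ} (h1 : H1 ψ) (h2 : H2 ψ) (h3 : H3 ψ) :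
    ∃ a > 0, ∀ r > 0, ∃ d, HasDerivAt (tilt ψ) d r ∧ a * (1 + tilt ψ r) ≤ d := by
  obtain ⟨a, ha, hh⟩ := exists_mul_one_add_le h1 h2 h3
  refine ⟨a / 2, by positivity, fun r hr => ?_⟩
  have hne : 1 + r ≠ 0 := by positivity
  refine ⟨_, (h1.differentiableAt hr).hasDerivAt.mul
    ((((hasDerivAt_id r).const_add 1).inv hne).const_sub 2), ?_⟩
  have e1 := hh r hr
  have e2 := tilt_le h1 hr.le
  have h4 : (1 + r)⁻¹ ≤ 1 := inv_le_one_of_one_le₀ (by linarith)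
  have h5 : ψ r * -(-1 / (1 + id r) ^ 2) = ψ r / (1 + r) ^ 2 := by
    simp only [id]; ring
  have h6 := h2 r hr
  rw [h5]
  nlinarith

/-- Completing the square in the derivative of `φ² g^(N+1) (1 + g)`. -/
theorem hardy_pointwise {N : ℕ} {a x g G s d : ℝ} (ha : 0 < a) (hx : 0 ≤ x) (hxg : x ≤ g)
    (hgx : g ≤ 2 * x) (hG : a * (1 + g) ≤ G) :
    a / 2 * (s ^ 2 * (x ^ N + x ^ (N + 2))) - 2 ^ (N + 3) / a * (d ^ 2 * x ^ (N + 2)) ≤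
      2 * s * d * (g ^ (N + 1) * (1 + g)) +
        s ^ 2 * (((N + 1) * g ^ N * G) * (1 + g) + g ^ (N + 1) * G) := by
  have hg : 0 ≤ g := hx.trans hxg
  have hG0 : 0 ≤ G := le_trans (by positivity) hG
  have hH : a * (g ^ N * (1 + g) ^ 2) ≤
      ((N + 1) * g ^ N * G) * (1 + g) + g ^ (N + 1) * G := by
    have e1 : g ^ N * (1 + g) * (a * (1 + g)) ≤ g ^ N * (1 + g) * G := by gcongr
    have e2 : 0 ≤ N * g ^ N * G * (1 + g) + g ^ (N + 1) * G := by positivity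
    linarith
  have hlow : x ^ N + x ^ (N + 2) ≤ g ^ N * (1 + g) ^ 2 := by
    have e1 : x ^ N * (1 + x ^ 2) ≤ g ^ N * (1 + g) ^ 2 := by
      gcongr
      nlinarith
    linarith [pow_add x N 2]
  have hup : g ^ (N + 2) ≤ 2 ^ (N + 2) * x ^ (N + 2) := by
    rw [← mul_pow]; gcongr
  have hsq : a / 2 * (s ^ 2 * (g ^ N * (1 + g) ^ 2)) - 2 / a * (d ^ 2 * g ^ (N + 2)) ≤
      2 * s * d * (g ^ (N + 1) * (1 + g)) + s ^ 2 * (a * (g ^ N * (1 + g) ^ 2)) := by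
    have e : 0 ≤ g ^ N * (a / 2 * (s * (1 + g) + 2 / a * (d * g)) ^ 2) := by positivity
    have e' : g ^ N * (a / 2 * (s * (1 + g) + 2 / a * (d * g)) ^ 2) =
        2 * s * d * (g ^ (N + 1) * (1 + g)) + s ^ 2 * (a * (g ^ N * (1 + g) ^ 2)) -
        (a / 2 * (s ^ 2 * (g ^ N * (1 + g) ^ 2)) - 2 / a * (d ^ 2 * g ^ (N + 2))) := by
      field_simp
      ring
    linarith
  have k1 : a / 2 * (s ^ 2 * (x ^ N + x ^ (N + 2))) ≤ a / 2 * (s ^ 2 * (g ^ N * (1 + g) ^ 2)) := by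
    gcongr
  have k2 : 2 / a * (d ^ 2 * g ^ (N + 2)) ≤ 2 / a * (d ^ 2 * (2 ^ (N + 2) * x ^ (N + 2))) := by
    gcongr
  have k3 : 2 / a * (d ^ 2 * (2 ^ (N + 2) * x ^ (N + 2))) =
      2 ^ (N + 3) / a * (d ^ 2 * x ^ (N + 2)) := by ring
  have k4 := mul_le_mul_of_nonneg_left hH (sq_nonneg s)
  linarith

theorem exists_hardy {ψ : ℝ → ℝ} (h1 : H1 ψ) (h2 : H2 ψ) (h3 : H3 ψ) (N : ℕ) :
    ∃ K > 0, ∀ φ : ℝ → ℝ, ContDiff ℝ 1 φ → ∀ R, φ R = 0 → ∀ r, 0 ≤ r → r ≤ R →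
      φ r ^ 2 * ψ r ^ (N + 1) + ∫ t in r..R, φ t ^ 2 * (ψ t ^ N + ψ t ^ (N + 2)) ≤
        K * ∫ t in r..R, deriv φ t ^ 2 * ψ t ^ (N + 2) := by
  obtain ⟨a, ha, hd⟩ := exists_hasDerivAt_tilt h1 h2 h3
  refine ⟨(1 + 2 / a) * (2 ^ (N + 3) / a), by positivity, fun φ hφ R hR r hr hrR => ?_⟩
  have hsub : Icc r R ⊆ Ici 0 := fun t ht => hr.trans ht.1
  have hψc : ContinuousOn ψ (Icc r R) := h1.continuousOn.mono hsub
  have hgc : ContinuousOn (tilt ψ) (Icc r R) := (continuousOn_tilt h1).mono hsub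
  have hφc : Continuous φ := hφ.continuous
  have hφ'c : Continuous (deriv φ) := hφ.continuous_deriv_one
  have hcF : ContinuousOn (fun t => φ t ^ 2 * (ψ t ^ N + ψ t ^ (N + 2))) (Icc r R) := by fun_prop
  have hcE : ContinuousOn (fun t => deriv φ t ^ 2 * ψ t ^ (N + 2)) (Icc r R) := by fun_prop
  have hiF := hcF.intervalIntegrable_of_Icc (μ := volume) hrR
  have hiE := hcE.intervalIntegrable_of_Icc (μ := volume) hrR
  have key := intervalIntegral.integral_le_sub_of_hasDeriv_right_of_le hrR
    (g := fun t => φ t ^ 2 * (tilt ψ t ^ (N + 1) * (1 + tilt ψ t)))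
    (g' := fun t => 2 * φ t * deriv φ t * (tilt ψ t ^ (N + 1) * (1 + tilt ψ t)) +
        φ t ^ 2 * (((N + 1) * tilt ψ t ^ N * deriv (tilt ψ) t) * (1 + tilt ψ t) +
          tilt ψ t ^ (N + 1) * deriv (tilt ψ) t))
    (φ := fun t => a / 2 * (φ t ^ 2 * (ψ t ^ N + ψ t ^ (N + 2))) -
      2 ^ (N + 3) / a * (deriv φ t ^ 2 * ψ t ^ (N + 2)))
    (by fun_prop) ?_
    (((hcF.const_smul (a / 2)).sub (hcE.const_smul (2 ^ (N + 3) / a))).integrableOn_Icc) ?_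
  · rw [intervalIntegral.integral_sub (hiF.const_mul _) (hiE.const_mul _),
      intervalIntegral.integral_const_mul, intervalIntegral.integral_const_mul, hR] at key
    set F := ∫ t in r..R, φ t ^ 2 * (ψ t ^ N + ψ t ^ (N + 2))
    set E := ∫ t in r..R, deriv φ t ^ 2 * ψ t ^ (N + 2)
    have hF : 0 ≤ F := intervalIntegral.integral_nonneg hrR fun t ht => by
      have := h1.nonneg (hsub ht)
      positivity
    have hx := h1.nonneg hr
    have hxg := le_tilt h1 hr
    have hg := hx.trans hxg
    have hW : φ r ^ 2 * ψ r ^ (N + 1) ≤ φ r ^ 2 * (tilt ψ r ^ (N + 1) * (1 + tilt ψ r)) := by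
      have e : ψ r ^ (N + 1) * 1 ≤ tilt ψ r ^ (N + 1) * (1 + tilt ψ r) := by
        gcongr
        linarith
      rw [mul_one] at e
      gcongr
    have hW0 : 0 ≤ φ r ^ 2 * ψ r ^ (N + 1) := by positivity
    have hsum : φ r ^ 2 * ψ r ^ (N + 1) + a / 2 * F ≤ 2 ^ (N + 3) / a * E := by linarith
    set W := φ r ^ 2 * ψ r ^ (N + 1)
    have e1 : W ≤ 2 ^ (N + 3) / a * E := le_trans (by linarith [mul_nonneg ha.le hF]) hsum
    have e2 : a / 2 * F ≤ 2 ^ (N + 3) / a * E := by linarith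
    have e3 : F ≤ 2 / a * (2 ^ (N + 3) / a * E) := by
      calc F = 2 / a * (a / 2 * F) := by field_simp
        _ ≤ _ := by gcongr
    linarith
  · intro t ht
    obtain ⟨d, hd, -⟩ := hd t (hr.trans_lt ht.1)
    have hφd := (hφ.differentiable one_ne_zero t).hasDerivAt
    rw [hd.deriv]
    refine (((hφd.pow 2).mul ((hd.pow (N + 1)).mul (hd.const_add 1))).congr_deriv ?_).hasDerivWithinAt
    simp
  · intro t ht
    have ht0 := hr.trans_lt ht.1
    obtain ⟨d, hd, hle⟩ := hd t ht0
    have := hd.deriv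
    exact hardy_pointwise ha (h1.nonneg ht0.le) (le_tilt h1 ht0.le) (tilt_le h1 ht0.le)
      (this ▸ hle)

/-- Interpolating `x ^ (N + 1)` to the subcritical power `q ≤ 2 / (N + 1)`. -/
theorem rpow_mul_le_of_mul_le {N : ℕ} {q x s A : ℝ} (hq : 0 ≤ q) (hqN : (N + 1) * q ≤ 2)
    (hx : 0 < x) (hs : 0 ≤ s) (h : s * x ^ (N + 1) ≤ A) :
    s ^ q * x ^ (N + 2) ≤ A ^ q * (x ^ N + x ^ (N + 2)) := by
  have hA : 0 ≤ A := le_trans (by positivity) h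
  have e : s ^ q * (x ^ (N + 1)) ^ q ≤ A ^ q := by
    rw [← Real.mul_rpow hs (by positivity)]
    exact Real.rpow_le_rpow (by positivity) h hq
  have hy : x ^ 2 ≤ (x ^ (N + 1)) ^ q * (1 + x ^ 2) := by
    rcases le_total 1 x with h1 | h1
    · have : 1 ≤ (x ^ (N + 1)) ^ q := Real.one_le_rpow (one_le_pow₀ h1) hq
      nlinarith [sq_nonneg x]
    · have : x ^ 2 ≤ (x ^ (N + 1)) ^ q := by
        rw [← Real.rpow_natCast x (N + 1), ← Real.rpow_mul hx.le, ← Real.rpow_natCast x 2]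
        exact Real.rpow_le_rpow_of_exponent_ge hx h1 (by push_cast; exact hqN)
      nlinarith [sq_nonneg x]
  calc s ^ q * x ^ (N + 2) = s ^ q * x ^ N * x ^ 2 := by ring
    _ ≤ s ^ q * x ^ N * ((x ^ (N + 1)) ^ q * (1 + x ^ 2)) := by gcongr
    _ = s ^ q * (x ^ (N + 1)) ^ q * (x ^ N + x ^ (N + 2)) := by ring
    _ ≤ _ := by gcongr

theorem setIntegral_Ioi_eq_intervalIntegral {f : ℝ → ℝ} {R : ℝ} (hR : 0 ≤ R)
    (hf : ∀ r > R, f r = 0) : ∫ r in Ioi (0 : ℝ), f r = ∫ r in (0 : ℝ)..R, f r := by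
  rw [intervalIntegral.integral_of_le hR]
  refine setIntegral_eq_of_subset_of_forall_sdiff_eq_zero measurableSet_Ioi
    Ioc_subset_Ioi_self fun r hr => hf r ?_
  by_contra hlt
  exact hr.2 ⟨hr.1, not_lt.1 hlt⟩

theorem exists_forall_ge_eq_zero {φ : ℝ → ℝ} (hφ : HasCompactSupport φ) :
    ∃ R, 0 ≤ R ∧ φ R = 0 ∧ ∀ r > R, φ r = 0 ∧ deriv φ r = 0 := by
  obtain ⟨R, hR⟩ := hφ.isCompact.isBounded.subset_closedBall 0
  have h : ∀ r > |R|, r ∉ tsupport φ := fun r hr hmem => by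
    have := hR hmem
    rw [Metric.mem_closedBall, Real.dist_eq, sub_zero] at this
    linarith [le_abs_self r, le_abs_self R]
  refine ⟨|R| + 1, by positivity, image_eq_zero_of_notMem_tsupport (h _ (by linarith)),
    fun r hr => ⟨image_eq_zero_of_notMem_tsupport (h r (by linarith)), ?_⟩⟩
  by_contra hne
  exact h r (by linarith) (support_deriv_subset hne)

/-- Radial Poincaré–Sobolev inequality: for 1 < p ≤ (n+2)/(n-2) there is C > 0 with
(∫₀^∞ |φ|^{p+1} ψ^{n-1})^{2/(p+1)} ≤ C ∫₀^∞ (φ')² ψ^{n-1}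
for all compactly supported C¹ functions φ. -/
theorem statement2 (n : ℕ) (hn : 3 ≤ n) (p : ℝ) (hp : 1 < p)
    (hpc : p ≤ ((n : ℝ) + 2) / ((n : ℝ) - 2)) (ψ : ℝ → ℝ)
    (h1 : H1 ψ) (h2 : H2 ψ) (h3 : H3 ψ) :
    ∃ C : ℝ, 0 < C ∧ ∀ φ : ℝ → ℝ, ContDiff ℝ 1 φ → HasCompactSupport φ →
      (∫ r in Ioi (0:ℝ), |φ r| ^ (p + 1) * ψ r ^ (n - 1)) ^ (2 / (p + 1)) ≤
        C * ∫ r in Ioi (0:ℝ), (deriv φ r) ^ 2 * ψ r ^ (n - 1) := by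
  obtain ⟨N, rfl⟩ := Nat.exists_eq_add_of_le' hn
  obtain ⟨K, hK, hardy⟩ := exists_hardy h1 h2 h3 N
  refine ⟨K, hK, fun φ hφ hφs => ?_⟩
  obtain ⟨R, hR, hφR, hφ0⟩ := exists_forall_ge_eq_zero hφs
  have hN : N + 3 - 1 = N + 2 := by omega
  rw [hN, setIntegral_Ioi_eq_intervalIntegral hR fun r hr => by
      rw [(hφ0 r hr).1, abs_zero, Real.zero_rpow (by linarith), zero_mul],
    setIntegral_Ioi_eq_intervalIntegral hR fun r hr => by
      rw [(hφ0 r hr).2, zero_pow two_ne_zero, zero_mul]]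
  have hψc : ContinuousOn ψ (Icc 0 R) := h1.continuousOn.mono Icc_subset_Ici_self
  have hφc : Continuous φ := hφ.continuous
  have hφ'c : Continuous (deriv φ) := hφ.continuous_deriv_one
  have hcF : ContinuousOn (fun t => φ t ^ 2 * (ψ t ^ N + ψ t ^ (N + 2))) (Icc 0 R) := by fun_prop
  have hcE : ContinuousOn (fun t => deriv φ t ^ 2 * ψ t ^ (N + 2)) (Icc 0 R) := by fun_prop
  have hiE := hcE.intervalIntegrable_of_Icc (μ := volume) hR
  have hcP : ContinuousOn (fun t => |φ t| ^ (p + 1) * ψ t ^ (N + 2)) (Icc 0 R) :=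
    ((hφc.abs.rpow_const fun _ => Or.inr (by linarith)).continuousOn).mul (hψc.pow _)
  set E := ∫ t in (0 : ℝ)..R, deriv φ t ^ 2 * ψ t ^ (N + 2)
  have hE0 : 0 ≤ E := intervalIntegral.integral_nonneg hR fun t ht => by
    have := h1.nonneg ht.1
    positivity
  set q := (p - 1) / 2 with hq
  have hq0 : 0 < q := by linarith
  have hqN : (N + 1) * q ≤ 2 := by
    push_cast at hpc
    rw [le_div_iff₀ (by linarith [(Nat.cast_nonneg N : (0 : ℝ) ≤ N)])] at hpc
    rw [hq]
    linarith
  have hsup : ∀ t ∈ Icc 0 R, φ t ^ 2 * ψ t ^ (N + 1) ≤ K * E := fun t ht => by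
    have e1 := hardy φ hφ R hφR t ht.1 ht.2
    have e2 : 0 ≤ ∫ s in t..R, φ s ^ 2 * (ψ s ^ N + ψ s ^ (N + 2)) :=
      intervalIntegral.integral_nonneg ht.2 fun s hs => by
        have := h1.nonneg (ht.1.trans hs.1)
        positivity
    have e3 : ∫ s in t..R, deriv φ s ^ 2 * ψ s ^ (N + 2) ≤ E := by
      refine intervalIntegral.integral_mono_interval ht.1 ht.2 le_rfl ?_ hiE
      filter_upwards [ae_restrict_mem measurableSet_Ioc] with s hs
      have := h1.nonneg hs.1.le
      simp only [Pi.zero_apply]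
      positivity
    have := mul_le_mul_of_nonneg_left e3 hK.le
    linarith
  have hint : ∫ t in (0 : ℝ)..R, φ t ^ 2 * (ψ t ^ N + ψ t ^ (N + 2)) ≤ K * E := by
    have e1 := hardy φ hφ R hφR 0 le_rfl hR
    rwa [h1.2.1, zero_pow (Nat.succ_ne_zero N), mul_zero, zero_add] at e1
  have hKE : 0 ≤ K * E := by positivity
  have hP : ∫ t in (0 : ℝ)..R, |φ t| ^ (p + 1) * ψ t ^ (N + 2) ≤ (K * E) ^ ((p + 1) / 2) := by
    calc ∫ t in (0 : ℝ)..R, |φ t| ^ (p + 1) * ψ t ^ (N + 2)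
        ≤ ∫ t in (0 : ℝ)..R, (K * E) ^ q * (φ t ^ 2 * (ψ t ^ N + ψ t ^ (N + 2))) := by
          refine intervalIntegral.integral_mono_on_of_le_Ioo hR
            (hcP.intervalIntegrable_of_Icc hR)
            ((hcF.intervalIntegrable_of_Icc hR).const_mul _) fun t ht => ?_
          have e1 := rpow_mul_le_of_mul_le hq0.le hqN (h1.2.2.2.2 t ht.1) (sq_nonneg (φ t))
            (hsup t (Ioo_subset_Icc_self ht))
          have e2 : |φ t| ^ (p + 1) = φ t ^ 2 * (φ t ^ 2) ^ q := by
            rw [← sq_abs, ← Real.rpow_natCast, ← Real.rpow_mul (abs_nonneg _),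
              ← Real.rpow_add_of_nonneg (abs_nonneg _) (by norm_num) (by positivity)]
            congr 1
            rw [hq]
            push_cast
            ring
          rw [e2]
          nlinarith [mul_le_mul_of_nonneg_left e1 (sq_nonneg (φ t))]
      _ = (K * E) ^ q * ∫ t in (0 : ℝ)..R, φ t ^ 2 * (ψ t ^ N + ψ t ^ (N + 2)) :=
          intervalIntegral.integral_const_mul _ _
      _ ≤ (K * E) ^ q * (K * E) := by gcongr
      _ = (K * E) ^ ((p + 1) / 2) := by
          rw [← Real.rpow_add_one' hKE (by positivity)]
          congr 1
          rw [hq]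
          ring
  have hP0 : 0 ≤ ∫ t in (0 : ℝ)..R, |φ t| ^ (p + 1) * ψ t ^ (N + 2) :=
    intervalIntegral.integral_nonneg hR fun t ht => by
      have := h1.nonneg ht.1
      positivity
  calc _ ≤ ((K * E) ^ ((p + 1) / 2)) ^ (2 / (p + 1)) := by
        gcongr
    _ = K * E := by
        rw [← Real.rpow_mul hKE, div_mul_div_cancel₀' (by linarith), div_self (by norm_num),
          Real.rpow_one]
end
end

section
/- If 1 < p < (n+2)/(n−2), then there exists a global C² function u : [0, ∞) → ℝ with u(0) > 0, u'(0) = 0, satisfying u''(r) + (n−1)(ψ'(r)/ψ(r)) u'(r) + |u(r)|^{p−1} u(r) = 0 for all r > 0, such that u(r) > 0 for all r ≥ 0 and ∫₀^∞ (u(r)² + u'(r)²) ψ(r)^{n−1} dr < ∞. -/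
open Real MeasureTheory Filter Set Asymptotics

noncomputable section

/-- `u` belongs to the radial energy space. -/
def InEnergySpace (n : ℕ) (ψ u : ℝ → ℝ) : Prop :=
  IntegrableOn (fun r => ((u r) ^ 2 + (deriv u r) ^ 2) * ψ r ^ (n - 1)) (Ioi 0)

open scoped Topology BoundedContinuousFunction

/-- Properties of the volume density `W` of a model manifold, with mean curvature `H = W' / W`. -/
structure IsRadialWeight_s3 (m : ℕ) (W H : ℝ → ℝ) : Prop where
  cont : Continuous W
  zero : ∀ t ≤ 0, W t = 0
  pos : ∀ t > 0, 0 < W t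
  mono : Monotone W
  hasDerivAt : ∀ t > 0, HasDerivAt W (H t * W t) t
  contH : ContinuousOn H (Ioi 0)
  tendsto : Tendsto (fun t => t * H t) (𝓝[>] 0) (𝓝 m)
  lower : ∃ c > 0, ∀ᶠ t in 𝓝[>] (0 : ℝ), c * t ^ m ≤ W t
  bddBelow : ∃ h > 0, ∃ R > 0, ∀ r ≥ R, h ≤ H r

/-- The solution `v` of `(W v)' = W g` that is regular at the origin. -/
def flux (W g : ℝ → ℝ) (t : ℝ) : ℝ := (W t)⁻¹ * ∫ s in (0 : ℝ)..t, W s * g s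

/-- The power nonlinearity, truncated to the interval `[0, A]`. -/
def truncPow (p A x : ℝ) : ℝ := (min (max x 0) A) ^ p

/-- `u` solves `u'' + H u' + f u = 0` with `u 0 = α`, in integrated form. -/
structure IsFluxSolution (W f u : ℝ → ℝ) (α : ℝ) : Prop where
  cont : Continuous u
  init : u 0 = α
  hasDerivAt : ∀ r, HasDerivAt u (-flux W (fun s => f (u s)) r) r

section Flux

variable {m : ℕ} {W H g h : ℝ → ℝ}

lemma flux_of_nonpos (hW : IsRadialWeight_s3 m W H) {t : ℝ} (ht : t ≤ 0) : flux W g t = 0 := by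
  simp [flux, hW.zero t ht]

lemma mul_flux (hW : IsRadialWeight_s3 m W H) {t : ℝ} (ht : 0 ≤ t) :
    W t * flux W g t = ∫ s in (0 : ℝ)..t, W s * g s := by
  rcases ht.eq_or_lt with rfl | ht
  · simp [hW.zero 0 le_rfl]
  · rw [flux, mul_inv_cancel_left₀ (hW.pos t ht).ne']

lemma IsRadialWeight_s3.nonneg (hW : IsRadialWeight_s3 m W H) (t : ℝ) : 0 ≤ W t := by
  rcases le_or_gt t 0 with ht | ht
  · exact (hW.zero t ht).ge
  · exact (hW.pos t ht).le

lemma flux_sub (hW : IsRadialWeight_s3 m W H) (hg : Continuous g) (hh : Continuous h) (t : ℝ) :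
    flux W g t - flux W h t = flux W (fun s => g s - h s) t := by
  have := hW.cont
  simp only [flux, mul_sub]
  rw [intervalIntegral.integral_sub]
  · ring
  all_goals exact Continuous.intervalIntegrable (by fun_prop) _ _

lemma abs_flux_le (hW : IsRadialWeight_s3 m W H) (hg : Continuous g) {t : ℝ} (ht : 0 ≤ t) :
    |flux W g t| ≤ ∫ s in (0 : ℝ)..t, |g s| := by
  have hWc := hW.cont
  rcases ht.eq_or_lt with rfl | ht'
  · simp [flux]
  have hp := hW.pos t ht'
  rw [flux, abs_mul, abs_inv, abs_of_pos hp, inv_mul_le_iff₀ hp,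
    ← intervalIntegral.integral_const_mul]
  refine (intervalIntegral.abs_integral_le_integral_abs ht).trans ?_
  refine intervalIntegral.integral_mono_on ht
    (Continuous.intervalIntegrable (by fun_prop) _ _)
    (Continuous.intervalIntegrable (by fun_prop) _ _) fun s hs => ?_
  rw [abs_mul, abs_of_nonneg (hW.nonneg s)]
  exact mul_le_mul_of_nonneg_right (hW.mono hs.2) (abs_nonneg _)

lemma hasDerivAt_flux (hW : IsRadialWeight_s3 m W H) (hg : Continuous g) {t : ℝ} (ht : 0 < t) :
    HasDerivAt (flux W g) (g t - H t * flux W g t) t := by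
  have hWc := hW.cont
  have hp := (hW.pos t ht).ne'
  have h1 : HasDerivAt (fun t => ∫ s in (0 : ℝ)..t, W s * g s) (W t * g t) t :=
    (show Continuous fun s => W s * g s by fun_prop).integral_hasStrictDerivAt 0 t |>.hasDerivAt
  have h2 := ((hW.hasDerivAt t ht).inv hp).mul h1
  refine h2.congr_deriv ?_
  simp only [flux, Pi.inv_apply]
  field_simp
  ring

lemma continuous_flux (hW : IsRadialWeight_s3 m W H) (hg : Continuous g) :
    Continuous (flux W g) := by
  rw [continuous_iff_continuousAt]
  intro t
  rcases lt_trichotomy t 0 with ht | rfl | ht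
  · have : flux W g =ᶠ[𝓝 t] fun _ => 0 := by
      filter_upwards [Iio_mem_nhds ht] with s hs using flux_of_nonpos hW (le_of_lt hs)
    exact continuousAt_const.congr this.symm
  · have h0 : flux W g 0 = 0 := flux_of_nonpos hW le_rfl
    rw [ContinuousAt, h0]
    have hc : Tendsto (fun t => ‖∫ s in (0 : ℝ)..t, |g s|‖) (𝓝 0) (𝓝 0) := by
      have : Continuous fun t => ‖∫ s in (0 : ℝ)..t, |g s|‖ :=
        (intervalIntegral.continuous_primitive
          (fun a b => hg.abs.intervalIntegrable a b) 0).norm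
      simpa using this.tendsto 0
    refine squeeze_zero_norm (fun s => ?_) hc
    rcases le_or_gt s 0 with hs | hs
    · rw [flux_of_nonpos hW hs]; simp
    · exact (abs_flux_le hW hg hs.le).trans (le_abs_self _)
  · exact (hasDerivAt_flux hW hg ht).continuousAt

lemma flux_mono (hW : IsRadialWeight_s3 m W H) (hg : Continuous g) (hh : Continuous h) {t : ℝ}
    (ht : 0 ≤ t) (hgh : ∀ s ∈ Icc 0 t, g s ≤ h s) : flux W g t ≤ flux W h t := by
  have hWc := hW.cont
  refine mul_le_mul_of_nonneg_left ?_ (inv_nonneg.2 (hW.nonneg t))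
  exact intervalIntegral.integral_mono_on ht
    (Continuous.intervalIntegrable (by fun_prop) _ _)
    (Continuous.intervalIntegrable (by fun_prop) _ _)
    fun s hs => mul_le_mul_of_nonneg_left (hgh s hs) (hW.nonneg s)

lemma flux_nonneg (hW : IsRadialWeight_s3 m W H) (hg : ∀ s, 0 ≤ g s) (t : ℝ) :
    0 ≤ flux W g t := by
  rcases le_or_gt t 0 with ht | ht
  · rw [flux_of_nonpos hW ht]
  · exact mul_nonneg (inv_nonneg.2 (hW.nonneg t))
      (intervalIntegral.integral_nonneg ht.le fun s _ => mul_nonneg (hW.nonneg s) (hg s))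

lemma flux_const_mul (c : ℝ) (t : ℝ) :
    flux W (fun s => c * g s) t = c * flux W g t := by
  simp only [flux, mul_left_comm _ c, intervalIntegral.integral_const_mul]

lemma flux_le_mul (hW : IsRadialWeight_s3 m W H) (hg : Continuous g) {M : ℝ} {t : ℝ} (ht : 0 ≤ t)
    (h0 : ∀ s, 0 ≤ g s) (hM : ∀ s ∈ Icc 0 t, g s ≤ M) : flux W g t ≤ M * t := by
  refine (le_abs_self _).trans ((abs_flux_le hW hg ht).trans ?_)
  have : ∫ s in (0 : ℝ)..t, |g s| ≤ ∫ _ in (0 : ℝ)..t, M :=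
    intervalIntegral.integral_mono_on ht
      (hg.abs.intervalIntegrable _ _) (by simp) fun s hs => by
        rw [abs_of_nonneg (h0 s)]; exact hM s hs
  simpa [mul_comm] using this

/-- The second derivative of a solution has a limit at the origin. -/
lemma tendsto_deriv_flux (hW : IsRadialWeight_s3 m W H) (hg : Continuous g) :
    Tendsto (fun t => g t - H t * flux W g t) (𝓝[>] 0) (𝓝 (g 0 - m * (g 0 / (1 + m)))) := by
  have hWc := hW.cont
  have hm : (0 : ℝ) < 1 + m := by positivity
  have hg0 : Tendsto g (𝓝[>] 0) (𝓝 (g 0)) := hg.continuousAt.tendsto.mono_left nhdsWithin_le_nhds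
  have key : Tendsto (fun t => (∫ s in (0 : ℝ)..t, W s * g s) / (t * W t)) (𝓝[>] 0)
      (𝓝 (g 0 / (1 + m))) := by
    have hev : ∀ᶠ t in 𝓝[>] (0 : ℝ), 0 < 1 + t * H t :=
      (hW.tendsto.const_add 1).eventually (lt_mem_nhds hm)
    refine HasDerivAt.lhopital_zero_nhdsGT (f' := fun t => W t * g t)
      (g' := fun t => 1 * W t + t * (H t * W t)) ?_ ?_ ?_ ?_ ?_ ?_
    · exact Eventually.of_forall fun t =>
        (show Continuous fun s => W s * g s by fun_prop).integral_hasStrictDerivAt 0 t |>.hasDerivAt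
    · filter_upwards [self_mem_nhdsWithin] with t ht
      exact (hasDerivAt_id t).mul (hW.hasDerivAt t ht)
    · filter_upwards [self_mem_nhdsWithin, hev] with t ht h1
      have := mul_pos h1 (hW.pos t ht)
      exact ne_of_gt (by linarith)
    · have : Continuous fun t => ∫ s in (0 : ℝ)..t, W s * g s :=
        intervalIntegral.continuous_primitive
          (fun a b => Continuous.intervalIntegrable (by fun_prop) a b) 0
      simpa using (this.tendsto 0).mono_left nhdsWithin_le_nhds
    · have : Continuous fun t => t * W t := by fun_prop
      simpa using (this.tendsto 0).mono_left nhdsWithin_le_nhds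
    · refine (hg0.div (hW.tendsto.const_add 1) hm.ne').congr' ?_
      filter_upwards [self_mem_nhdsWithin, hev] with t ht h1
      have hp := (hW.pos t ht).ne'
      simp only [Pi.div_apply]
      rw [show 1 * W t + t * (H t * W t) = W t * (1 + t * H t) by ring,
        mul_div_mul_left _ _ hp]
  refine (hg0.sub (hW.tendsto.mul key)).congr' ?_
  filter_upwards [self_mem_nhdsWithin] with t ht
  have hp := (hW.pos t ht).ne'
  have ht' : t ≠ 0 := ne_of_gt ht
  simp only [flux]
  field_simp

end Flux

section TruncPow

variable {p A x : ℝ}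

lemma truncPow_of_nonpos (hp : 0 < p) (hA : 0 ≤ A) (hx : x ≤ 0) : truncPow p A x = 0 := by
  rw [truncPow, max_eq_right hx, min_eq_left hA, Real.zero_rpow hp.ne']

lemma truncPow_of_mem (hx : x ∈ Icc 0 A) : truncPow p A x = x ^ p := by
  rw [truncPow, max_eq_left hx.1, min_eq_left hx.2]

lemma truncPow_nonneg (hA : 0 ≤ A) (x : ℝ) : 0 ≤ truncPow p A x :=
  Real.rpow_nonneg (le_min (le_max_right _ _) hA) _

lemma truncPow_le (hp : 0 < p) (hA : 0 ≤ A) (x : ℝ) : truncPow p A x ≤ A ^ p :=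
  Real.rpow_le_rpow (le_min (le_max_right _ _) hA) (min_le_right _ _) hp.le

lemma continuous_truncPow (hp : 0 < p) : Continuous (truncPow p A) := by
  unfold truncPow
  exact Continuous.rpow_const (by fun_prop) fun _ => Or.inr hp.le

lemma monotone_truncPow (hp : 0 < p) (hA : 0 ≤ A) : Monotone (truncPow p A) := fun _ _ h =>
  Real.rpow_le_rpow (le_min (le_max_right _ _) hA)
    (min_le_min_right _ (max_le_max_right _ h)) hp.le

lemma abs_truncPow_sub_le (hp : 1 < p) (hA : 0 ≤ A) (x y : ℝ) :
    |truncPow p A x - truncPow p A y| ≤ p * A ^ (p - 1) * |x - y| := by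
  have hmem : ∀ x : ℝ, min (max x 0) A ∈ Icc 0 A := fun x =>
    ⟨le_min (le_max_right _ _) hA, min_le_right _ _⟩
  have key := (convex_Icc (0 : ℝ) A).norm_image_sub_le_of_norm_hasDerivWithin_le
    (f := fun x : ℝ => x ^ p) (f' := fun x => p * x ^ (p - 1)) (C := p * A ^ (p - 1))
    (fun z _ => (Real.hasDerivAt_rpow_const (Or.inr hp.le)).hasDerivWithinAt)
    (fun z hz => by
      rw [Real.norm_of_nonneg (mul_nonneg (by linarith) (Real.rpow_nonneg hz.1 _))]
      exact mul_le_mul_of_nonneg_left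
        (Real.rpow_le_rpow hz.1 hz.2 (by linarith)) (by linarith))
    (hmem y) (hmem x)
  refine key.trans (mul_le_mul_of_nonneg_left ?_
    (mul_nonneg (by linarith) (Real.rpow_nonneg hA _)))
  refine (abs_min_sub_min_le_max _ _ _ _).trans ?_
  rw [sub_self, abs_zero, max_eq_left (abs_nonneg _)]
  refine (abs_max_sub_max_le_max _ _ _ _).trans ?_
  rw [sub_self, abs_zero, max_eq_left (abs_nonneg _)]

end TruncPow

section Existence

variable {m : ℕ} {W H f : ℝ → ℝ}

lemma integral_exp_mul_le {l : ℝ} (hl : 0 < l) (t : ℝ) :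
    ∫ s in (0 : ℝ)..t, exp (l * s) ≤ exp (l * t) / l := by
  rw [intervalIntegral.integral_comp_mul_left (fun x => exp x) hl.ne', integral_exp, mul_zero,
    exp_zero, smul_eq_mul, ← div_eq_inv_mul]
  gcongr
  linarith

/-- An exponential bound on the difference of the sources bounds the difference of the
double primitives. -/
lemma abs_integral_flux_sub_le (hW : IsRadialWeight_s3 m W H) {g h : ℝ → ℝ} (hg : Continuous g)
    (hh : Continuous h) {l C : ℝ} (hl : 0 < l) {r : ℝ} (hr : 0 ≤ r)
    (hgh : ∀ s ≥ 0, |g s - h s| ≤ C * exp (l * s)) :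
    |(∫ t in (0 : ℝ)..r, flux W g t) - ∫ t in (0 : ℝ)..r, flux W h t|
      ≤ C * exp (l * r) / l ^ 2 := by
  have hC : 0 ≤ C := by simpa using (abs_nonneg _).trans (hgh 0 le_rfl)
  have hint : ∀ a b, IntervalIntegrable (fun s => exp (l * s)) volume a b := fun a b =>
    Continuous.intervalIntegrable (by fun_prop) _ _
  rw [← intervalIntegral.integral_sub ((continuous_flux hW hg).intervalIntegrable _ _)
    ((continuous_flux hW hh).intervalIntegrable _ _)]
  have hpt : ∀ t ∈ Icc 0 r, |flux W g t - flux W h t| ≤ C / l * exp (l * t) := by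
    intro t ht
    rw [flux_sub hW hg hh]
    refine (abs_flux_le hW (hg.sub hh) ht.1).trans ?_
    have : ∫ s in (0 : ℝ)..t, |g s - h s| ≤ ∫ s in (0 : ℝ)..t, C * exp (l * s) :=
      intervalIntegral.integral_mono_on ht.1 ((hg.sub hh).abs.intervalIntegrable _ _)
        ((hint _ _).const_mul _) fun s hs => hgh s hs.1
    refine this.trans ?_
    rw [intervalIntegral.integral_const_mul, div_mul_eq_mul_div, mul_div_assoc]
    exact mul_le_mul_of_nonneg_left (integral_exp_mul_le hl t) hC
  have hc : Continuous fun t => flux W g t - flux W h t :=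
    (continuous_flux hW hg).sub (continuous_flux hW hh)
  refine (intervalIntegral.abs_integral_le_integral_abs hr).trans ?_
  refine (intervalIntegral.integral_mono_on hr (hc.abs.intervalIntegrable _ _)
    ((hint _ _).const_mul _) hpt).trans ?_
  rw [intervalIntegral.integral_const_mul]
  refine (mul_le_mul_of_nonneg_left (integral_exp_mul_le hl r) (by positivity)).trans_eq ?_
  field_simp

/-- The initial value problem is solvable for Lipschitz bounded nonlinearities, and the solution
depends continuously on the initial value. -/
theorem exists_isFluxSolution (hW : IsRadialWeight_s3 m W H) (hf : Continuous f) {M L : ℝ}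
    (hM : ∀ x, |f x| ≤ M) (hL : ∀ x y, |f x - f y| ≤ L * |x - y|) :
    ∃ U : ℝ → ℝ → ℝ, (∀ α, IsFluxSolution W f (U α) α) ∧
      ∀ r ≥ 0, ∃ C, ∀ α β, ∀ s ∈ Icc 0 r, |U α s - U β s| ≤ C * |α - β| := by
  have hM0 : 0 ≤ M := (abs_nonneg _).trans (hM 0)
  have hL0 : 0 ≤ L := by simpa using (abs_nonneg _).trans (hL 1 0)
  set l : ℝ := 2 * L + 1 with hl
  have hl1 : 1 ≤ l := by linarith
  have hl0 : 0 < l := by linarith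
  have hLl : L / l ^ 2 ≤ 1 / 2 := by
    rw [div_le_div_iff₀ (by positivity) (by norm_num)]; nlinarith
  let e : ℝ → ℝ := fun r => l * max r 0
  have he : Continuous e := by fun_prop
  have hepos : ∀ r, 0 ≤ e r := fun r => mul_nonneg hl0.le (le_max_right _ _)
  have hex : ∀ r ≥ 0, e r = l * r := fun r hr => by simp only [e, max_eq_left hr]
  let src : (ℝ →ᵇ ℝ) → ℝ → ℝ := fun w s => f (exp (e s) * w s)
  have hsrc : ∀ w, Continuous (src w) := fun w =>
    hf.comp ((Real.continuous_exp.comp he).mul w.continuous)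
  have hzero : Continuous fun _ : ℝ => (0 : ℝ) := continuous_const
  have hI : ∀ w, Continuous fun r => ∫ t in (0 : ℝ)..r, flux W (src w) t := fun w =>
    intervalIntegral.continuous_primitive
      (fun a b => (continuous_flux hW (hsrc w)).intervalIntegrable a b) 0
  have hneg : ∀ w, ∀ r ≤ 0, ∫ t in (0 : ℝ)..r, flux W (src w) t = 0 := by
    intro w r hr
    rw [intervalIntegral.integral_congr (g := fun _ => 0)]
    · simp
    · intro t ht
      rw [uIcc_of_ge hr] at ht
      exact flux_of_nonpos hW ht.2
  have hbd : ∀ w r, |∫ t in (0 : ℝ)..r, flux W (src w) t| ≤ M * exp (e r) := by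
    intro w r
    rcases le_total r 0 with hr | hr
    · rw [hneg w r hr, abs_zero]; positivity
    · have := abs_integral_flux_sub_le hW (hsrc w) hzero (C := M) hl0 hr fun s hs => by
        rw [sub_zero]
        refine (hM _).trans (le_mul_of_one_le_right hM0 (one_le_exp (by positivity)))
      rw [show (∫ t in (0 : ℝ)..r, flux W (fun _ => 0) t) = 0 by simp [flux], sub_zero] at this
      rw [hex r hr]
      exact this.trans (div_le_self (by positivity) (one_le_pow₀ hl1))
  have hcont : ∀ α w, Continuous fun r =>
      exp (-e r) * (α - ∫ t in (0 : ℝ)..r, flux W (src w) t) := fun α w =>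
    (Real.continuous_exp.comp he.neg).mul (continuous_const.sub (hI w))
  have hbound : ∀ α w r,
      ‖exp (-e r) * (α - ∫ t in (0 : ℝ)..r, flux W (src w) t)‖ ≤ |α| + M := by
    intro α w r
    rw [norm_mul, Real.norm_eq_abs, Real.norm_eq_abs, abs_exp, exp_neg,
      inv_mul_le_iff₀ (exp_pos _)]
    refine (abs_sub _ _).trans ?_
    nlinarith [hbd w r, abs_nonneg α, one_le_exp (hepos r)]
  let T : ℝ → (ℝ →ᵇ ℝ) → (ℝ →ᵇ ℝ) := fun α w =>
    BoundedContinuousFunction.ofNormedAddCommGroup _ (hcont α w) _ (hbound α w)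
  have hTapp : ∀ α w r, T α w r = exp (-e r) * (α - ∫ t in (0 : ℝ)..r, flux W (src w) t) :=
    fun _ _ _ => rfl
  have hT : ∀ α, ContractingWith (1 / 2) (T α) := by
    intro α
    refine ⟨by rw [← NNReal.coe_lt_coe]; norm_num, LipschitzWith.of_dist_le_mul fun w₁ w₂ => ?_⟩
    rw [BoundedContinuousFunction.dist_le (by positivity)]
    intro r
    rw [Real.dist_eq, hTapp, hTapp, ← mul_sub, abs_mul, abs_exp, exp_neg,
      inv_mul_le_iff₀ (exp_pos _), sub_sub_sub_cancel_left, abs_sub_comm]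
    rcases le_total r 0 with hr | hr
    · rw [hneg _ r hr, hneg _ r hr]; simp; positivity
    have := abs_integral_flux_sub_le hW (hsrc w₁) (hsrc w₂) (C := L * dist w₁ w₂) hl0 hr
      fun s hs => by
        refine (hL _ _).trans ?_
        rw [← mul_sub, abs_mul, abs_exp, hex s hs, mul_assoc, mul_comm (dist w₁ w₂)]
        gcongr
        exact BoundedContinuousFunction.dist_coe_le_dist (f := w₁) (g := w₂) s
    rw [hex r hr]
    refine this.trans ?_
    have hd : 0 ≤ exp (l * r) * dist w₁ w₂ := by positivity
    calc L * dist w₁ w₂ * exp (l * r) / l ^ 2 = L / l ^ 2 * (exp (l * r) * dist w₁ w₂) := by ring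
      _ ≤ 1 / 2 * (exp (l * r) * dist w₁ w₂) := by gcongr
      _ = exp (l * r) * (((1 / 2 : NNReal) : ℝ) * dist w₁ w₂) := by push_cast; ring
  let w : ℝ → (ℝ →ᵇ ℝ) := fun α => (hT α).fixedPoint
  have hw : ∀ α, T α (w α) = w α := fun α => (hT α).fixedPoint_isFixedPt
  have hUeq : ∀ α r, exp (e r) * w α r = α - ∫ t in (0 : ℝ)..r, flux W (src (w α)) t := by
    intro α r
    conv_lhs => rw [← hw α, hTapp, ← mul_assoc, ← exp_add, add_neg_cancel, exp_zero, one_mul]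
  refine ⟨fun α r => exp (e r) * w α r, fun α => ⟨?_, ?_, fun r => ?_⟩, fun r hr => ?_⟩
  · exact (Real.continuous_exp.comp he).mul (w α).continuous
  · simp [hUeq]
  · have hd := ((continuous_flux hW (hsrc (w α))).integral_hasStrictDerivAt 0 r).hasDerivAt
    exact (hd.const_sub α).congr_of_eventuallyEq (Eventually.of_forall fun s => hUeq α s)
  · refine ⟨exp (l * r) * 2, fun α β s hs => ?_⟩
    have hdist : dist (w α) (w β) ≤ |α - β| / (1 - ((1 / 2 : NNReal) : ℝ)) := by
      refine (hT α).fixedPoint_lipschitz_in_map (hT β) fun z => ?_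
      rw [BoundedContinuousFunction.dist_le (by positivity)]
      intro r
      rw [Real.dist_eq, hTapp, hTapp, ← mul_sub, abs_mul, abs_exp, exp_neg,
        inv_mul_le_iff₀ (exp_pos _), sub_sub_sub_cancel_right]
      exact le_mul_of_one_le_left (abs_nonneg _) (one_le_exp (hepos r))
    have h2 : dist (w α) (w β) ≤ 2 * |α - β| := by
      refine hdist.trans_eq ?_
      push_cast
      ring
    rw [← mul_sub, abs_mul, abs_exp, hex s hs.1, mul_assoc]
    gcongr
    · exact hs.2
    · exact (BoundedContinuousFunction.dist_coe_le_dist (f := w α) (g := w β) s).trans h2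

end Existence

section Solutions

variable {m : ℕ} {W H f u : ℝ → ℝ} {α : ℝ}

lemma IsFluxSolution.continuous_source (hu : IsFluxSolution W f u α) (hfc : Continuous f) :
    Continuous fun s => f (u s) := hfc.comp hu.cont

lemma IsFluxSolution.antitone (hW : IsRadialWeight_s3 m W H) (hu : IsFluxSolution W f u α)
    (hf0 : ∀ x, 0 ≤ f x) : Antitone u :=
  antitone_of_hasDerivAt_nonpos hu.hasDerivAt fun r =>
    neg_nonpos.2 (flux_nonneg hW (fun s => hf0 (u s)) r)

lemma IsFluxSolution.le_init (hW : IsRadialWeight_s3 m W H) (hu : IsFluxSolution W f u α)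
    (hf0 : ∀ x, 0 ≤ f x) {r : ℝ} (hr : 0 ≤ r) : u r ≤ α :=
  hu.init ▸ hu.antitone hW hf0 hr

lemma IsFluxSolution.flux_le (hW : IsRadialWeight_s3 m W H) (hu : IsFluxSolution W f u α)
    (hfc : Continuous f) (hf0 : ∀ x, 0 ≤ f x) (hfm : Monotone f) {r : ℝ} (hr : 0 ≤ r) :
    flux W (fun s => f (u s)) r ≤ f α * r :=
  flux_le_mul hW (hu.continuous_source hfc) hr (fun _ => hf0 _)
    fun _ hs => hfm (hu.le_init hW hf0 hs.1)

lemma IsFluxSolution.lower_bound (hW : IsRadialWeight_s3 m W H) (hu : IsFluxSolution W f u α)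
    (hfc : Continuous f) (hf0 : ∀ x, 0 ≤ f x) (hfm : Monotone f) {r : ℝ} (hr : 0 ≤ r) :
    α - f α * r ^ 2 ≤ u r := by
  have := (convex_Icc (0 : ℝ) r).mul_sub_le_image_sub_of_le_deriv hu.cont.continuousOn
    (fun x _ => (hu.hasDerivAt x).differentiableAt.differentiableWithinAt) (C := -(f α * r))
    (fun x hx => by
      rw [interior_Icc] at hx
      rw [(hu.hasDerivAt x).deriv, neg_le_neg_iff]
      exact (hu.flux_le hW hfc hf0 hfm hx.1.le).trans
        (mul_le_mul_of_nonneg_left hx.2.le (hf0 α)))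
    0 (left_mem_Icc.2 hr) r (right_mem_Icc.2 hr) hr
  rw [hu.init] at this
  nlinarith

lemma IsFluxSolution.flux_pos (hW : IsRadialWeight_s3 m W H) (hu : IsFluxSolution W f u α)
    (hfc : Continuous f) (hf0 : ∀ x, 0 ≤ f x) (hfp : ∀ x > 0, 0 < f x) (hα : 0 < α)
    {r : ℝ} (hr : 0 < r) : 0 < flux W (fun s => f (u s)) r := by
  have hWc := hW.cont
  have huc := hu.cont
  refine mul_pos (inv_pos.2 (hW.pos r hr)) ?_
  have hev : ∀ᶠ s in 𝓝[>] (0 : ℝ), 0 < u s := by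
    have : Tendsto u (𝓝[>] 0) (𝓝 α) :=
      hu.init ▸ hu.cont.continuousAt.tendsto.mono_left nhdsWithin_le_nhds
    exact this.eventually (lt_mem_nhds hα)
  obtain ⟨c, hc, hcr⟩ := (hev.and (Ioo_mem_nhdsGT hr)).exists
  refine intervalIntegral.integral_pos hr (Continuous.continuousOn (by fun_prop))
    (fun x _ => mul_nonneg (hW.nonneg x) (hf0 _)) ⟨c, ⟨hcr.1.le, hcr.2.le⟩, ?_⟩
  exact mul_pos (hW.pos c hcr.1) (hfp _ hc)

lemma IsFluxSolution.pos_of_nonneg (hW : IsRadialWeight_s3 m W H) (hu : IsFluxSolution W f u α)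
    (hfc : Continuous f) (hf0 : ∀ x, 0 ≤ f x) (hfp : ∀ x > 0, 0 < f x) (hα : 0 < α)
    (h : ∀ r ≥ 0, 0 ≤ u r) {r : ℝ} (hr : 0 ≤ r) : 0 < u r := by
  have hs : StrictAntiOn u (Ici 0) := by
    refine strictAntiOn_of_deriv_neg (convex_Ici 0) hu.cont.continuousOn fun x hx => ?_
    rw [interior_Ici] at hx
    rw [(hu.hasDerivAt x).deriv, neg_lt_zero]
    exact hu.flux_pos hW hfc hf0 hfp hα hx
  exact (h (r + 1) (by linarith)).trans_lt
    (hs (mem_Ici.2 hr) (mem_Ici.2 (by linarith)) (by linarith))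

/-- Comparison of an arbitrary solution with a solution that stays above a positive level. -/
lemma IsFluxSolution.sub_le_of_lower_bound (hW : IsRadialWeight_s3 m W H)
    (hu : IsFluxSolution W f u α) {z : ℝ → ℝ} {β : ℝ} (hz : IsFluxSolution W f z β)
    (hfc : Continuous f) (hfm : Monotone f) {M l : ℝ} (hM : ∀ x, f x ≤ M) (hfl : 0 < f l)
    (hl : ∀ r ≥ 0, l ≤ u r) {r₁ r : ℝ} (hr₁ : 0 ≤ r₁) (hr : r₁ ≤ r) :
    z r₁ - M / f l * (u r₁ - u r) ≤ z r := by
  have hmono : MonotoneOn (fun s => z s - M / f l * u s) (Icc r₁ r) := by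
    have hd : ∀ s, HasDerivAt (fun s => z s - M / f l * u s)
        (-flux W (fun s => f (z s)) s - M / f l * -flux W (fun s => f (u s)) s) s := fun s =>
      (hz.hasDerivAt s).sub ((hu.hasDerivAt s).const_mul _)
    refine monotoneOn_of_hasDerivWithinAt_nonneg (convex_Icc _ _)
      (fun s _ => (hd s).continuousAt.continuousWithinAt)
      (fun s _ => (hd s).hasDerivWithinAt) fun s hs => ?_
    rw [interior_Icc] at hs
    have h0 : 0 ≤ s := hr₁.trans hs.1.le
    have hM0 : 0 ≤ M := hfl.le.trans (hM l)
    have := flux_mono hW (hz.continuous_source hfc)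
      (h := fun s => M / f l * f (u s)) (continuous_const.mul (hu.continuous_source hfc)) h0
      fun t ht => by
        have h1 : M ≤ M / f l * f (u t) := by
          rw [div_mul_eq_mul_div, le_div_iff₀ hfl]
          exact mul_le_mul_of_nonneg_left (hfm (hl t ht.1)) hM0
        exact (hM _).trans h1
    rw [flux_const_mul] at this
    linarith
  have := hmono (left_mem_Icc.2 hr) (right_mem_Icc.2 hr) hr
  simp only at this
  linarith

/-- The decaying radial harmonic function at infinity. -/
lemma IsRadialWeight_s3.exists_tail (hW : IsRadialWeight_s3 m W H) :
    ∃ h > 0, ∃ R > 0, ∃ G : ℝ → ℝ, (∀ r ≥ R, h ≤ H r) ∧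
      (∀ r ≥ R, HasDerivAt G (-(W r)⁻¹) r) ∧ ∀ r ≥ R, 0 < G r ∧ h * (W r * G r) ≤ 1 := by
  have hWc := hW.cont
  obtain ⟨h, hh, R, hR, hHR⟩ := hW.bddBelow
  have hWR := hW.pos R hR
  have hkc : Continuous fun r => (max (W r) (W R))⁻¹ :=
    Continuous.inv₀ (by fun_prop) fun r => (hWR.trans_le (le_max_right _ _)).ne'
  set g : ℝ → ℝ := fun r => ∫ s in R..r, (max (W s) (W R))⁻¹ with hg
  have hgd : ∀ r ≥ R, HasDerivAt g (W r)⁻¹ r := by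
    intro r hr
    have := (hkc.integral_hasStrictDerivAt R r).hasDerivAt
    rwa [max_eq_left (hW.mono hr)] at this
  have hmono : StrictMonoOn g (Ici R) := by
    refine strictMonoOn_of_deriv_pos (convex_Ici R)
      (fun r hr => (hgd r hr).continuousAt.continuousWithinAt) fun r hr => ?_
    rw [interior_Ici] at hr
    rw [(hgd r hr.le).deriv]
    exact inv_pos.2 (hW.pos r (hR.trans hr))
  have hanti : AntitoneOn (fun r => g r + h⁻¹ * (W r)⁻¹) (Ici R) := by
    have hd : ∀ r ≥ R, HasDerivAt (fun r => g r + h⁻¹ * (W r)⁻¹)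
        ((W r)⁻¹ + h⁻¹ * (-(H r * W r) / W r ^ 2)) r := fun r hr =>
      (hgd r hr).add (((hW.hasDerivAt r (hR.trans_le hr)).inv
        (hW.pos r (hR.trans_le hr)).ne').const_mul _)
    refine antitoneOn_of_hasDerivWithinAt_nonpos (convex_Ici R)
      (fun r hr => (hd r hr).continuousAt.continuousWithinAt)
      (fun r hr => (hd r (interior_subset hr)).hasDerivWithinAt) fun r hr => ?_
    rw [interior_Ici] at hr
    have hp := hW.pos r (hR.trans hr)
    have : (W r)⁻¹ + h⁻¹ * (-(H r * W r) / W r ^ 2) = (h - H r) / (h * W r) := by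
      field_simp
      ring
    rw [this]
    exact div_nonpos_of_nonpos_of_nonneg (by linarith [hHR r hr.le]) (by positivity)
  have hle : ∀ r ≥ R, ∀ s ≥ R, g s ≤ g r + h⁻¹ * (W r)⁻¹ := by
    intro r hr s hs
    have hpr := hW.pos r (hR.trans_le hr)
    have hps := hW.pos s (hR.trans_le hs)
    rcases le_total s r with hsr | hrs
    · exact (hmono.monotoneOn hs hr hsr).trans (le_add_of_nonneg_right (by positivity))
    · have := hanti hr hs hrs
      have h2 : 0 ≤ h⁻¹ * (W s)⁻¹ := by positivity
      simp only at this
      linarith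
  have hbdd : BddAbove (g '' Ici R) := ⟨_, by
    rintro _ ⟨s, hs, rfl⟩
    exact hle R le_rfl s hs⟩
  refine ⟨h, hh, R, hR, fun r => sSup (g '' Ici R) - g r, hHR, fun r hr =>
    (hgd r hr).const_sub _, fun r hr => ⟨?_, ?_⟩⟩
  · have h1 : g r < g (r + 1) := hmono hr (mem_Ici.2 (by linarith [hr.le])) (by linarith)
    have h2 : g (r + 1) ≤ sSup (g '' Ici R) :=
      le_csSup hbdd ⟨r + 1, mem_Ici.2 (by linarith [hr.le]), rfl⟩
    simp only [sub_pos]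
    linarith
  · have hp := hW.pos r (hR.trans_le hr)
    have h1 : sSup (g '' Ici R) ≤ g r + h⁻¹ * (W r)⁻¹ :=
      csSup_le ⟨_, R, self_mem_Ici, rfl⟩ (by
        rintro _ ⟨s, hs, rfl⟩
        exact hle r hr s hs)
    have h2 : sSup (g '' Ici R) - g r ≤ h⁻¹ * (W r)⁻¹ := by linarith
    calc h * (W r * (sSup (g '' Ici R) - g r)) ≤ h * (W r * (h⁻¹ * (W r)⁻¹)) := by gcongr
      _ = 1 := by field_simp

/-- Once the logarithmic derivative of a small solution is below that of a power of the
decaying harmonic function, it stays below, and the solution stays positive. -/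
lemma IsFluxSolution.pos_of_barrier (hW : IsRadialWeight_s3 m W H) (hu : IsFluxSolution W f u α)
    (hfc : Continuous f) (hf0 : ∀ x, 0 ≤ f x) (hfp : ∀ x > 0, 0 < f x) (hα : 0 < α)
    {h R : ℝ} {G : ℝ → ℝ} (hh : 0 < h) (hR : 0 < R)
    (hG : ∀ r ≥ R, HasDerivAt G (-(W r)⁻¹) r)
    (hGb : ∀ r ≥ R, 0 < G r ∧ h * (W r * G r) ≤ 1) {r₁ ε : ℝ} (hr₁ : R ≤ r₁)
    (hε : ε < 3 / 16 * h ^ 2) (hfε : ∀ x ∈ Icc 0 (u r₁), f x ≤ ε * x)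
    (hX : W r₁ * G r₁ * flux W (fun s => f (u s)) r₁ ≤ 3 / 4 * u r₁) {r : ℝ} (hr : r₁ ≤ r) :
    0 < u r := by
  set v := flux W fun s => f (u s) with hv
  have hd : ∀ r ≥ R, HasDerivAt (fun r => W r * G r * v r - 3 / 4 * u r)
      (W r * G r * f (u r) - v r / 4) r := by
    intro r hr
    have hr0 := hR.trans_le hr
    have hp := (hW.pos r hr0).ne'
    refine ((((hW.hasDerivAt r hr0).mul (hG r hr)).mul
      (hasDerivAt_flux hW (hu.continuous_source hfc) hr0)).sub
      ((hu.hasDerivAt r).const_mul (3 / 4))).congr_deriv ?_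
    simp only [← hv, Pi.mul_apply]
    field_simp
    ring
  have key := image_le_of_deriv_right_lt_deriv_boundary
    (f := fun r => W r * G r * v r - 3 / 4 * u r) (f' := fun r => W r * G r * f (u r) - v r / 4)
    (a := r₁) (b := r) (B := fun _ => 0) (B' := fun _ => 0)
    (fun s hs => (hd s (hr₁.trans hs.1)).continuousAt.continuousWithinAt)
    (fun s hs => (hd s (hr₁.trans hs.1)).hasDerivWithinAt) (by simpa using hX)
    (fun s => hasDerivAt_const s 0) ?_ (right_mem_Icc.2 hr)
  · have hrR := hr₁.trans hr
    have hr0 := hR.trans_le hrR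
    have := mul_pos (mul_pos (hW.pos r hr0) (hGb r hrR).1)
      (hu.flux_pos hW hfc hf0 hfp hα hr0)
    linarith
  · intro s hs hX0
    have hsR := hr₁.trans hs.1
    have hs0 := hR.trans_le hsR
    have hvp : 0 < v s := hu.flux_pos hW hfc hf0 hfp hα hs0
    have hwp := mul_pos (hW.pos s hs0) (hGb s hsR).1
    have hus : u s = 4 / 3 * (W s * G s * v s) := by linarith
    have hu0 : 0 ≤ u s := by rw [hus]; positivity
    have hfs := hfε (u s) ⟨hu0, hu.antitone hW hf0 hs.1⟩
    have h1 := (hGb s hsR).2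
    generalize W s * G s = k at *
    have h2 : ε * k ^ 2 < 3 / 16 := by
      have h3 : (h * k) ^ 2 ≤ 1 := by
        rw [sq_le_one_iff₀ (by positivity)]; exact h1
      have h4 : ε * k ^ 2 < 3 / 16 * h ^ 2 * k ^ 2 := by gcongr
      nlinarith
    have h5 : k * f (u s) ≤ k * (ε * (4 / 3 * (k * v s))) := by
      rw [← hus]; gcongr
    nlinarith

end Solutions

section Energy

variable {m : ℕ} {W H f u : ℝ → ℝ} {α : ℝ}

lemma IsFluxSolution.hasDerivAt_mul_flux (hW : IsRadialWeight_s3 m W H)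
    (hu : IsFluxSolution W f u α) (hfc : Continuous f) {r : ℝ} (hr : 0 < r) :
    HasDerivAt (fun r => W r * flux W (fun s => f (u s)) r) (W r * f (u r)) r := by
  refine ((hW.hasDerivAt r hr).mul
    (hasDerivAt_flux hW (hu.continuous_source hfc) hr)).congr_deriv ?_
  ring

/-- A positive solution dominated by a power of the decaying harmonic function is square
integrable. -/
lemma IsFluxSolution.integrableOn_sq (hW : IsRadialWeight_s3 m W H) (hu : IsFluxSolution W f u α)
    (hpos : ∀ r ≥ 0, 0 < u r)
    {h R : ℝ} {G : ℝ → ℝ} (hh : 0 < h) (hR : 0 < R) (hHR : ∀ r ≥ R, h ≤ H r)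
    (hG : ∀ r ≥ R, HasDerivAt G (-(W r)⁻¹) r)
    (hGb : ∀ r ≥ R, 0 < G r ∧ h * (W r * G r) ≤ 1)
    (hX : ∀ r ≥ R, 3 / 4 * u r ≤ W r * G r * flux W (fun s => f (u s)) r) :
    IntegrableOn (fun r => u r ^ 2 * W r) (Ioi 0) := by
  have hWc := hW.cont
  have huc := hu.cont
  have hWp : ∀ r ≥ R, 0 < W r := fun r hr => hW.pos r (hR.trans_le hr)
  have hanti : AntitoneOn (fun r => u r ^ 4 / G r ^ 3) (Ici R) := by
    have hd : ∀ r ≥ R, HasDerivAt (fun r => u r ^ 4 / G r ^ 3) _ r := fun r hr =>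
      ((hu.hasDerivAt r).pow 4).div ((hG r hr).pow 3) (pow_pos (hGb r hr).1 3).ne'
    refine antitoneOn_of_hasDerivWithinAt_nonpos (convex_Ici R)
      (fun r hr => (hd r hr).continuousAt.continuousWithinAt)
      (fun r hr => (hd r (interior_subset hr)).hasDerivWithinAt) fun r hr => ?_
    rw [interior_Ici] at hr
    have hr' : R ≤ r := hr.le
    have h1 := hX r hr'
    have h2 := hWp r hr'
    have h3 := (hGb r hr').1
    have h4 := hpos r (hR.le.trans hr')
    refine div_nonpos_of_nonpos_of_nonneg ?_ (by positivity)
    generalize flux W (fun s => f (u s)) r = v at *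
    have : u r ^ 3 * G r ^ 2 * (W r)⁻¹ * (3 * u r - 4 * (W r * G r * v)) ≤ 0 :=
      mul_nonpos_of_nonneg_of_nonpos (by positivity) (by linarith)
    refine le_of_eq_of_le ?_ this
    simp only [Pi.pow_apply]
    push_cast
    field_simp
    ring
  have hmono : MonotoneOn (fun r => W r * exp (-h * r)) (Ici R) := by
    have hd : ∀ r ≥ R, HasDerivAt (fun r => W r * exp (-h * r))
        (H r * W r * exp (-h * r) + W r * (exp (-h * r) * (-h * 1))) r := fun r hr =>
      (hW.hasDerivAt r (hR.trans_le hr)).mul ((hasDerivAt_id r).const_mul (-h)).exp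
    refine monotoneOn_of_hasDerivWithinAt_nonneg (convex_Ici R)
      (fun r hr => (hd r hr).continuousAt.continuousWithinAt)
      (fun r hr => (hd r (interior_subset hr)).hasDerivWithinAt) fun r hr => ?_
    rw [interior_Ici] at hr
    have h1 : 0 ≤ (H r - h) * (W r * exp (-h * r)) :=
      mul_nonneg (by linarith [hHR r hr.le]) (mul_nonneg (hW.nonneg r) (exp_pos _).le)
    linarith
  set C : ℝ := u R ^ 4 / G R ^ 3 with hC
  have hC0 : 0 ≤ C := by
    have := (hGb R le_rfl).1
    have := hpos R hR.le
    positivity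
  set k : ℝ := W R * exp (-h * R) with hk
  have hk0 : 0 < k := mul_pos (hWp R le_rfl) (exp_pos _)
  have hbound : ∀ r ≥ R, (u r ^ 2 * W r) ^ 2 ≤ C / (h ^ 3 * k) * exp (-h * r) := by
    intro r hr
    have h1 := hWp r hr
    obtain ⟨h2, h3⟩ := hGb r hr
    have h4 : u r ^ 4 ≤ C * G r ^ 3 := by
      rw [← div_le_iff₀ (by positivity)]
      exact hanti self_mem_Ici hr hr
    have h5 : k ≤ W r * exp (-h * r) := hmono self_mem_Ici hr hr
    have h6 : (h * (W r * G r)) ^ 3 ≤ 1 := pow_le_one₀ (by positivity) h3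
    rw [div_mul_eq_mul_div, le_div_iff₀ (by positivity)]
    calc (u r ^ 2 * W r) ^ 2 * (h ^ 3 * k) = u r ^ 4 * (W r ^ 2 * h ^ 3 * k) := by ring
      _ ≤ C * G r ^ 3 * (W r ^ 2 * h ^ 3 * (W r * exp (-h * r))) := by gcongr
      _ = C * (h * (W r * G r)) ^ 3 * exp (-h * r) := by ring
      _ ≤ C * 1 * exp (-h * r) := by gcongr
      _ = _ := by ring
  have hO : (fun r => u r ^ 2 * W r) =O[atTop] fun r => exp (-(h / 2) * r) := by
    refine IsBigO.of_bound (√(C / (h ^ 3 * k))) ?_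
    filter_upwards [eventually_ge_atTop R] with r hr
    rw [Real.norm_of_nonneg (mul_nonneg (sq_nonneg _) (hW.nonneg r)),
      Real.norm_of_nonneg (exp_pos _).le]
    refine (sq_le_sq₀ (mul_nonneg (sq_nonneg _) (hW.nonneg r)) (by positivity)).1 ?_
    rw [mul_pow (√_), Real.sq_sqrt (by positivity), ← exp_nat_mul]
    refine (hbound r hr).trans_eq ?_
    congr 2
    push_cast
    ring
  exact integrable_of_isBigO_exp_neg (by positivity) (Continuous.continuousOn (by fun_prop)) hO

/-- The weighted Dirichlet energy of a positive solution is controlled by its `L²` norm. -/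
lemma IsFluxSolution.integrableOn_energy (hW : IsRadialWeight_s3 m W H)
    (hu : IsFluxSolution W f u α) (hfc : Continuous f) (hf0 : ∀ x, 0 ≤ f x)
    (hpos : ∀ r ≥ 0, 0 < u r) {K : ℝ} (hK : ∀ x ∈ Icc 0 α, f x ≤ K * x)
    (hint : IntegrableOn (fun r => u r ^ 2 * W r) (Ioi 0)) :
    IntegrableOn (fun r => (u r ^ 2 + flux W (fun s => f (u s)) r ^ 2) * W r) (Ioi 0) := by
  have hWc := hW.cont
  have huc := hu.cont
  have hsc := hu.continuous_source hfc
  have hvc := continuous_flux hW hsc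
  set v := flux W (fun s => f (u s)) with hv
  have hv0 : ∀ r, 0 ≤ v r := flux_nonneg hW fun s => hf0 (u s)
  have hcont : Continuous fun r => v r ^ 2 * W r := by fun_prop
  have hV : IntegrableOn (fun r => v r ^ 2 * W r) (Ioi 0) := by
    refine integrableOn_Ioi_of_intervalIntegral_norm_bounded
      (∫ r in Ioi 0, K * (u r ^ 2 * W r)) 0
      (fun i : ℝ => (hcont.integrableOn_Icc).mono_set Ioc_subset_Icc_self) tendsto_id ?_
    filter_upwards [eventually_ge_atTop 0] with r hr
    have hd : ∀ s ∈ Ioo 0 r, HasDerivAt (fun s => W s * v s * u s)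
        (W s * f (u s) * u s - v s ^ 2 * W s) s := fun s hs =>
      ((hu.hasDerivAt_mul_flux hW hfc hs.1).mul (hu.hasDerivAt s)).congr_deriv (by
        simp only [← hv]; ring)
    have hi1 : IntervalIntegrable (fun s => W s * f (u s) * u s) volume 0 r :=
      Continuous.intervalIntegrable (by fun_prop) _ _
    have hi2 := hcont.intervalIntegrable (μ := volume) 0 r
    have hftc := intervalIntegral.integral_eq_sub_of_hasDerivAt_of_le hr
      (Continuous.continuousOn (by fun_prop)) hd (hi1.sub hi2)
    rw [intervalIntegral.integral_sub hi1 hi2, hW.zero 0 le_rfl, zero_mul, zero_mul, sub_zero]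
      at hftc
    have hend : 0 ≤ W r * v r * u r :=
      mul_nonneg (mul_nonneg (hW.nonneg r) (hv0 r)) (hpos r hr).le
    have hle : ∫ s in (0 : ℝ)..r, W s * f (u s) * u s ≤
        ∫ s in (0 : ℝ)..r, K * (u s ^ 2 * W s) := by
      refine intervalIntegral.integral_mono_on hr hi1
        (Continuous.intervalIntegrable (by fun_prop) _ _) fun s hs => ?_
      have h1 := hpos s hs.1
      have h2 := hK (u s) ⟨h1.le, hu.le_init hW hf0 hs.1⟩
      calc W s * f (u s) * u s = W s * u s * f (u s) := by ring
        _ ≤ W s * u s * (K * u s) :=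
          mul_le_mul_of_nonneg_left h2 (mul_nonneg (hW.nonneg s) h1.le)
        _ = _ := by ring
    have hle2 : ∫ s in (0 : ℝ)..r, K * (u s ^ 2 * W s) ≤
        ∫ s in Ioi 0, K * (u s ^ 2 * W s) := by
      rw [intervalIntegral.integral_of_le hr]
      refine setIntegral_mono_set (hint.const_mul K) ?_
        (LE.le.eventuallyLE Ioc_subset_Ioi_self)
      filter_upwards [ae_restrict_mem measurableSet_Ioi] with s hs
      have h1 := hpos s (le_of_lt hs)
      have h2 := (hf0 _).trans (hK (u s) ⟨h1.le, hu.le_init hW hf0 (le_of_lt hs)⟩)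
      have := mul_nonneg (mul_nonneg h2 h1.le) (hW.nonneg s)
      simp only [Pi.zero_apply]
      linarith
    have hnorm : ∫ s in (0 : ℝ)..id r, ‖v s ^ 2 * W s‖ = ∫ s in (0 : ℝ)..r, v s ^ 2 * W s :=
      intervalIntegral.integral_congr fun s _ =>
        Real.norm_of_nonneg (mul_nonneg (sq_nonneg _) (hW.nonneg s))
    rw [hnorm]
    linarith
  simp only [add_mul]
  exact hint.add hV

end Energy

section Pohozaev

variable {m : ℕ} {W H : ℝ → ℝ} {p : ℝ}

/-- Positive solutions are bounded away from the origin independently of the initial value. -/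
lemma exists_universal_bound (hW : IsRadialWeight_s3 m W H) (hp : 1 < p) {δ : ℝ} (hδ : 0 < δ) :
    ∃ B, ∀ A > 0, ∀ u, IsFluxSolution W (truncPow p A) u A → (∀ r ≥ 0, 0 < u r) →
      u δ ≤ B ∧ flux W (fun s => truncPow p A (u s)) δ ≤ B := by
  have hWc := hW.cont
  have hp0 : 0 < p := by linarith
  have hone : Continuous fun _ : ℝ => (1 : ℝ) := continuous_const
  obtain ⟨x₀, hx₀, hmin⟩ := (isCompact_Icc (a := δ / 2) (b := δ)).exists_isMinOn
    ⟨δ, by constructor <;> linarith⟩ (continuous_flux hW hone).continuousOn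
  set c := flux W (fun _ => 1) x₀ with hc
  have hc0 : 0 < c := by
    have hx : 0 < x₀ := by linarith [hx₀.1]
    refine mul_pos (inv_pos.2 (hW.pos _ hx)) ?_
    exact intervalIntegral.integral_pos hx (Continuous.continuousOn (by fun_prop))
      (fun s _ => mul_nonneg (hW.nonneg s) zero_le_one)
      ⟨x₀, ⟨hx.le, le_rfl⟩, by simpa using hW.pos _ hx⟩
  set b := ((p - 1) * c * (δ / 2)) ^ (1 / (1 - p)) with hb
  have hb0 : 0 < b := Real.rpow_pos_of_pos (by nlinarith [mul_pos (sub_pos.2 hp) hc0]) _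
  set k := W δ / W (2 * δ) with hk
  have hW1 := hW.pos δ hδ
  have hW2 := hW.pos (2 * δ) (by linarith)
  have hk0 : 0 < k := div_pos hW1 hW2
  refine ⟨max b (b / (k * δ)), fun A hA u hu hpos => ?_⟩
  have hfc : Continuous (truncPow p A) := continuous_truncPow hp0
  have hf0 : ∀ x, 0 ≤ truncPow p A x := truncPow_nonneg hA.le
  have hfm : Monotone (truncPow p A) := monotone_truncPow hp0 hA.le
  have hsc := hu.continuous_source hfc
  have hanti := hu.antitone hW hf0
  have hfu : ∀ r ≥ 0, truncPow p A (u r) = u r ^ p := fun r hr =>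
    truncPow_of_mem ⟨(hpos r hr).le, hu.le_init hW hf0 hr⟩
  set v := flux W (fun s => truncPow p A (u s)) with hv
  have hvlow : ∀ r ∈ Icc (δ / 2) δ, c * u r ^ p ≤ v r := by
    intro r hr
    have hr0 : 0 ≤ r := by linarith [hr.1]
    have h1 : flux W (fun _ => u r ^ p * 1) r ≤ v r :=
      flux_mono hW (by fun_prop) hsc hr0 fun s hs => by
        rw [mul_one, ← hfu r hr0]
        exact hfm (hanti hs.2)
    rw [flux_const_mul] at h1
    have h2 : c ≤ flux W (fun _ => 1) r := hmin hr
    have h3 := Real.rpow_nonneg (hpos r hr0).le p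
    nlinarith
  have hub : u δ ≤ b := by
    have hd : ∀ r ≥ 0, HasDerivAt (fun r => u r ^ (1 - p)) (-v r * (1 - p) * u r ^ (1 - p - 1)) r :=
      fun r hr => (hu.hasDerivAt r).rpow_const (Or.inl (hpos r hr).ne')
    have hle : δ / 2 ≤ δ := by linarith
    have := (convex_Icc (δ / 2) δ).mul_sub_le_image_sub_of_le_deriv
      (f := fun r => u r ^ (1 - p)) (C := (p - 1) * c)
      (fun r hr => (hd r (by linarith [hr.1])).continuousAt.continuousWithinAt)
      (fun r hr => (hd r (by
        have := (interior_subset hr).1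
        linarith)).differentiableAt.differentiableWithinAt)
      (fun r hr => by
        have hr' := interior_subset hr
        have hr0 : 0 ≤ r := by linarith [hr'.1]
        rw [(hd r hr0).deriv, show 1 - p - 1 = -p by ring]
        have h1 : c ≤ v r * u r ^ (-p) := by
          rw [Real.rpow_neg (hpos r hr0).le, ← div_eq_mul_inv,
            le_div_iff₀ (Real.rpow_pos_of_pos (hpos r hr0) p)]
          exact hvlow r hr'
        nlinarith)
      (δ / 2) (left_mem_Icc.2 hle) δ (right_mem_Icc.2 hle) hle
    have h2 : (p - 1) * c * (δ / 2) ≤ u δ ^ (1 - p) := by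
      have := Real.rpow_nonneg (hpos (δ / 2) (by linarith)).le (1 - p)
      linarith
    have h3 : 0 < (p - 1) * c * (δ / 2) := by
      have := sub_pos.2 hp
      positivity
    have h4 := Real.rpow_le_rpow_of_nonpos h3 h2 (z := 1 / (1 - p))
      (one_div_nonpos.2 (by linarith))
    rwa [← Real.rpow_mul (hpos δ hδ.le).le, mul_one_div_cancel (by linarith),
      Real.rpow_one] at h4
  refine ⟨hub.trans (le_max_left _ _), ?_⟩
  have hle : δ ≤ 2 * δ := by linarith
  have h1 := (convex_Icc δ (2 * δ)).image_sub_le_mul_sub_of_deriv_le hu.cont.continuousOn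
    (fun r _ => (hu.hasDerivAt r).differentiableAt.differentiableWithinAt) (C := -(k * v δ))
    (fun r hr => by
      have hr' := interior_subset hr
      have hr0 : 0 < r := hδ.trans_le hr'.1
      rw [(hu.hasDerivAt r).deriv, neg_le_neg_iff, hk, div_mul_eq_mul_div, div_le_iff₀ hW2]
      have hmono : W δ * v δ ≤ W r * v r := by
        have hc : Continuous fun s => W s * truncPow p A (u s) := hWc.mul hsc
        rw [hv, mul_flux hW hδ.le, mul_flux hW hr0.le, ← sub_nonneg,
          intervalIntegral.integral_interval_sub_left (hc.intervalIntegrable _ _)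
            (hc.intervalIntegrable _ _)]
        exact intervalIntegral.integral_nonneg hr'.1
          fun s _ => mul_nonneg (hW.nonneg s) (hf0 _)
      have hvr : 0 ≤ v r := flux_nonneg hW (fun s => hf0 (u s)) r
      nlinarith [hW.mono hr'.2])
    δ (left_mem_Icc.2 hle) (2 * δ) (right_mem_Icc.2 hle) hle
  refine le_trans ?_ (le_max_right _ _)
  rw [le_div_iff₀ (by positivity)]
  have h2 := hpos (2 * δ) (by linarith)
  nlinarith

/-- Derivative of the Pohozaev functional of a positive solution. -/
lemma hasDerivAt_pohozaev (hW : IsRadialWeight_s3 m W H) {f u : ℝ → ℝ} {α : ℝ}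
    (hu : IsFluxSolution W f u α) (hfc : Continuous f) (hp : 0 < p) (a : ℝ) {t : ℝ} (ht : 0 < t)
    (hut : 0 < u t) (hft : f (u t) = u t ^ p) :
    HasDerivAt (fun t => t * (W t * (flux W (fun s => f (u s)) t ^ 2 / 2 +
        u t ^ (p + 1) / (p + 1))) - a * (W t * (u t * flux W (fun s => f (u s)) t)))
      (W t * (flux W (fun s => f (u s)) t ^ 2 * (1 / 2 - t * H t / 2 + a) +
        u t ^ (p + 1) * ((1 + t * H t) / (p + 1) - a))) t := by
  have hd := hasDerivAt_flux hW (hu.continuous_source hfc) ht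
  have hdW := hW.hasDerivAt t ht
  have hdu := hu.hasDerivAt t
  set v := flux W (fun s => f (u s)) with hv
  have hpow : HasDerivAt (fun t => u t ^ (p + 1) / (p + 1)) (-v t * u t ^ p) t := by
    refine ((hdu.rpow_const (p := p + 1) (Or.inl hut.ne')).div_const (p + 1)).congr_deriv ?_
    rw [add_sub_cancel_right]
    field_simp
  refine (((hasDerivAt_id t).mul (hdW.mul (((hd.pow 2).div_const 2).add hpow))).sub
    ((hdW.mul (hdu.mul hd)).const_mul a)).congr_deriv ?_
  simp only [id, Pi.add_apply, Pi.mul_apply, Pi.pow_apply, hft, Real.rpow_add_one hut.ne']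
  push_cast
  field_simp
  ring

/-- In the subcritical range, solutions with a large initial value change sign. -/
theorem exists_sign_changing (hW : IsRadialWeight_s3 m W H) (hm : 1 ≤ m) (hp : 1 < p)
    (hsub : p * ((m : ℝ) - 1) < m + 3) :
    ∃ A > 0, ∀ u, IsFluxSolution W (truncPow p A) u A → ∃ r ≥ 0, u r < 0 := by
  have hp0 : 0 < p := by linarith
  have hm' : (1 : ℝ) ≤ m := by exact_mod_cast hm
  have hgap : ((m : ℝ) - 1) / 2 < (m + 1) / (p + 1) := by
    rw [div_lt_div_iff₀ (by norm_num) (by linarith)]; nlinarith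
  obtain ⟨a, ha1, ha2⟩ := exists_between hgap
  obtain ⟨κ, hκ1, hκ2⟩ := exists_between (sub_pos.2 ha2)
  obtain ⟨c, hc, hcW⟩ := hW.lower
  have hlim1 : Tendsto (fun t => 1 / 2 - t * H t / 2 + a) (𝓝[>] 0) (𝓝 (1 / 2 - m / 2 + a)) :=
    ((hW.tendsto.div_const 2).const_sub _).add_const a
  have hlim2 : Tendsto (fun t => (1 + t * H t) / (p + 1) - a) (𝓝[>] 0)
      (𝓝 ((m + 1) / (p + 1) - a)) := by
    rw [add_comm (m : ℝ) 1]
    exact ((hW.tendsto.const_add 1).div_const _).sub_const a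
  have hev := ((hlim1.eventually (lt_mem_nhds (show 0 < 1 / 2 - (m : ℝ) / 2 + a by linarith))).and
    (hlim2.eventually (lt_mem_nhds hκ2))).and hcW
  obtain ⟨δ, hδ, hsubset⟩ := mem_nhdsGT_iff_exists_Ioc_subset.1 hev
  replace hδ : 0 < δ := hδ
  obtain ⟨B, hB⟩ := exists_universal_bound hW hp hδ
  set D := δ * (W δ * (B ^ 2 / 2 + B ^ (p + 1) / (p + 1))) with hD
  set q := κ * c * (1 / 2) ^ (p + 1) * (1 / 2) ^ (m + 1) / (m + 1) with hq
  have hq0 : 0 < q := by positivity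
  set γ := p + 1 - (p - 1) / 2 * (m + 1) with hγ
  have hγ0 : 0 < γ := by rw [hγ]; nlinarith
  have hA1 : ∀ᶠ A : ℝ in atTop, D < q * A ^ γ :=
    ((tendsto_rpow_atTop hγ0).const_mul_atTop hq0).eventually_gt_atTop D
  have hA2 : ∀ᶠ A : ℝ in atTop, A ^ (-((p - 1) / 2)) < δ :=
    (tendsto_rpow_neg_atTop (by linarith)).eventually (gt_mem_nhds hδ)
  obtain ⟨A, ⟨hA1, hA2⟩, hA⟩ := ((hA1.and hA2).and (eventually_gt_atTop 0)).exists
  refine ⟨A, hA, fun u hu => ?_⟩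
  by_contra! hcon
  have hfc : Continuous (truncPow p A) := continuous_truncPow hp0
  have hf0 : ∀ x, 0 ≤ truncPow p A x := truncPow_nonneg hA.le
  have hfm : Monotone (truncPow p A) := monotone_truncPow hp0 hA.le
  have hfp : ∀ x > 0, 0 < truncPow p A x := fun x hx =>
    Real.rpow_pos_of_pos (lt_min (lt_max_of_lt_left hx) hA) p
  have hpos : ∀ r ≥ 0, 0 < u r := fun r hr => hu.pos_of_nonneg hW hfc hf0 hfp hA hcon hr
  have hfu : ∀ r ≥ 0, truncPow p A (u r) = u r ^ p := fun r hr =>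
    truncPow_of_mem ⟨(hpos r hr).le, hu.le_init hW hf0 hr⟩
  obtain ⟨hBu, hBv⟩ := hB A hA u hu hpos
  have hWc := hW.cont
  have huc := hu.cont
  have hvc := continuous_flux hW (hu.continuous_source hfc)
  have hderiv := fun t ht => hasDerivAt_pohozaev hW hu hfc hp0 a (t := t) ht (hpos t (le_of_lt ht))
    (hfu t (le_of_lt ht))
  have hv0 : ∀ r, 0 ≤ flux W (fun s => truncPow p A (u s)) r :=
    flux_nonneg hW fun s => hf0 (u s)
  set v := flux W (fun s => truncPow p A (u s)) with hv
  set P : ℝ → ℝ := fun t => t * (W t * (v t ^ 2 / 2 + u t ^ (p + 1) / (p + 1)))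
    - a * (W t * (u t * v t)) with hP
  have hPc : Continuous P := by
    have : Continuous fun t => u t ^ (p + 1) :=
      huc.rpow_const fun _ => Or.inr (by linarith)
    fun_prop
  have hP' : ∀ t ∈ Ioc 0 δ, κ * (W t * u t ^ (p + 1)) ≤
      W t * (v t ^ 2 * (1 / 2 - t * H t / 2 + a) +
        u t ^ (p + 1) * ((1 + t * H t) / (p + 1) - a)) := by
    intro t ht
    obtain ⟨⟨h1, h2⟩, -⟩ := hsubset ht
    have h3 := Real.rpow_nonneg (hpos t ht.1.le).le (p + 1)
    have h4 : κ * u t ^ (p + 1) ≤ v t ^ 2 * (1 / 2 - t * H t / 2 + a) +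
        u t ^ (p + 1) * ((1 + t * H t) / (p + 1) - a) := by
      nlinarith [mul_nonneg (sq_nonneg (v t)) h1.le]
    nlinarith [mul_le_mul_of_nonneg_left h4 (hW.nonneg t)]
  set ρ := A ^ (-((p - 1) / 2)) / 2 with hρ
  have hApow : 0 < A ^ (-((p - 1) / 2)) := Real.rpow_pos_of_pos hA _
  have hρ0 : 0 < ρ := by positivity
  have hρδ : ρ ≤ δ := by linarith
  have hhalf : ∀ t ∈ Icc 0 ρ, A / 2 ≤ u t := by
    intro t ht
    refine le_trans ?_ (hu.antitone hW hf0 ht.2)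
    refine le_trans ?_ (hu.lower_bound hW hfc hf0 hfm hρ0.le)
    have : truncPow p A A * ρ ^ 2 = A / 4 := by
      rw [truncPow_of_mem ⟨hA.le, le_rfl⟩, hρ, div_pow, ← Real.rpow_mul_natCast hA.le,
        mul_div_assoc', ← Real.rpow_add hA]
      norm_num
    rw [this]
    linarith
  have hPmono : MonotoneOn P (Icc 0 δ) := by
    refine monotoneOn_of_hasDerivWithinAt_nonneg (convex_Icc _ _) hPc.continuousOn
      (fun t ht => (hderiv t (by rw [interior_Icc] at ht; exact ht.1)).hasDerivWithinAt)
      fun t ht => ?_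
    rw [interior_Icc] at ht
    refine le_trans ?_ (hP' t ⟨ht.1, ht.2.le⟩)
    have h1 := hW.nonneg t
    have h2 := Real.rpow_nonneg (hpos t ht.1.le).le (p + 1)
    positivity
  have hPlow : κ * c * (A / 2) ^ (p + 1) * ρ ^ (m + 1) / (m + 1) ≤ P ρ := by
    have hd : ∀ t ∈ Ioo 0 ρ, HasDerivAt
        (fun t => P t - κ * c * (A / 2) ^ (p + 1) * (t ^ (m + 1) / (m + 1))) _ t := fun t ht =>
      (hderiv t ht.1).sub (((hasDerivAt_pow (m + 1) t).div_const ((m : ℝ) + 1)).const_mul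
        (κ * c * (A / 2) ^ (p + 1)))
    have := monotoneOn_of_hasDerivWithinAt_nonneg (convex_Icc 0 ρ)
      (f := fun t => P t - κ * c * (A / 2) ^ (p + 1) * (t ^ (m + 1) / (m + 1)))
      (Continuous.continuousOn (by fun_prop))
      (fun t ht => (hd t (by rwa [interior_Icc] at ht)).hasDerivWithinAt)
      (fun t ht => by
        rw [interior_Icc] at ht
        have h1 := hP' t ⟨ht.1, ht.2.le.trans hρδ⟩
        have h2 : c * t ^ m ≤ W t := (hsubset ⟨ht.1, ht.2.le.trans hρδ⟩).2
        have h3 : (A / 2) ^ (p + 1) ≤ u t ^ (p + 1) :=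
          Real.rpow_le_rpow (by positivity) (hhalf t ⟨ht.1.le, ht.2.le⟩) (by linarith)
        have h4 : κ * ((c * t ^ m) * (A / 2) ^ (p + 1)) ≤ κ * (W t * u t ^ (p + 1)) := by
          have := ht.1
          have := hW.nonneg t
          gcongr
        have h5 : κ * c * (A / 2) ^ (p + 1) * (((m + 1 : ℕ) : ℝ) * t ^ (m + 1 - 1) / ((m : ℝ) + 1))
            = κ * ((c * t ^ m) * (A / 2) ^ (p + 1)) := by
          rw [Nat.add_sub_cancel]
          push_cast
          field_simp
        rw [h5]
        linarith)
      (left_mem_Icc.2 hρ0.le) (right_mem_Icc.2 hρ0.le) hρ0.le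
    have hP0 : P 0 = 0 := by simp [hP, hW.zero 0 le_rfl]
    simp only [hP0, zero_pow (Nat.succ_ne_zero m), zero_div, mul_zero, sub_zero] at this
    rw [mul_div_assoc]
    linarith
  have hPup : P δ ≤ D := by
    have h1 := hpos δ hδ.le
    have h2 := hv0 δ
    have h3 := hW.nonneg δ
    have h4 : 0 ≤ a * (W δ * (u δ * v δ)) :=
      mul_nonneg (by linarith) (by positivity)
    have h5 : δ * (W δ * (v δ ^ 2 / 2 + u δ ^ (p + 1) / (p + 1))) ≤ D := by
      rw [hD]
      gcongr
    simp only [hP]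
    linarith
  have hval : κ * c * (A / 2) ^ (p + 1) * ρ ^ (m + 1) / (m + 1) = q * A ^ γ := by
    have h1 : (A / 2) ^ (p + 1) = A ^ (p + 1) * (1 / 2) ^ (p + 1) := by
      rw [div_eq_mul_one_div, Real.mul_rpow hA.le (by norm_num)]
    have h2 : ρ ^ (m + 1) = A ^ (-((p - 1) / 2) * ((m + 1 : ℕ) : ℝ)) * (1 / 2) ^ (m + 1) := by
      rw [hρ, div_eq_mul_one_div, mul_pow, ← Real.rpow_mul_natCast hA.le]
    have h3 : A ^ γ = A ^ (p + 1) * A ^ (-((p - 1) / 2) * ((m + 1 : ℕ) : ℝ)) := by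
      rw [← Real.rpow_add hA, hγ]
      congr 1
      push_cast
      ring
    rw [h1, h2, h3, hq]
    ring
  have := hPmono ⟨hρ0.le, hρδ⟩ ⟨hδ.le, le_rfl⟩ hρδ
  linarith

end Pohozaev

section Shooting

variable {m : ℕ} {W H : ℝ → ℝ} {p : ℝ}

lemma truncPow_le_mul (hp : 1 < p) {A l x : ℝ} (hA : 0 ≤ A) (hx : x ∈ Icc 0 l) :
    truncPow p A x ≤ l ^ (p - 1) * x := by
  calc truncPow p A x ≤ x ^ p := by
        rw [truncPow, max_eq_left hx.1]
        exact Real.rpow_le_rpow (le_min hx.1 hA) (min_le_left _ _) (by linarith)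
    _ = x ^ (p - 1) * x := by
        rw [← Real.rpow_add_one' hx.1 (by linarith), sub_add_cancel]
    _ ≤ l ^ (p - 1) * x :=
        mul_le_mul_of_nonneg_right (Real.rpow_le_rpow hx.1 hx.2 (by linarith)) hx.1

lemma continuous_of_abs_sub_le {g : ℝ → ℝ} {C : ℝ}
    (hg : ∀ x y, |g x - g y| ≤ C * |x - y|) : Continuous g :=
  (LipschitzWith.of_dist_le' (K := C) hg).continuous

/-- Solutions with a small initial value are positive. -/
lemma eventually_pos_of_small (hW : IsRadialWeight_s3 m W H) (hp : 1 < p) {A : ℝ} (hA : 0 < A) :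
    ∀ᶠ α in 𝓝[>] 0, ∀ u, IsFluxSolution W (truncPow p A) u α → ∀ r ≥ 0, 0 < u r := by
  have hp0 : 0 < p := by linarith
  obtain ⟨h, hh, R, hR, G, -, hG, hGb⟩ := hW.exists_tail
  have hlim : Tendsto (fun α : ℝ => α ^ (p - 1)) (𝓝[>] 0) (𝓝 0) := by
    have := (Real.continuousAt_rpow_const 0 (p - 1) (Or.inr (by linarith))).tendsto
    rw [Real.zero_rpow (by linarith)] at this
    exact this.mono_left nhdsWithin_le_nhds
  have hη : 0 < min (1 / (2 * R ^ 2)) (min (3 * h / (8 * R)) (3 / 16 * h ^ 2)) := by positivity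
  filter_upwards [hlim.eventually (gt_mem_nhds hη), self_mem_nhdsWithin] with α hα hα0 u hu r hr
  replace hα0 : 0 < α := hα0
  obtain ⟨h1, h2⟩ := lt_min_iff.1 hα
  obtain ⟨h2, h3⟩ := lt_min_iff.1 h2
  rw [lt_div_iff₀ (by positivity)] at h1 h2
  have hfc : Continuous (truncPow p A) := continuous_truncPow hp0
  have hf0 : ∀ x, 0 ≤ truncPow p A x := truncPow_nonneg hA.le
  have hfm : Monotone (truncPow p A) := monotone_truncPow hp0 hA.le
  have hfp : ∀ x > 0, 0 < truncPow p A x := fun x hx =>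
    Real.rpow_pos_of_pos (lt_min (lt_max_of_lt_left hx) hA) p
  have hfα := truncPow_le_mul hp hA.le (right_mem_Icc.2 hα0.le)
  have huR : α / 2 ≤ u R := by
    have := hu.lower_bound hW hfc hf0 hfm hR.le
    nlinarith [mul_le_mul_of_nonneg_right hfα (sq_nonneg R)]
  rcases le_total r R with hrR | hrR
  · linarith [hu.antitone hW hf0 hrR]
  · refine hu.pos_of_barrier hW hfc hf0 hfp hα0 hh hR hG hGb le_rfl h3 (fun x hx =>
      truncPow_le_mul hp hA.le ⟨hx.1, hx.2.trans (hu.le_init hW hf0 hR.le)⟩) ?_ hrR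
    have hv := hu.flux_le hW hfc hf0 hfm hR.le
    have hv0 := flux_nonneg hW (fun s => hf0 (u s)) R
    obtain ⟨hG0, hG1⟩ := hGb R le_rfl
    have hwg : 0 ≤ W R * G R := mul_nonneg (hW.nonneg R) hG0.le
    generalize flux W (fun s => truncPow p A (u s)) R = v at *
    generalize W R * G R = k at *
    have h4 : v ≤ 3 / 8 * h * α := by
      nlinarith [mul_le_mul_of_nonneg_right hfα hR.le]
    have h5 : k * v ≤ 3 / 8 * α := by
      calc k * v ≤ k * (3 / 8 * h * α) := by gcongr
        _ = h * k * (3 / 8 * α) := by ring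
        _ ≤ 1 * (3 / 8 * α) := by gcongr
        _ = _ := one_mul _
    linarith

/-- Shooting: there is a positive solution of finite energy. -/
theorem exists_pos_finite_energy (hW : IsRadialWeight_s3 m W H) (hm : 1 ≤ m) (hp : 1 < p)
    (hsub : p * ((m : ℝ) - 1) < m + 3) :
    ∃ A > 0, ∃ α ∈ Ioc 0 A, ∃ u, IsFluxSolution W (truncPow p A) u α ∧ (∀ r ≥ 0, 0 < u r) ∧
      IntegrableOn (fun r => (u r ^ 2 + flux W (fun s => truncPow p A (u s)) r ^ 2) * W r)
        (Ioi 0) := by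
  have hp0 : 0 < p := by linarith
  obtain ⟨A, hA, hAneg⟩ := exists_sign_changing hW hm hp hsub
  have hfc : Continuous (truncPow p A) := continuous_truncPow hp0
  have hf0 : ∀ x, 0 ≤ truncPow p A x := truncPow_nonneg hA.le
  have hfm : Monotone (truncPow p A) := monotone_truncPow hp0 hA.le
  have hfp : ∀ x > 0, 0 < truncPow p A x := fun x hx =>
    Real.rpow_pos_of_pos (lt_min (lt_max_of_lt_left hx) hA) p
  have hfM : ∀ x, truncPow p A x ≤ A ^ p := truncPow_le hp0 hA.le
  have hAp : 0 < A ^ p := Real.rpow_pos_of_pos hA p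
  have hfL := abs_truncPow_sub_le hp hA.le
  obtain ⟨U, hU, hUL⟩ := exists_isFluxSolution hW hfc (M := A ^ p)
    (fun x => by rw [abs_of_nonneg (hf0 x)]; exact hfM x) hfL
  have hUc : ∀ r ≥ 0, Continuous fun α => U α r := by
    intro r hr
    obtain ⟨C, hC⟩ := hUL r hr
    exact continuous_of_abs_sub_le fun α β => hC α β r (right_mem_Icc.2 hr)
  have hVc : ∀ r ≥ 0, Continuous fun α => flux W (fun s => truncPow p A (U α s)) r := by
    intro r hr
    obtain ⟨C, hC⟩ := hUL r hr
    refine continuous_of_abs_sub_le (C := p * A ^ (p - 1) * C * r) fun α β => ?_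
    have hα := (hU α).continuous_source hfc
    have hβ := (hU β).continuous_source hfc
    rw [flux_sub hW hα hβ]
    refine (abs_flux_le hW (hα.sub hβ) hr).trans ?_
    have hL0 : 0 ≤ p * A ^ (p - 1) := mul_nonneg hp0.le (Real.rpow_nonneg hA.le _)
    have := intervalIntegral.integral_mono_on (μ := volume) hr
      ((hα.sub hβ).abs.intervalIntegrable 0 r)
      (intervalIntegrable_const (c := p * A ^ (p - 1) * (C * |α - β|))) fun s hs =>
        (hfL _ _).trans (mul_le_mul_of_nonneg_left (hC α β s hs) hL0)
    refine this.trans_eq ?_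
    rw [intervalIntegral.integral_const, smul_eq_mul]
    ring
  set S : Set ℝ := {α | α ∈ Icc 0 A ∧ ∃ r ≥ 0, U α r < 0} with hS
  have hAS : A ∈ S := ⟨⟨hA.le, le_rfl⟩, hAneg _ (hU A)⟩
  have hSb : BddBelow S := ⟨0, fun α hα => hα.1.1⟩
  obtain ⟨α₀, hα₀, hsmall⟩ := mem_nhdsGT_iff_exists_Ioc_subset.1 (eventually_pos_of_small hW hp hA)
  replace hα₀ : 0 < α₀ := hα₀
  set a := sInf S with ha
  have ha0 : 0 < a := by
    refine hα₀.trans_le (le_csInf ⟨A, hAS⟩ fun α hα => ?_)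
    by_contra! hlt
    obtain ⟨hα1, r, hr, hneg⟩ := hα
    rcases hα1.1.eq_or_lt with h0 | h0
    · have := (hU α).lower_bound hW hfc hf0 hfm hr
      rw [← h0, truncPow_of_nonpos hp0 hA.le le_rfl] at this
      rw [← h0] at hneg
      linarith
    · exact (hsmall ⟨h0, hlt.le⟩ _ (hU α) r hr).not_gt hneg
  have haA : a ≤ A := csInf_le hSb hAS
  have hnonneg : ∀ r ≥ 0, 0 ≤ U a r := by
    intro r hr
    by_contra! hneg
    have hev : ∀ᶠ α in 𝓝[<] a, U α r < 0 :=
      (((hUc r hr).tendsto a).eventually (gt_mem_nhds hneg)).filter_mono nhdsWithin_le_nhds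
    obtain ⟨α, hα, hα'⟩ := (hev.and (Ioo_mem_nhdsLT ha0)).exists
    exact notMem_of_lt_csInf hα'.2 hSb ⟨⟨hα'.1.le, hα'.2.le.trans haA⟩, r, hr, hα⟩
  have hpos : ∀ r ≥ 0, 0 < U a r := fun r hr =>
    (hU a).pos_of_nonneg hW hfc hf0 hfp ha0 hnonneg hr
  have hopen : ¬ ∀ᶠ α in 𝓝 a, 0 < α → ∀ r ≥ 0, 0 ≤ U α r := by
    intro hev
    have hfreq := mem_closure_iff_frequently.1 (csInf_mem_closure ⟨A, hAS⟩ hSb)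
    obtain ⟨α, ⟨-, r, hr, hneg⟩, hα, hα0⟩ :=
      (hfreq.and_eventually (hev.and (lt_mem_nhds ha0))).exists
    exact (hα hα0 r hr).not_gt hneg
  refine ⟨A, hA, a, ⟨ha0, haA⟩, U a, hU a, hpos, ?_⟩
  by_cases hL : ∃ l > 0, ∀ r ≥ 0, l ≤ U a r
  · refine absurd ?_ hopen
    obtain ⟨l₀, hl₀, hl₀u⟩ := hL
    set l := sInf (U a '' Ici 0) with hl
    have hne : (U a '' Ici 0).Nonempty := ⟨_, 0, self_mem_Ici, rfl⟩
    have hbdd : BddBelow (U a '' Ici 0) := ⟨l₀, by rintro _ ⟨r, hr, rfl⟩; exact hl₀u r hr⟩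
    have hl0 : 0 < l := hl₀.trans_le (le_csInf hne (by rintro _ ⟨r, hr, rfl⟩; exact hl₀u r hr))
    have hlu : ∀ r ≥ 0, l ≤ U a r := fun r hr => csInf_le hbdd ⟨r, hr, rfl⟩
    have hfl := hfp l hl0
    have hη : 0 < l / 2 / (A ^ p / truncPow p A l) := by positivity
    obtain ⟨_, ⟨r₁, hr₁, rfl⟩, hr₁l⟩ := exists_lt_of_csInf_lt hne (lt_add_of_pos_right l hη)
    have hr₁0 : 0 ≤ r₁ := hr₁
    have hlt : l / 2 < U a r₁ := by linarith [hlu r₁ hr₁0]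
    filter_upwards [((hUc r₁ hr₁0).tendsto a).eventually (lt_mem_nhds hlt)] with α hα hα0 r hr
    rcases le_total r r₁ with hrr | hrr
    · linarith [(hU α).antitone hW hf0 hrr]
    · have h1 := (hU a).sub_le_of_lower_bound hW (hU α) hfc hfm hfM hfl hlu hr₁0 hrr
      have h2 : A ^ p / truncPow p A l * (U a r₁ - U a r) ≤ l / 2 := by
        rw [← le_div_iff₀' (by positivity)]
        linarith [hlu r hr]
      linarith
  · push Not at hL
    obtain ⟨h, hh, R, hR, G, hHR, hG, hGb⟩ := hW.exists_tail
    have hlim : Tendsto (fun l : ℝ => l ^ (p - 1)) (𝓝[>] 0) (𝓝 0) := by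
      have := (Real.continuousAt_rpow_const 0 (p - 1) (Or.inr (by linarith))).tendsto
      rw [Real.zero_rpow (by linarith)] at this
      exact this.mono_left nhdsWithin_le_nhds
    obtain ⟨l, hlε, hl0⟩ := ((hlim.eventually (gt_mem_nhds
      (show 0 < 3 / 16 * h ^ 2 by positivity))).and self_mem_nhdsWithin).exists
    obtain ⟨r₀, hr₀, hr₀l⟩ := hL l hl0
    by_cases hcross : ∃ r₂ ≥ max R r₀,
        W r₂ * G r₂ * flux W (fun s => truncPow p A (U a s)) r₂ < 3 / 4 * U a r₂
    · refine absurd ?_ hopen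
      obtain ⟨r₂, hr₂, hX⟩ := hcross
      have hr₂R : R ≤ r₂ := (le_max_left _ _).trans hr₂
      have hr₂0 : 0 ≤ r₂ := hR.le.trans hr₂R
      have hlt : U a r₂ < l :=
        ((hU a).antitone hW hf0 ((le_max_right _ _).trans hr₂)).trans_lt hr₀l
      have hev1 := ((hUc r₂ hr₂0).tendsto a).eventually (gt_mem_nhds hlt)
      have hev2 := ((hUc r₂ hr₂0).tendsto a).eventually (lt_mem_nhds (hpos r₂ hr₂0))
      have hev3 := (((hVc r₂ hr₂0).const_mul (W r₂ * G r₂)).tendsto a).eventually_lt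
        (((hUc r₂ hr₂0).const_mul (3 / 4)).tendsto a) hX
      filter_upwards [hev1, hev2, hev3] with α h1 h2 h3 hα0 r hr
      rcases le_total r r₂ with hrr | hrr
      · exact h2.le.trans ((hU α).antitone hW hf0 hrr)
      · exact ((hU α).pos_of_barrier hW hfc hf0 hfp hα0 hh hR hG hGb hr₂R hlε
          (fun x hx => truncPow_le_mul hp hA.le ⟨hx.1, hx.2.trans h1.le⟩) h3.le hrr).le
    · push Not at hcross
      have hmax : R ≤ max R r₀ := le_max_left _ _
      exact (hU a).integrableOn_energy hW hfc hf0 hpos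
        (fun x hx => truncPow_le_mul hp hA.le hx)
        ((hU a).integrableOn_sq hW hpos hh (hR.trans_le hmax)
          (fun r hr => hHR r (hmax.trans hr)) (fun r hr => hG r (hmax.trans hr))
          (fun r hr => hGb r (hmax.trans hr)) hcross)

end Shooting

section Model

variable {m : ℕ} {W H : ℝ → ℝ}

/-- The hypotheses on `ψ` give a radial weight. -/
lemma isRadialWeight_of_model {n : ℕ} (hn : 3 ≤ n) {ψ : ℝ → ℝ} (h1 : H1 ψ) (h2 : H2 ψ)
    (h3 : H3 ψ) :
    IsRadialWeight_s3 (n - 1) (fun t => ψ (max t 0) ^ (n - 1))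
      (fun t => ((n : ℝ) - 1) * (deriv ψ t / ψ t)) := by
  obtain ⟨hc, h0, hd0, -, hpos⟩ := h1
  have hcast : ((n - 1 : ℕ) : ℝ) = n - 1 := by
    rw [Nat.cast_sub (by omega), Nat.cast_one]
  have hn1 : (0 : ℝ) < n - 1 := by
    have : (3 : ℝ) ≤ n := by exact_mod_cast hn
    linarith
  have hψd : ∀ t > 0, HasDerivAt ψ (deriv ψ t) t := fun t ht =>
    ((hc.contDiffAt (Ici_mem_nhds ht)).differentiableAt (by norm_num)).hasDerivAt
  have hψ0 : HasDerivAt ψ 1 0 := hd0 ▸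
    (differentiableAt_of_deriv_ne_zero (by rw [hd0]; exact one_ne_zero)).hasDerivAt
  have hψm : MonotoneOn ψ (Ici 0) := by
    refine monotoneOn_of_deriv_nonneg (convex_Ici 0) hc.continuousOn (fun t ht => ?_) fun t ht => ?_
    all_goals rw [interior_Ici] at ht
    · exact (hψd t ht).differentiableAt.differentiableWithinAt
    · exact h2 t ht
  have hψnonneg : ∀ t ≥ 0, 0 ≤ ψ t := fun t ht => by
    rcases ht.eq_or_lt with rfl | ht
    · exact h0.ge
    · exact (hpos t ht).le
  have hderiv : Tendsto (deriv ψ) (𝓝[>] 0) (𝓝 1) := by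
    have h := (hc.continuousOn_derivWithin (uniqueDiffOn_Ici 0) (by norm_num)) 0 self_mem_Ici
    rw [ContinuousWithinAt, hψ0.hasDerivWithinAt.derivWithin (uniqueDiffOn_Ici (0 : ℝ) 0
      self_mem_Ici)] at h
    refine (h.mono_left (nhdsWithin_mono _ Ioi_subset_Ici_self)).congr' ?_
    filter_upwards [self_mem_nhdsWithin] with t ht
    exact derivWithin_of_mem_nhds (Ici_mem_nhds ht)
  have hslope : Tendsto (fun t => ψ t / t) (𝓝[>] 0) (𝓝 1) := by
    have h := (hasDerivAt_iff_tendsto_slope.1 hψ0).mono_left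
      (nhdsWithin_mono (0 : ℝ) (s := Ioi 0) fun t ht => (ne_of_gt ht : t ≠ 0))
    refine h.congr fun t => ?_
    rw [slope_def_field, h0, sub_zero, sub_zero]
  refine ⟨?_, fun t ht => ?_, fun t ht => ?_, fun s t hst => ?_, fun t ht => ?_, ?_, ?_, ?_, ?_⟩
  · exact (hc.continuousOn.comp_continuous (by fun_prop) fun t => le_max_right t 0).pow _
  · simp only [max_eq_right ht, h0]
    exact zero_pow (by omega)
  · simp only [max_eq_left (le_of_lt ht)]
    exact pow_pos (hpos t ht) _
  · exact pow_le_pow_left₀ (hψnonneg _ (le_max_right _ _))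
      (hψm (le_max_right s 0) (le_max_right t 0) (max_le_max_right _ hst)) _
  · have hev : (fun t => ψ (max t 0) ^ (n - 1)) =ᶠ[𝓝 t] fun t => ψ t ^ (n - 1) := by
      filter_upwards [Ioi_mem_nhds ht] with s hs
      rw [max_eq_left (le_of_lt hs)]
    refine (((hψd t ht).pow (n - 1)).congr_of_eventuallyEq hev).congr_deriv ?_
    have hp := (hpos t ht).ne'
    obtain ⟨k, hk⟩ : ∃ k, n - 1 = k + 1 := ⟨n - 2, by omega⟩
    rw [max_eq_left (le_of_lt ht), hcast, hk, Nat.add_sub_cancel, pow_succ]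
    field_simp
  · refine continuousOn_const.mul (ContinuousOn.div ?_
      (hc.continuousOn.mono Ioi_subset_Ici_self) fun t ht => (hpos t ht).ne')
    exact (hc.mono Ioi_subset_Ici_self).continuousOn_deriv_of_isOpen isOpen_Ioi (by norm_num)
  · have h := (hderiv.div hslope one_ne_zero).const_mul ((n : ℝ) - 1)
    rw [div_one, mul_one, ← hcast] at h
    refine h.congr' ?_
    filter_upwards [self_mem_nhdsWithin] with t ht
    have hp := (hpos t ht).ne'
    have ht0 : t ≠ 0 := ne_of_gt ht
    simp only [Pi.div_apply, hcast]
    field_simp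
  · refine ⟨(1 / 2) ^ (n - 1), by positivity, ?_⟩
    filter_upwards [self_mem_nhdsWithin,
      hslope.eventually (lt_mem_nhds (show (1 / 2 : ℝ) < 1 by norm_num))] with t ht hlt
    replace ht : 0 < t := ht
    rw [max_eq_left ht.le, ← mul_pow]
    rw [lt_div_iff₀ ht] at hlt
    exact pow_le_pow_left₀ (by positivity) hlt.le _
  · obtain ⟨c, hc0, hev⟩ := h3
    obtain ⟨R, hR⟩ := eventually_atTop.1 hev
    exact ⟨(n - 1) * c, by positivity, max R 1, by positivity, fun r hr =>
      mul_le_mul_of_nonneg_left (hR r ((le_max_left _ _).trans hr)) hn1.le⟩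

lemma contDiffOn_flux (hW : IsRadialWeight_s3 m W H) {g : ℝ → ℝ} (hg : Continuous g) :
    ContDiffOn ℝ 1 (flux W g) (Ici 0) := by
  have hd := fun t ht => hasDerivAt_flux hW hg (t := t) ht
  have hvc := continuous_flux hW hg
  have hlim := tendsto_deriv_flux hW hg
  have h0 : HasDerivWithinAt (flux W g) (g 0 - m * (g 0 / (1 + m))) (Ici 0) 0 := by
    refine hasDerivWithinAt_Ici_of_tendsto_deriv (s := Ioi 0)
      (fun t ht => (hd t ht).differentiableAt.differentiableWithinAt)
      hvc.continuousWithinAt self_mem_nhdsWithin (hlim.congr' ?_)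
    filter_upwards [self_mem_nhdsWithin] with t ht
    exact (hd t ht).deriv.symm
  have hu := uniqueDiffOn_Ici (0 : ℝ)
  have hD : ∀ t > 0, derivWithin (flux W g) (Ici 0) t = g t - H t * flux W g t := fun t ht => by
    rw [derivWithin_of_mem_nhds (Ici_mem_nhds ht), (hd t ht).deriv]
  rw [contDiffOn_one_iff_derivWithin hu]
  refine ⟨fun t ht => ?_, fun t ht => ?_⟩
  · rcases (mem_Ici.1 ht).eq_or_lt with rfl | ht
    · exact h0.differentiableWithinAt
    · exact (hd t ht).differentiableAt.differentiableWithinAt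
  · rcases (mem_Ici.1 ht).eq_or_lt with rfl | ht
    · have : ContinuousWithinAt (derivWithin (flux W g) (Ici 0)) (Ioi 0) 0 := by
        rw [ContinuousWithinAt, h0.derivWithin (hu 0 self_mem_Ici)]
        refine hlim.congr' ?_
        filter_upwards [self_mem_nhdsWithin] with t ht
        exact (hD t ht).symm
      rw [← Ioi_insert]
      rwa [continuousWithinAt_insert_self, Ioi_insert]
    · have hcd : ContinuousAt (fun t => g t - H t * flux W g t) t :=
        hg.continuousAt.sub (((hW.contH.continuousAt (Ioi_mem_nhds ht))).mul hvc.continuousAt)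
      refine (hcd.congr ?_).continuousWithinAt
      filter_upwards [Ioi_mem_nhds ht] with s hs
      exact (hD s hs).symm

end Model

/-- Existence of a positive finite-energy radial solution in the subcritical case. -/
theorem statement3 (n : ℕ) (hn : 3 ≤ n) (p : ℝ) (hp : 1 < p)
    (hsub : p < ((n : ℝ) + 2) / ((n : ℝ) - 2)) (ψ : ℝ → ℝ)
    (h1 : H1 ψ) (h2 : H2 ψ) (h3 : H3 ψ) :
    ∃ (u : ℝ → ℝ) (α : ℝ), IsRadialSolution n p ψ u α ∧ 0 < α ∧
      (∀ r ≥ (0:ℝ), 0 < u r) ∧ InEnergySpace n ψ u := by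
  have hW := isRadialWeight_of_model hn h1 h2 h3
  have hn3 : (3 : ℝ) ≤ n := by exact_mod_cast hn
  have hcast : ((n - 1 : ℕ) : ℝ) = n - 1 := by
    rw [Nat.cast_sub (by omega), Nat.cast_one]
  obtain ⟨A, hA, α, hα, u, hu, hpos, hint⟩ := exists_pos_finite_energy hW (by omega) hp (by
    rw [lt_div_iff₀ (by linarith)] at hsub
    rw [hcast]
    linarith)
  have hp0 : 0 < p := by linarith
  have hfc : Continuous (truncPow p A) := continuous_truncPow hp0
  have hsc := hu.continuous_source hfc
  set W : ℝ → ℝ := fun t => ψ (max t 0) ^ (n - 1)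
  have hdu : deriv u = fun r => -flux W (fun s => truncPow p A (u s)) r :=
    funext fun r => (hu.hasDerivAt r).deriv
  refine ⟨u, α, ⟨?_, hu.init, ?_, fun r hr => ?_⟩, hα.1, hpos, ?_⟩
  · rw [show (2 : WithTop ℕ∞) = 1 + 1 from rfl,
      contDiffOn_succ_iff_derivWithin (uniqueDiffOn_Ici 0)]
    refine ⟨fun r _ => (hu.hasDerivAt r).differentiableAt.differentiableWithinAt, by simp, ?_⟩
    refine (contDiffOn_flux hW hsc).neg.congr fun r hr => ?_
    exact (hu.hasDerivAt r).hasDerivWithinAt.derivWithin (uniqueDiffOn_Ici (0 : ℝ) r hr)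
  · rw [hdu]
    simp only [flux_of_nonpos hW le_rfl, neg_zero]
  · have hur := hpos r hr.le
    rw [hdu, (hasDerivAt_flux hW hsc hr).fun_neg.deriv, abs_of_pos hur,
      ← Real.rpow_add_one hur.ne', sub_add_cancel,
      truncPow_of_mem ⟨hur.le, (hu.le_init hW (truncPow_nonneg hA.le) hr.le).trans hα.2⟩]
    ring
  · refine hint.congr_fun (fun r hr => ?_) measurableSet_Ioi
    simp only [hdu, neg_sq, W, max_eq_left (le_of_lt (mem_Ioi.1 hr))]
end
end

section
/- Let 1 < p < (n+2)/(n−2). Assume ψ satisfies (H1)–(H2), lim_{r→∞} ψ'(r)/ψ(r) = l ∈ (0, +∞], and, in case l = +∞, that the function [log(ψ'(r)/ψ(r))]' is bounded as r → ∞. Let u be a radial solution with u(r) > 0 for all r ≥ 0 that belongs to the radial energy space. Then there exists L ∈ (−∞, 0) such that lim_{r→∞} ψ(r)^{n−1} u'(r) = L. Moreover, if l < +∞ then lim_{r→∞} ψ(r)^{n−1} u(r) = |L|/((n−1) l), while if l = +∞ then lim_{r→∞} u(r)/∫_r^∞ ψ(s)^{1−n} ds = |L|. -/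
open Real MeasureTheory Filter Set Asymptotics

noncomputable section

/-- [log(ψ'/ψ)]' is bounded as r → ∞. -/
def LogDerivBounded (ψ : ℝ → ℝ) : Prop :=
  ∃ C : ℝ, ∀ᶠ r in atTop, |deriv (fun s => Real.log (deriv ψ s / ψ s)) r| ≤ C

theorem monotoneOn_Ici_of_hasDerivAt_nonneg {f f' : ℝ → ℝ} {R : ℝ}
    (hf : ∀ r ≥ R, HasDerivAt f (f' r) r) (hf' : ∀ r ≥ R, 0 ≤ f' r) :
    MonotoneOn f (Ici R) := by
  refine monotoneOn_of_hasDerivWithinAt_nonneg (f' := f') (convex_Ici R)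
    (fun r hr => (hf r hr).continuousAt.continuousWithinAt) ?_ ?_
  · intro r hr
    exact (hf r (interior_subset hr)).hasDerivWithinAt
  · intro r hr
    exact hf' r (interior_subset hr)

theorem antitoneOn_Ici_of_hasDerivAt_nonpos {f f' : ℝ → ℝ} {R : ℝ}
    (hf : ∀ r ≥ R, HasDerivAt f (f' r) r) (hf' : ∀ r ≥ R, f' r ≤ 0) :
    AntitoneOn f (Ici R) := by
  have := monotoneOn_Ici_of_hasDerivAt_nonneg (f := fun r => -f r)
    (fun r hr => (hf r hr).neg) (fun r hr => neg_nonneg.2 (hf' r hr))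
  intro x hx y hy hxy
  exact neg_le_neg_iff.1 (this hx hy hxy)

theorem not_eventually_ge_of_integrableOn_Ioi {f : ℝ → ℝ} {a c : ℝ}
    (hf : IntegrableOn f (Ioi a)) (hc : 0 < c) : ¬ ∀ᶠ r in atTop, c ≤ f r := by
  intro h
  obtain ⟨R, hR⟩ := eventually_atTop.1 h
  have hint : IntegrableOn f (Ioi (max a R)) :=
    hf.mono_set (Ioi_subset_Ioi (le_max_left _ _))
  have hconst : IntegrableOn (fun _ : ℝ => c) (Ioi (max a R)) := by
    refine Integrable.mono' hint aestronglyMeasurable_const ?_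
    refine (ae_restrict_iff' measurableSet_Ioi).2 (Eventually.of_forall fun r hr => ?_)
    rw [Real.norm_of_nonneg hc.le]
    exact hR r ((le_max_right _ _).trans (le_of_lt hr))
  rw [integrableOn_const_iff] at hconst
  simp [hc.ne'] at hconst

theorem exists_tendsto_of_monotoneOn_Ici {f : ℝ → ℝ} {R C : ℝ}
    (hf : MonotoneOn f (Ici R)) (hC : ∀ r ≥ R, f r ≤ C) :
    ∃ l, f R ≤ l ∧ Tendsto f atTop (nhds l) := by
  have hmono : Monotone fun r => f (max r R) := fun x y hxy =>
    hf (mem_Ici.2 (le_max_right _ _)) (mem_Ici.2 (le_max_right _ _)) (max_le_max_right _ hxy)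
  have hbdd : BddAbove (range fun r => f (max r R)) := by
    refine ⟨C, ?_⟩
    rintro _ ⟨r, rfl⟩
    exact hC _ (le_max_right _ _)
  have hlim := tendsto_atTop_ciSup hmono hbdd
  have heq : (fun r => f (max r R)) =ᶠ[atTop] f := by
    filter_upwards [eventually_ge_atTop R] with r hr
    rw [max_eq_left hr]
  have hlim' := hlim.congr' heq
  refine ⟨_, ge_of_tendsto hlim' ?_, hlim'⟩
  filter_upwards [eventually_ge_atTop R] with r hr
  exact hf self_mem_Ici hr hr

theorem tendsto_atTop_of_logDeriv_ge {ψ a : ℝ → ℝ} {c : ℝ}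
    (hψ : ∀ r > 0, HasDerivAt ψ (a r * ψ r) r) (hpos : ∀ r > 0, 0 < ψ r) (hc : 0 < c)
    (ha : ∀ᶠ r in atTop, c ≤ a r) : Tendsto ψ atTop atTop := by
  obtain ⟨R, hR⟩ := eventually_atTop.1 (ha.and (eventually_gt_atTop 0))
  have hR0 : 0 < R := (hR R le_rfl).2
  have hmono : MonotoneOn ψ (Ici R) :=
    monotoneOn_Ici_of_hasDerivAt_nonneg (fun r hr => hψ r (hR r hr).2)
      (fun r hr => mul_nonneg (hc.le.trans (hR r hr).1) (hpos r (hR r hr).2).le)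
  have hlin : MonotoneOn (fun r => ψ r - c * ψ R * r) (Ici R) := by
    refine monotoneOn_Ici_of_hasDerivAt_nonneg
      (fun r hr => (hψ r (hR r hr).2).sub ((hasDerivAt_id r).const_mul (c * ψ R))) ?_
    intro r hr
    have h1 : ψ R ≤ ψ r := hmono self_mem_Ici hr hr
    have h2 := mul_le_mul (hR r hr).1 h1 (hpos R hR0).le (hc.le.trans (hR r hr).1)
    simpa using h2
  have hK : 0 < c * ψ R := mul_pos hc (hpos R hR0)
  refine tendsto_atTop_mono' atTop (f₁ := fun r => (ψ R - c * ψ R * R) + c * ψ R * r) ?_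
    (tendsto_atTop_add_const_left _ _ (tendsto_id.const_mul_atTop hK))
  filter_upwards [eventually_ge_atTop R] with r hr
  have := hlin self_mem_Ici hr hr
  simp only at this
  linarith

theorem pos_flux_and_tendsto_zero {N : ℕ} {p : ℝ} {ψ u v : ℝ → ℝ}
    (hψpos : ∀ r > 0, 0 < ψ r) (hψtop : Tendsto ψ atTop atTop)
    (hu : ∀ r > 0, HasDerivAt u (v r) r) (hupos : ∀ r > 0, 0 < u r)
    (hflux : ∀ r > 0, HasDerivAt (fun s => -(ψ s ^ N * v s))
      (ψ r ^ N * (u r ^ (p - 1) * u r)) r)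
    (hint : IntegrableOn (fun r => (u r ^ 2 + v r ^ 2) * ψ r ^ N) (Ioi 0)) :
    (∀ᶠ r in atTop, v r < 0) ∧ Tendsto u atTop (nhds 0) := by
  have hlow : ∀ c > 0, ¬ ∀ᶠ r in atTop, c ≤ u r := by
    intro c hc h
    refine not_eventually_ge_of_integrableOn_Ioi hint (pow_pos hc 2) ?_
    filter_upwards [h, hψtop.eventually_ge_atTop 1] with r hr h1
    have h2 : 1 ≤ ψ r ^ N := one_le_pow₀ h1
    nlinarith [sq_nonneg (v r), sq_nonneg (u r), mul_self_le_mul_self hc.le hr]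
  have hv : ∀ᶠ r in atTop, v r < 0 := by
    by_cases h : ∃ r > 0, v r < 0
    · obtain ⟨R, hR0, hR⟩ := h
      have hmono : MonotoneOn (fun s => -(ψ s ^ N * v s)) (Ici R) :=
        monotoneOn_Ici_of_hasDerivAt_nonneg (fun r hr => hflux r (lt_of_lt_of_le hR0 hr))
          (fun r hr => by
            have h1 := hψpos r (lt_of_lt_of_le hR0 hr)
            have h2 := hupos r (lt_of_lt_of_le hR0 hr)
            positivity)
      filter_upwards [eventually_ge_atTop R] with r hr
      have h1 := hmono self_mem_Ici hr hr
      simp only at h1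
      have h2 : 0 < ψ R ^ N := pow_pos (hψpos R hR0) N
      have h3 : 0 < ψ r ^ N := pow_pos (hψpos r (lt_of_lt_of_le hR0 hr)) N
      have h4 := mul_neg_of_pos_of_neg h2 hR
      by_contra! h5
      have h6 := mul_nonneg h3.le h5
      linarith
    · push Not at h
      exfalso
      have hmono : MonotoneOn u (Ici 1) :=
        monotoneOn_Ici_of_hasDerivAt_nonneg (fun r hr => hu r (lt_of_lt_of_le one_pos hr))
          (fun r hr => h r (lt_of_lt_of_le one_pos hr))
      refine hlow (u 1) (hupos 1 one_pos) ?_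
      filter_upwards [eventually_ge_atTop 1] with r hr
      exact hmono self_mem_Ici hr hr
  refine ⟨hv, ?_⟩
  obtain ⟨R, hR⟩ := eventually_atTop.1 (hv.and (eventually_gt_atTop 0))
  have hanti : AntitoneOn u (Ici R) :=
    antitoneOn_Ici_of_hasDerivAt_nonpos (fun r hr => hu r (hR r hr).2)
      (fun r hr => (hR r hr).1.le)
  refine Metric.tendsto_atTop.2 fun ε hε => ?_
  obtain ⟨r₀, hr₀, hlt⟩ : ∃ r₀ ≥ R, u r₀ < ε := by
    by_contra! h
    exact hlow ε hε (eventually_atTop.2 ⟨R, h⟩)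
  refine ⟨r₀, fun r hr => ?_⟩
  have h1 : u r ≤ u r₀ := hanti hr₀ (hr₀.trans hr) hr
  have h2 := hupos r (hR r (hr₀.trans hr)).2
  rw [Real.dist_eq, sub_zero, abs_of_pos h2]
  linarith

/-- Dichotomy for the sign of `u' + b u` when `b` is asymptotic to `a = ψ' / ψ`; finite energy
rules out the positive sign. -/
theorem eventually_deriv_add_mul_nonpos {N : ℕ} (hN : 2 ≤ N) {p : ℝ} (hp : 1 < p)
    {ψ a u v b b' : ℝ → ℝ} {c : ℝ}
    (hψ : ∀ r > 0, HasDerivAt ψ (a r * ψ r) r)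
    (hψpos : ∀ r > 0, 0 < ψ r) (hψtop : Tendsto ψ atTop atTop)
    (hu : ∀ r > 0, HasDerivAt u (v r) r) (hupos : ∀ r > 0, 0 < u r)
    (hv : ∀ r > 0, HasDerivAt v (-(N * a r * v r) - u r ^ (p - 1) * u r) r)
    (hint : IntegrableOn (fun r => (u r ^ 2 + v r ^ 2) * ψ r ^ N) (Ioi 0))
    (hvneg : ∀ᶠ r in atTop, v r < 0) (hu0 : Tendsto u atTop (nhds 0))
    (hc : 0 < c) (hac : ∀ᶠ r in atTop, c ≤ a r) (hbc : ∀ᶠ r in atTop, c ≤ b r)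
    (hb : ∀ᶠ r in atTop, HasDerivAt b (b' r) r)
    (hba : ∀ᶠ r in atTop, b r ≤ 5 / 4 * a r)
    (hb' : ∀ᶠ r in atTop, |b' r| ≤ 1 / 4 * (a r * b r)) :
    ∀ᶠ r in atTop, v r + b r * u r ≤ 0 := by
  have hup : ∀ᶠ r in atTop, u r ^ (p - 1) ≤ 1 / 4 * c ^ 2 := by
    have h := hu0.rpow_const (p := p - 1) (Or.inr (by linarith))
    rw [Real.zero_rpow (by linarith)] at h
    exact h.eventually_le_const (by positivity)
  obtain ⟨R, hR⟩ := eventually_atTop.1 (hvneg.and (hac.and (hbc.and (hb.and (hba.and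
    (hb'.and (hup.and ((eventually_gt_atTop 0).and (hψtop.eventually_ge_atTop 1)))))))))
  choose gv ga gb gbd gba gb' gup gpos gψ using hR
  have hrpow : ∀ s r, R ≤ r → HasDerivAt (fun r => ψ r ^ (s : ℝ)) (s * a r * ψ r ^ s) r := by
    intro s r hr
    have h0 := hψpos r (gpos r hr)
    have h := (hψ r (gpos r hr)).rpow_const (p := s) (Or.inl h0.ne')
    convert h using 1
    rw [Real.rpow_sub_one h0.ne']
    field_simp
  have hH : MonotoneOn (fun r => ψ r ^ (1 / 2 : ℝ) * (v r + b r * u r)) (Ici R) := by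
    refine monotoneOn_Ici_of_hasDerivAt_nonneg (fun r hr => (hrpow _ r hr).mul
      ((hv r (gpos r hr)).add ((gbd r hr).mul (hu r (gpos r hr))))) ?_
    intro r hr
    have h1 : 0 < ψ r ^ (1 / 2 : ℝ) := Real.rpow_pos_of_pos (hψpos r (gpos r hr)) _
    have hN' : (2 : ℝ) ≤ N := by exact_mod_cast hN
    have ha0 : 0 < a r := hc.trans_le (ga r hr)
    have hu1 := hupos r (gpos r hr)
    have hab : c ^ 2 ≤ a r * b r := by
      rw [sq]; exact mul_le_mul (ga r hr) (gb r hr) hc.le ha0.le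
    have h2 : 0 ≤ (-v r) * (N * a r - 1 / 2 * a r - b r) := by
      refine mul_nonneg (by linarith [gv r hr]) ?_
      nlinarith [gba r hr]
    have h3 : 0 ≤ u r * (1 / 2 * (a r * b r) + b' r - u r ^ (p - 1)) := by
      refine mul_nonneg hu1.le ?_
      linarith [(abs_le.1 (gb' r hr)).1, gup r hr]
    have h4 := mul_nonneg h1.le (add_nonneg h2 h3)
    refine h4.trans (le_of_eq ?_)
    ring
  have hB : AntitoneOn (fun r => ψ r ^ (-(1 / 4) : ℝ) * b r) (Ici R) := by
    refine antitoneOn_Ici_of_hasDerivAt_nonpos (fun r hr => (hrpow _ r hr).mul (gbd r hr)) ?_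
    intro r hr
    have h1 : 0 < ψ r ^ (-(1 / 4) : ℝ) := Real.rpow_pos_of_pos (hψpos r (gpos r hr)) _
    have h2 := mul_nonneg h1.le (sub_nonneg.2 ((le_abs_self _).trans (gb' r hr)))
    linarith
  refine eventually_atTop.2 ⟨R, fun r₁ hr₁ => ?_⟩
  by_contra! hpos
  have hK : 0 < ψ r₁ ^ (1 / 2 : ℝ) * (v r₁ + b r₁ * u r₁) :=
    mul_pos (Real.rpow_pos_of_pos (hψpos r₁ (gpos r₁ hr₁)) _) hpos
  set K := ψ r₁ ^ (1 / 2 : ℝ) * (v r₁ + b r₁ * u r₁) with hKdef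
  set C := ψ r₁ ^ (-(1 / 4) : ℝ) * b r₁ with hCdef
  have hC : 0 < C := mul_pos (Real.rpow_pos_of_pos (hψpos r₁ (gpos r₁ hr₁)) _)
    (hc.trans_le (gb r₁ hr₁))
  refine not_eventually_ge_of_integrableOn_Ioi hint (c := (K / C) ^ 2) (by positivity) ?_
  filter_upwards [eventually_ge_atTop r₁] with r hr
  have hrR : R ≤ r := hr₁.trans hr
  have h0 := hψpos r (gpos r hrR)
  have hu1 := hupos r (gpos r hrR)
  have e1 : K ≤ ψ r ^ (1 / 2 : ℝ) * (v r + b r * u r) := hH hr₁ hrR hr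
  have e2 : ψ r ^ (-(1 / 4) : ℝ) * b r ≤ C := hB hr₁ hrR hr
  have e3 : b r ≤ C * ψ r ^ (1 / 4 : ℝ) := by
    have h := mul_le_mul_of_nonneg_left e2 (Real.rpow_pos_of_pos h0 (1 / 4)).le
    rw [← mul_assoc, ← Real.rpow_add h0] at h
    norm_num at h
    linarith
  have e4 : K ≤ C * (ψ r ^ (3 / 4 : ℝ) * u r) := by
    have h5 : 0 < ψ r ^ (1 / 2 : ℝ) := Real.rpow_pos_of_pos h0 _
    calc K ≤ ψ r ^ (1 / 2 : ℝ) * (v r + b r * u r) := e1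
      _ ≤ ψ r ^ (1 / 2 : ℝ) * ((C * ψ r ^ (1 / 4 : ℝ)) * u r) := by
        refine mul_le_mul_of_nonneg_left ?_ h5.le
        have := mul_le_mul_of_nonneg_right e3 hu1.le
        linarith [gv r hrR]
      _ = C * ((ψ r ^ (1 / 2 : ℝ) * ψ r ^ (1 / 4 : ℝ)) * u r) := by ring
      _ = C * (ψ r ^ (3 / 4 : ℝ) * u r) := by
        rw [← Real.rpow_add h0]; norm_num
  have e5 : K / C ≤ ψ r ^ (3 / 4 : ℝ) * u r := by
    rw [div_le_iff₀ hC]; linarith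
  have e6 : ψ r ^ (3 / 4 : ℝ) ≤ ψ r := by
    simpa using Real.rpow_le_rpow_of_exponent_le (gψ r hrR) (by norm_num : (3 / 4 : ℝ) ≤ 1)
  have e7 : K / C ≤ ψ r * u r := e5.trans (mul_le_mul_of_nonneg_right e6 hu1.le)
  calc (K / C) ^ 2 ≤ (ψ r * u r) ^ 2 := pow_le_pow_left₀ (by positivity) e7 2
    _ = u r ^ 2 * ψ r ^ 2 := by ring
    _ ≤ u r ^ 2 * ψ r ^ N :=
      mul_le_mul_of_nonneg_left (pow_le_pow_right₀ (gψ r hrR) hN) (sq_nonneg _)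
    _ ≤ (u r ^ 2 + v r ^ 2) * ψ r ^ N :=
      mul_le_mul_of_nonneg_right (by linarith [sq_nonneg (v r)]) (by positivity)

theorem exists_tendsto_flux_of_deriv_le {N : ℕ} {p : ℝ} (hp : 1 < p) {ψ u v : ℝ → ℝ} {c : ℝ}
    (hψpos : ∀ r > 0, 0 < ψ r)
    (hu : ∀ r > 0, HasDerivAt u (v r) r) (hupos : ∀ r > 0, 0 < u r)
    (hflux : ∀ r > 0, HasDerivAt (fun s => -(ψ s ^ N * v s))
      (ψ r ^ N * (u r ^ (p - 1) * u r)) r)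
    (hc : 0 < c) (hvu : ∀ᶠ r in atTop, v r + c * u r ≤ 0) :
    ∃ l > 0, Tendsto (fun s => -(ψ s ^ N * v s)) atTop (nhds l) := by
  obtain ⟨R, hR⟩ := eventually_atTop.1 (hvu.and (eventually_gt_atTop 0))
  choose gvu gpos using hR
  have hw : ∀ r ≥ R, 0 < ψ r ^ N := fun r hr => pow_pos (hψpos r (gpos r hr)) N
  have hv : ∀ r ≥ R, v r < 0 := fun r hr => by
    have := mul_pos hc (hupos r (gpos r hr))
    linarith [gvu r hr]
  have hm : ∀ r ≥ R, 0 < -(ψ r ^ N * v r) := fun r hr =>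
    neg_pos.2 (mul_neg_of_pos_of_neg (hw r hr) (hv r hr))
  have hmono : MonotoneOn (fun s => -(ψ s ^ N * v s)) (Ici R) :=
    monotoneOn_Ici_of_hasDerivAt_nonneg (fun r hr => hflux r (gpos r hr))
      (fun r hr => by
        have h1 := hw r hr
        have h2 := hupos r (gpos r hr)
        positivity)
  set D := 1 / (c ^ 2 * (p - 1)) with hD
  have hp1 : 0 < p - 1 := by linarith
  have hanti : AntitoneOn (fun s => Real.log (-(ψ s ^ N * v s)) + D * u s ^ (p - 1)) (Ici R) := by
    refine antitoneOn_Ici_of_hasDerivAt_nonpos (fun r hr =>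
      ((hflux r (gpos r hr)).log (hm r hr).ne').add
        (((hu r (gpos r hr)).rpow_const (p := p - 1)
          (Or.inl (hupos r (gpos r hr)).ne')).const_mul D)) ?_
    intro r hr
    have hu1 := hupos r (gpos r hr)
    have hw1 := hw r hr
    have hv1 := hv r hr
    have hU : 0 < u r ^ (p - 1) := Real.rpow_pos_of_pos hu1 _
    have hq : c * u r ≤ -v r := by linarith [gvu r hr]
    have e1 : ψ r ^ N * (u r ^ (p - 1) * u r) / -(ψ r ^ N * v r) ≤ u r ^ (p - 1) / c := by
      rw [div_le_div_iff₀ (hm r hr) hc]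
      have := mul_le_mul_of_nonneg_left hq (mul_pos hw1 hU).le
      linarith
    have e2 : D * (v r * (p - 1) * u r ^ (p - 1 - 1)) ≤ -(u r ^ (p - 1) / c) := by
      have hDp : D * (p - 1) = 1 / c ^ 2 := by rw [hD]; field_simp
      rw [Real.rpow_sub_one hu1.ne']
      calc D * (v r * (p - 1) * (u r ^ (p - 1) / u r))
          = -((D * (p - 1)) * (u r ^ (p - 1) / u r) * (-v r)) := by ring
        _ ≤ -((1 / c ^ 2) * (u r ^ (p - 1) / u r) * (c * u r)) := by
          rw [hDp]
          exact neg_le_neg (mul_le_mul_of_nonneg_left hq (by positivity))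
        _ = -(u r ^ (p - 1) / c) := by field_simp
    linarith
  set M := Real.log (-(ψ R ^ N * v R)) + D * u R ^ (p - 1) with hM
  obtain ⟨l, hl, hlim⟩ := exists_tendsto_of_monotoneOn_Ici (C := Real.exp M) hmono (by
    intro r hr
    rw [← Real.log_le_iff_le_exp (hm r hr)]
    have h1 : Real.log (-(ψ r ^ N * v r)) + D * u r ^ (p - 1) ≤ M := hanti self_mem_Ici hr hr
    have hD0 : 0 < D := by positivity
    have h2 := mul_pos hD0 (Real.rpow_pos_of_pos (hupos r (gpos r hr)) (p - 1))
    linarith)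
  exact ⟨l, (hm R le_rfl).trans_le hl, hlim⟩

theorem tendsto_pow_mul_of_tendsto_flux {N : ℕ} (hN : N ≠ 0) {ψ a u v : ℝ → ℝ} {l L : ℝ}
    (hψ : ∀ r > 0, HasDerivAt ψ (a r * ψ r) r)
    (hψpos : ∀ r > 0, 0 < ψ r) (hψtop : Tendsto ψ atTop atTop)
    (hu : ∀ r > 0, HasDerivAt u (v r) r) (hu0 : Tendsto u atTop (nhds 0))
    (hl : 0 < l) (ha : Tendsto a atTop (nhds l))
    (hflux : Tendsto (fun s => -(ψ s ^ N * v s)) atTop (nhds L)) :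
    Tendsto (fun r => ψ r ^ N * u r) atTop (nhds (L / (N * l))) := by
  have hN' : (0 : ℝ) < N := by positivity
  have hd : ∀ r > 0, HasDerivAt (fun s => (ψ s ^ N)⁻¹) (-(N * a r) * (ψ r ^ N)⁻¹) r := by
    intro r hr
    have h0 := hψpos r hr
    refine (((hψ r hr).pow N).inv (pow_pos h0 N).ne').congr_deriv ?_
    obtain ⟨k, rfl⟩ := Nat.exists_eq_succ_of_ne_zero hN
    simp only [Nat.succ_eq_add_one, Nat.add_sub_cancel, Pi.pow_apply]
    field_simp
    ring
  have hlim := HasDerivAt.lhopital_zero_atTop (f := u) (g := fun s => (ψ s ^ N)⁻¹)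
    (l := nhds (L / (N * l)))
    (by filter_upwards [eventually_gt_atTop 0] with r hr using hu r hr)
    (by filter_upwards [eventually_gt_atTop 0] with r hr using hd r hr)
    (by
      filter_upwards [eventually_gt_atTop 0, ha.eventually_const_lt hl] with r hr har
      have := hψpos r hr
      exact mul_ne_zero (by simp [hN, har.ne']) (by positivity))
    hu0 ((tendsto_pow_atTop hN).comp hψtop).inv_tendsto_atTop
    (by
      refine (hflux.div (ha.const_mul (N : ℝ)) (by positivity)).congr' ?_
      filter_upwards [eventually_gt_atTop 0, ha.eventually_const_lt hl] with r hr har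
      have := hψpos r hr
      simp only [Pi.div_apply]
      field_simp)
  refine hlim.congr fun r => ?_
  rw [div_inv_eq_mul, mul_comm]

theorem tendsto_div_integral_of_tendsto_flux {N : ℕ} {ψ a u v : ℝ → ℝ} {L : ℝ}
    (hψ : ∀ r > 0, HasDerivAt ψ (a r * ψ r) r) (hψpos : ∀ r > 0, 0 < ψ r)
    (hu : ∀ r > 0, HasDerivAt u (v r) r) (hu0 : Tendsto u atTop (nhds 0))
    (hL : 0 < L) (hflux : Tendsto (fun s => -(ψ s ^ N * v s)) atTop (nhds L)) :
    Tendsto (fun r => u r / ∫ s in Ioi r, (ψ s ^ N)⁻¹) atTop (nhds L) := by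
  have hcont : ∀ r > 0, ContinuousAt (fun s => (ψ s ^ N)⁻¹) r := fun r hr =>
    ((hψ r hr).continuousAt.pow N).inv₀ (pow_pos (hψpos r hr) N).ne'
  obtain ⟨R, hR⟩ := eventually_atTop.1
    ((hflux.eventually_const_lt (half_lt_self hL)).and (eventually_gt_atTop 0))
  choose gm gpos using hR
  have hR0 : 0 < R := gpos R le_rfl
  have hle : ∀ r ≥ R, (ψ r ^ N)⁻¹ ≤ 2 / L * -v r := fun r hr => by
    have hw := pow_pos (hψpos r (gpos r hr)) N
    rw [inv_le_iff_one_le_mul₀ hw]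
    have h1 := mul_lt_mul_of_pos_left (gm r hr) (by positivity : 0 < 2 / L)
    have h2 : 2 / L * (L / 2) = 1 := by field_simp
    nlinarith
  have hv : ∀ r ≥ R, v r ≤ 0 := fun r hr => by
    have hw := pow_pos (hψpos r (gpos r hr)) N
    by_contra! h
    have := mul_pos hw h
    linarith [gm r hr]
  have hvint : IntegrableOn v (Ioi R) :=
    integrableOn_Ioi_deriv_of_nonpos (hu R hR0).continuousAt.continuousWithinAt
      (fun r hr => hu r (hR0.trans hr)) (fun r hr => hv r (le_of_lt hr)) hu0
  have hint : IntegrableOn (fun s => (ψ s ^ N)⁻¹) (Ioi R) := by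
    refine Integrable.mono' (hvint.neg.const_mul (2 / L)) ?_ ?_
    · exact ContinuousOn.aestronglyMeasurable
        (fun r hr => (hcont r (hR0.trans hr)).continuousWithinAt) measurableSet_Ioi
    · refine (ae_restrict_iff' measurableSet_Ioi).2 (Eventually.of_forall fun r hr => ?_)
      have hw := pow_pos (hψpos r (hR0.trans hr)) N
      rw [Real.norm_of_nonneg (by positivity)]
      exact hle r (le_of_lt hr)
  have hii : ∀ r ≥ R, IntervalIntegrable (fun s => (ψ s ^ N)⁻¹) volume R r := fun r hr =>
    (intervalIntegrable_iff_integrableOn_Ioc_of_le hr).2 (hint.mono_set Ioc_subset_Ioi_self)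
  have hsplit : ∀ r ≥ R, (∫ s in Ioi R, (ψ s ^ N)⁻¹) - ∫ s in R..r, (ψ s ^ N)⁻¹
      = ∫ s in Ioi r, (ψ s ^ N)⁻¹ := fun r hr => by
    rw [← intervalIntegral.integral_interval_add_Ioi hint
      (hint.mono_set (Ioi_subset_Ioi hr))]
    ring
  have hIlim : Tendsto (fun r => ∫ s in Ioi r, (ψ s ^ N)⁻¹) atTop (nhds 0) := by
    have h := (intervalIntegral_tendsto_integral_Ioi R hint tendsto_id).const_sub
      (∫ s in Ioi R, (ψ s ^ N)⁻¹)
    rw [sub_self] at h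
    refine h.congr' ?_
    filter_upwards [eventually_ge_atTop R] with r hr using hsplit r hr
  have hId : ∀ r > R, HasDerivAt (fun r => ∫ s in Ioi r, (ψ s ^ N)⁻¹) (-(ψ r ^ N)⁻¹) r := by
    intro r hr
    have h := (intervalIntegral.integral_hasDerivAt_right (hii r hr.le)
      (ContinuousOn.stronglyMeasurableAtFilter isOpen_Ioi
        (fun s hs => (hcont s hs).continuousWithinAt) r (hR0.trans hr))
      (hcont r (hR0.trans hr))).const_sub (∫ s in Ioi R, (ψ s ^ N)⁻¹)
    refine h.congr_of_eventuallyEq ?_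
    filter_upwards [eventually_gt_nhds hr] with s hs using (hsplit s hs.le).symm
  refine HasDerivAt.lhopital_zero_atTop (f' := v) (g' := fun r => -(ψ r ^ N)⁻¹)
    (by filter_upwards [eventually_gt_atTop 0] with r hr using hu r hr)
    (by filter_upwards [eventually_gt_atTop R] with r hr using hId r hr)
    (by
      filter_upwards [eventually_gt_atTop 0] with r hr
      have := hψpos r hr
      simp [this.ne'])
    hu0 hIlim (hflux.congr fun r => ?_)
  rw [div_neg, div_inv_eq_mul, mul_comm]

theorem ContDiffOn.hasDerivAt_of_Ici {f : ℝ → ℝ} (hf : ContDiffOn ℝ 2 f (Ici 0)) {r : ℝ}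
    (hr : 0 < r) : HasDerivAt f (deriv f r) r :=
  ((hf.contDiffAt (Ici_mem_nhds hr)).differentiableAt (by norm_num)).hasDerivAt

theorem ContDiffOn.hasDerivAt_deriv_of_Ici {f : ℝ → ℝ} (hf : ContDiffOn ℝ 2 f (Ici 0)) {r : ℝ}
    (hr : 0 < r) : HasDerivAt (deriv f) (deriv (deriv f) r) r := by
  have h : ContDiffAt ℝ (1 + 1) f r := (hf.contDiffAt (Ici_mem_nhds hr)).of_le (by norm_num)
  exact ((h.derivWithin le_rfl).differentiableAt one_ne_zero).hasDerivAt

/-- Fast decay of positive finite-energy radial solutions in the subcritical case. -/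
theorem statement6 (n : ℕ) (hn : 3 ≤ n) (p : ℝ) (hp : 1 < p)
    (hsub : p < ((n : ℝ) + 2) / ((n : ℝ) - 2)) (ψ : ℝ → ℝ)
    (h1 : H1 ψ) (h2 : H2 ψ)
    (hl : (∃ l : ℝ, 0 < l ∧ Tendsto (fun r => deriv ψ r / ψ r) atTop (nhds l)) ∨
          (Tendsto (fun r => deriv ψ r / ψ r) atTop atTop ∧ LogDerivBounded ψ))
    (u : ℝ → ℝ) (α : ℝ) (hu : IsRadialSolution n p ψ u α)
    (hupos : ∀ r ≥ (0:ℝ), 0 < u r) (huH1 : InEnergySpace n ψ u) :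
    ∃ L : ℝ, L < 0 ∧
      Tendsto (fun r => ψ r ^ (n - 1) * deriv u r) atTop (nhds L) ∧
      (∀ l : ℝ, 0 < l → Tendsto (fun r => deriv ψ r / ψ r) atTop (nhds l) →
        Tendsto (fun r => ψ r ^ (n - 1) * u r) atTop
          (nhds (|L| / (((n : ℝ) - 1) * l)))) ∧
      (Tendsto (fun r => deriv ψ r / ψ r) atTop atTop →
        Tendsto (fun r => u r / ∫ s in Ioi r, ψ s ^ ((1 : ℝ) - (n : ℝ))) atTop
          (nhds |L|)) := by
  obtain ⟨N, rfl⟩ : ∃ N, n = N + 1 := ⟨n - 1, by omega⟩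
  have hN : 2 ≤ N := by omega
  have hcast : ((N + 1 : ℕ) : ℝ) - 1 = N := by push_cast; ring
  obtain ⟨hψ2, -, -, -, hψpos⟩ := h1
  obtain ⟨hu2, -, -, hode⟩ := hu
  simp only [InEnergySpace, Nat.add_sub_cancel] at huH1
  simp only [Nat.add_sub_cancel]
  rw [hcast] at hode ⊢
  set a : ℝ → ℝ := fun r => deriv ψ r / ψ r with ha
  have hψd : ∀ r > 0, HasDerivAt ψ (a r * ψ r) r := fun r hr => by
    rw [ha, div_mul_cancel₀ _ (hψpos r hr).ne']
    exact hψ2.hasDerivAt_of_Ici hr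
  have hupos' : ∀ r > 0, 0 < u r := fun r hr => hupos r (le_of_lt hr)
  have hud : ∀ r > 0, HasDerivAt u (deriv u r) r := fun r hr => hu2.hasDerivAt_of_Ici hr
  have hvd : ∀ r > 0,
      HasDerivAt (deriv u) (-(N * a r * deriv u r) - u r ^ (p - 1) * u r) r := fun r hr => by
    convert hu2.hasDerivAt_deriv_of_Ici hr using 1
    have := hode r hr
    rw [abs_of_pos (hupos' r hr)] at this
    linarith
  have hflux : ∀ r > 0, HasDerivAt (fun s => -(ψ s ^ N * deriv u s))
      (ψ r ^ N * (u r ^ (p - 1) * u r)) r := fun r hr => by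
    refine (((hψd r hr).pow N).mul (hvd r hr)).neg.congr_deriv ?_
    obtain ⟨k, rfl⟩ : ∃ k, N = k + 1 := ⟨N - 1, by omega⟩
    simp only [Nat.add_sub_cancel, Pi.pow_apply]
    ring
  obtain ⟨c, hc, hac⟩ : ∃ c > 0, ∀ᶠ r in atTop, c ≤ a r := by
    rcases hl with ⟨l, hl0, hl⟩ | ⟨hl, -⟩
    · exact ⟨l / 2, half_pos hl0, hl.eventually_const_le (half_lt_self hl0)⟩
    · exact ⟨1, one_pos, hl.eventually_ge_atTop 1⟩
  have hψtop := tendsto_atTop_of_logDeriv_ge hψd hψpos hc hac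
  obtain ⟨hvneg, hu0⟩ := pos_flux_and_tendsto_zero hψpos hψtop hud hupos' hflux huH1
  obtain ⟨d, hd, hvu⟩ : ∃ d > 0, ∀ᶠ r in atTop, deriv u r + d * u r ≤ 0 := by
    rcases hl with ⟨l, hl0, hl⟩ | ⟨hl, C, hC⟩
    · refine ⟨l, hl0, eventually_deriv_add_mul_nonpos (b := fun _ => l) (b' := fun _ => 0)
        (c := min c l) hN hp hψd hψpos hψtop hud hupos' hvd huH1 hvneg hu0 (lt_min hc hl0)
        (hac.mono fun r hr => (min_le_left _ _).trans hr)
        (Eventually.of_forall fun r => min_le_right _ _)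
        (Eventually.of_forall fun r => hasDerivAt_const _ _) ?_ ?_⟩
      · filter_upwards [hl.eventually_const_le (by linarith : 4 / 5 * l < l)] with r hr
        linarith
      · filter_upwards [hac] with r hr
        have := hc.trans_le hr
        rw [abs_zero]
        positivity
    · refine ⟨1, one_pos, ?_⟩
      have had : ∀ r > 0, DifferentiableAt ℝ a r := fun r hr =>
        (hψ2.hasDerivAt_deriv_of_Ici hr).differentiableAt.div (hψd r hr).differentiableAt
          (hψpos r hr).ne'
      have key := eventually_deriv_add_mul_nonpos (b := a) (b' := deriv a)
        hN hp hψd hψpos hψtop hud hupos' hvd huH1 hvneg hu0 hc hac hac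
        ((eventually_gt_atTop 0).mono fun r hr => (had r hr).hasDerivAt)
        (hac.mono fun r hr => by linarith)
        (by
          filter_upwards [hC, eventually_gt_atTop 0, hl.eventually_ge_atTop (4 * C), hac]
            with r hr hr0 hrC hrc
          have har : 0 < a r := hc.trans_le hrc
          have hlog : deriv (fun s => Real.log (deriv ψ s / ψ s)) r = deriv a r / a r :=
            ((had r hr0).hasDerivAt.log har.ne').deriv
          rw [hlog, abs_div, abs_of_pos har, div_le_iff₀ har] at hr
          have h4 : 4 * C ≤ a r := hrC
          nlinarith)
      filter_upwards [key, hl.eventually_ge_atTop 1, eventually_gt_atTop 0] with r hr ha1 hr0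
      have ha1' : 1 ≤ a r := ha1
      have := mul_le_mul_of_nonneg_right ha1' (hupos' r hr0).le
      linarith
  obtain ⟨L, hL, hlim⟩ := exists_tendsto_flux_of_deriv_le hp hψpos hud hupos' hflux hd hvu
  refine ⟨-L, neg_neg_of_pos hL, ?_, ?_, ?_⟩
  · simpa using hlim.neg
  · intro l hl0 hal
    rw [abs_neg, abs_of_pos hL]
    exact tendsto_pow_mul_of_tendsto_flux (by omega) hψd hψpos hψtop hud hu0 hl0 hal hlim
  · intro _
    rw [abs_neg, abs_of_pos hL]
    refine (tendsto_div_integral_of_tendsto_flux hψd hψpos hud hu0 hL hlim).congr' ?_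
    filter_upwards [eventually_gt_atTop 0] with r hr
    congr 1
    refine setIntegral_congr_fun measurableSet_Ioi fun s hs => ?_
    have hexp : (1 : ℝ) - ((N + 1 : ℕ) : ℝ) = -(N : ℝ) := by push_cast; ring
    simp only [hexp, Real.rpow_neg (hψpos s (hr.trans hs)).le, Real.rpow_natCast]
end
end
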